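/- Let R be a two-dimensional regular local ring with infinite residue field, let I be an integrally closed R-ideal, and let φ be a matrix with n rows presenting I. Then core(I) = I_{n−2}(φ)·I, and moreover both I_{n−2}(φ) and core(I) are integrally closed. -/

import Mathlib

open IsLocalRing

universe u v

namespace CPU

section Defs

variable {R : Type u} [CommRing R]

/-- The minimal number of generators of a submodule, as an extended natural number. -/
noncomputable def muE {M : Type v} [AddCommGroup M] [Module R M] (N : Submodule R M) : ℕ∞ :=
  sInf {n : ℕ∞ | ∃ s : Finset M, (s.card : ℕ∞) = n ∧ Submodule.span R (s : Set M) = N}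

/-- The Krull dimension of a ring, valued in `WithBot ℕ∞`. -/
noncomputable def rDim (S : Type v) [CommRing S] : WithBot ℕ∞ :=
  ringKrullDim S

/-- `J` is a reduction of `I`. -/
def IsReduction (J I : Ideal R) : Prop :=
  J ≤ I ∧ ∃ r : ℕ, I ^ (r + 1) = J * I ^ r

/-- `J` is a minimal reduction of `I`. -/
def IsMinimalReduction (J I : Ideal R) : Prop :=
  IsReduction J I ∧ ∀ J' : Ideal R, IsReduction J' I → J' ≤ J → J' = J

/-- The core of an ideal: the intersection of all of its minimal reductions. -/
noncomputable def core (I : Ideal R) : Ideal R :=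
  sInf {J : Ideal R | IsMinimalReduction J I}

/-- The reduction number of `I`. -/
noncomputable def reductionNumber (I : Ideal R) : ℕ∞ :=
  sInf {n : ℕ∞ | ∃ r : ℕ, (r : ℕ∞) = n ∧ ∃ J : Ideal R,
    IsMinimalReduction J I ∧ I ^ (r + 1) = J * I ^ r}

/-- `γ(I)`: the least number of minimal reductions whose intersection is the core. -/
noncomputable def gamma (I : Ideal R) : ℕ∞ :=
  sInf {n : ℕ∞ | ∃ t : ℕ, (t : ℕ∞) = n ∧ ∃ Js : Fin t → Ideal R,
    (∀ i, IsMinimalReduction (Js i) I) ∧ core I = ⨅ i, Js i}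

/-- The height of an ideal. -/
noncomputable def ht (I : Ideal R) : WithBot ℕ∞ :=
  ⨅ (p : PrimeSpectrum R) (_ : I ≤ p.asIdeal),
    rDim (Localization.AtPrime p.asIdeal)

/-- The Krull dimension of the special fiber ring of `I`,
i.e. the analytic spread of `I`. -/
noncomputable def fiberDim [IsLocalRing R] (I : Ideal R) : WithBot ℕ∞ :=
  rDim (↥(reesAlgebra I) ⧸
    (Ideal.map (algebraMap R ↥(reesAlgebra I)) (maximalIdeal R)))

/-- The condition `G_s`. -/
def Gcond (I : Ideal R) (s : ℕ) : Prop :=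
  ∀ p : PrimeSpectrum R, I ≤ p.asIdeal →
    rDim (Localization.AtPrime p.asIdeal) < (s : WithBot ℕ∞) →
    (muE (Ideal.map (algebraMap R (Localization.AtPrime p.asIdeal)) I) : WithBot ℕ∞) ≤
      rDim (Localization.AtPrime p.asIdeal)

/-- Depth of a module over a local ring, via lengths of regular sequences in the
maximal ideal. -/
noncomputable def mDepth (R : Type u) [CommRing R] [IsLocalRing R]
    (M : Type v) [AddCommGroup M] [Module R M] : ℕ∞ :=
  sSup {n : ℕ∞ | ∃ rs : List R, (∀ x ∈ rs, x ∈ maximalIdeal R) ∧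
    RingTheory.Sequence.IsRegular M rs ∧ (rs.length : ℕ∞) = n}

/-- Depth of the quotient `R/K` of a local ring `R`. -/
noncomputable def qDepth (R : Type u) [CommRing R] [IsLocalRing R] (K : Ideal R) : ℕ∞ :=
  mDepth R (R ⧸ K)

/-- The socle of `R/K`, for `R` local. -/
noncomputable def socle (R : Type u) [CommRing R] [IsLocalRing R] (K : Ideal R) :
    Ideal (R ⧸ K) :=
  Submodule.colon (⊥ : Ideal (R ⧸ K)) (Ideal.map (Ideal.Quotient.mk K) (maximalIdeal R))

/-- The Cohen–Macaulay type of the quotient `R/K` of a local ring `R`. -/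
noncomputable def qType (R : Type u) [CommRing R] [IsLocalRing R] (K : Ideal R) : ℕ∞ :=
  sInf {n : ℕ∞ | ∃ rs : List R, (∀ x ∈ rs, x ∈ maximalIdeal R) ∧
    RingTheory.Sequence.IsRegular (R ⧸ K) rs ∧ (rs.length : ℕ∞) = qDepth R K ∧
    muE (socle R (K ⊔ Ideal.ofList rs)) = n}

/-- Cohen–Macaulayness for a quotient `R/K` of a local ring `R`. -/
def IsCMQuot (R : Type u) [CommRing R] [IsLocalRing R] (K : Ideal R) : Prop :=
  rDim (R ⧸ K) = (qDepth R K : WithBot ℕ∞)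

/-- A Cohen–Macaulay local ring: depth equals Krull dimension. -/
def IsCMLocalRing (R : Type u) [CommRing R] [IsLocalRing R] : Prop :=
  rDim R = (qDepth R (⊥ : Ideal R) : WithBot ℕ∞)

/-- A Gorenstein local ring: Cohen–Macaulay of type one. -/
def IsGorensteinLocalRing (R : Type u) [CommRing R] [IsLocalRing R] : Prop :=
  IsCMLocalRing R ∧ qType R (⊥ : Ideal R) = 1

/-- Gorensteinness of the quotient ring `R/K` of a local ring. -/
def IsGorQuot (R : Type u) [CommRing R] [IsLocalRing R] (K : Ideal R) : Prop :=
  IsCMQuot R K ∧ qType R K = 1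

/-- A regular local ring: the maximal ideal is generated by `dim R` elements. -/
def IsRegularLocal (R : Type u) [CommRing R] [IsLocalRing R] : Prop :=
  IsNoetherianRing R ∧ (muE (maximalIdeal R) : WithBot ℕ∞) = rDim R

/-- Serre's condition `S₂` for the quotient ring `R/K`. -/
def QuotS2 (K : Ideal R) : Prop :=
  ∀ (q : Ideal R) (hq : q.IsPrime), K ≤ q →
    letI := hq
    min 2 (rDim ((Localization.AtPrime q) ⧸
        (Ideal.map (algebraMap R (Localization.AtPrime q)) K)))
      ≤ (qDepth (Localization.AtPrime q)
          (Ideal.map (algebraMap R (Localization.AtPrime q)) K) : WithBot ℕ∞)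

/-- `K` is an `s`-residual intersection of `I`. -/
def IsResidualIntersection (I K : Ideal R) (s : ℕ) : Prop :=
  K ≠ ⊤ ∧ ht I ≤ (s : WithBot ℕ∞) ∧ (s : WithBot ℕ∞) ≤ ht K ∧
    ∃ a : Ideal R, a ≤ I ∧ (∃ f : Finset R, f.card ≤ s ∧ Ideal.span (f : Set R) = a) ∧
      K = Submodule.colon a I

/-- `K` is a geometric `s`-residual intersection of `I`. -/
def IsGeometricRI (I K : Ideal R) (s : ℕ) : Prop :=
  IsResidualIntersection I K s ∧ (s : WithBot ℕ∞) + 1 ≤ ht (I ⊔ K)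

/-- `I` is weakly `s`-residually `S₂`. -/
def WeaklyResS2 (I : Ideal R) (s : ℕ) : Prop :=
  ∀ i ≤ s, ∀ K : Ideal R, IsGeometricRI I K i → QuotS2 K

/-- The condition `AN_s` for `I`. -/
def ANcond [IsLocalRing R] (I : Ideal R) (s : ℕ) : Prop :=
  ∀ i ≤ s, ∀ K : Ideal R, IsResidualIntersection I K i → IsCMQuot R K

/-- The condition `AN_s⁻` for `I`. -/
def ANminus [IsLocalRing R] (I : Ideal R) (s : ℕ) : Prop :=
  ∀ i ≤ s, ∀ K : Ideal R, IsGeometricRI I K i → IsCMQuot R K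

/-- `I` is universally weakly `s`-residually `S₂`: for every finite set of
variables, the extension of `I` to `R(x₁, …, x_n)` is weakly `s`-residually `S₂`. -/
def UnivWeaklyResS2 [IsLocalRing R] (I : Ideal R) (s : ℕ) : Prop :=
  ∀ (n : ℕ)
    (hP : (Ideal.map (MvPolynomial.C (σ := Fin n)) (maximalIdeal R)).IsPrime),
    letI := hP
    WeaklyResS2 (Ideal.map
      ((algebraMap (MvPolynomial (Fin n) R)
        (Localization.AtPrime
          (Ideal.map (MvPolynomial.C (σ := Fin n)) (maximalIdeal R)))).comp
        (MvPolynomial.C)) I) s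

/-- The `j`-th Fitting ideal of (the module) `I`. -/
noncomputable def fittingIdeal (I : Ideal R) (j : ℕ) : Ideal R :=
  ⨆ (n : ℕ) (π : (Fin n → R) →ₗ[R] R) (_ : LinearMap.range π = I),
    Ideal.span {d : R | ∃ (v : Fin (n - j) → (Fin n → R)) (r : Fin (n - j) → Fin n),
      (∀ k, π (v k) = 0) ∧ d = Matrix.det (Matrix.of fun i k => v k (r i))}

/-- The set `Q(I)` of primes containing `Fitt_ℓ(I)` at which `R` has dimension `ℓ`
and `I` has analytic spread `ℓ`. -/
def QSet [IsLocalRing R] (I : Ideal R) (l : ℕ) : Set (PrimeSpectrum R) :=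
  {p | fittingIdeal I l ≤ p.asIdeal ∧
    rDim (Localization.AtPrime p.asIdeal) = (l : WithBot ℕ∞) ∧
    fiberDim (Ideal.map (algebraMap R (Localization.AtPrime p.asIdeal)) I)
      = (l : WithBot ℕ∞)}

/-- An ideal is integrally closed if it admits no larger ideal of which it is a
reduction. -/
def IsIntClosedIdeal (I : Ideal R) : Prop :=
  ∀ J : Ideal R, IsReduction I J → J = I

/-- A normal ideal: all powers are integrally closed. -/
def IsNormalIdeal (I : Ideal R) : Prop :=
  ∀ j : ℕ, IsIntClosedIdeal (I ^ j)

/-- `φ` is a presentation matrix of the ideal `I` (with `n = μ(I)` rows). -/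
def Presents {n m : ℕ} (φ : Matrix (Fin n) (Fin m) R) (I : Ideal R) : Prop :=
  muE I = (n : ℕ∞) ∧ ∃ π : (Fin n → R) →ₗ[R] R, LinearMap.range π = I ∧
    LinearMap.range (Matrix.toLin' φ) = LinearMap.ker π

/-- The ideal of `t × t` minors of a matrix. -/
noncomputable def minorsIdeal {n m : ℕ} (t : ℕ) (φ : Matrix (Fin n) (Fin m) R) : Ideal R :=
  Ideal.span {d : R | ∃ (r : Fin t → Fin n) (c : Fin t → Fin m),
    d = (φ.submatrix r c).det}

/-- The grade of an ideal: the supremum of lengths of regular sequences contained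
in it. -/
noncomputable def grade (I : Ideal R) : ℕ∞ :=
  sSup {n : ℕ∞ | ∃ rs : List R, (∀ x ∈ rs, x ∈ I) ∧
    RingTheory.Sequence.IsRegular R rs ∧ (rs.length : ℕ∞) = n}

end Defs

/-- `M` has projective dimension at most `n` over `R`. -/
def ProjDimLE (R : Type u) [CommRing R] :
    (n : ℕ) → (M : Type u) → [AddCommGroup M] → [Module R M] → Prop
  | 0, M, _, _ => Module.Projective R M
  | n + 1, M, _, _ => ∃ (k : ℕ) (f : (Fin k → R) →ₗ[R] M), Function.Surjective f ∧
      ProjDimLE R n ↥(LinearMap.ker f)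

section Defs2

variable {R : Type u} [CommRing R]

/-- `M` has projective dimension exactly `n` over `R`. -/
def ProjDimEq (R : Type u) [CommRing R] (M : Type u) [AddCommGroup M] [Module R M]
    (n : ℕ) : Prop :=
  ProjDimLE R n M ∧ ∀ m : ℕ, ProjDimLE R m M → n ≤ m

/-- A perfect ideal: the projective dimension of `R/I` equals the grade of `I`. -/
def IsPerfectIdeal (I : Ideal R) : Prop :=
  ∃ g : ℕ, grade I = (g : ℕ∞) ∧ ProjDimEq R (R ⧸ I) g

/-- The multiplicative set which is the complement of the union of the associated
primes of `R/H`. -/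
def assComplement (H : Ideal R) : Submonoid R where
  carrier := {r : R | ∀ p ∈ associatedPrimes R (R ⧸ H), r ∉ p}
  one_mem' := fun p hp => (Ideal.ne_top_iff_one p).mp hp.1.ne_top
  mul_mem' := fun {a b} ha hb p hp hab =>
    (hp.1.mem_or_mem hab).elim (ha p hp) (hb p hp)

/-- The `j`-th symbolic power of `H`. -/
noncomputable def symbolicPower (H : Ideal R) (j : ℕ) : Ideal R :=
  Ideal.comap (algebraMap R (Localization (assComplement H)))
    (Ideal.map (algebraMap R (Localization (assComplement H))) (H ^ j))

/-- Serre's condition `S₂` for a module. -/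
def ModuleS2 (S : Type u) [CommRing S] (M : Type v) [AddCommGroup M] [Module S M] : Prop :=
  ∀ (q : Ideal S) (hq : q.IsPrime),
    letI := hq
    min 2 (rDim ((Localization.AtPrime q) ⧸
        (Module.annihilator (Localization.AtPrime q) (LocalizedModule q.primeCompl M))))
      ≤ (mDepth (Localization.AtPrime q) (LocalizedModule q.primeCompl M) : WithBot ℕ∞)

/-- `M` is a maximal Cohen–Macaulay `S`-module. -/
def IsMCM (S : Type u) [CommRing S] (M : Type v) [AddCommGroup M] [Module S M] : Prop :=
  ∀ (q : Ideal S) (hq : q.IsMaximal),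
    letI := hq.isPrime
    (mDepth (Localization.AtPrime q) (LocalizedModule q.primeCompl M) : WithBot ℕ∞) =
      rDim (Localization.AtPrime q)

end Defs2

set_option linter.all false
section P0
variable {R : Type u} [CommRing R] [IsNoetherianRing R] [IsLocalRing R]

/-- Regular parameters. -/
structure Par (x y : R) : Prop where
  spn : maximalIdeal R = Ideal.span {x, y}
  prm : Prime x
  ndvd : ¬ x ∣ y

lemma mem_m_iff {x y : R} (h : maximalIdeal R = Ideal.span {x, y}) (z : R) :
    z ∈ maximalIdeal R ↔ ∃ p q, z = p * x + q * y := by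
  rw [h, Ideal.mem_span_pair]
  constructor <;> rintro ⟨a, b, h⟩ <;> exact ⟨a, b, h.symm⟩

lemma unit_or_mem (z : R) : IsUnit z ∨ z ∈ maximalIdeal R := by
  by_cases h : IsUnit z
  · exact Or.inl h
  · exact Or.inr h

lemma decomp {x y : R} (h : maximalIdeal R = Ideal.span {x, y}) (p : R) (hp : ¬ x ∣ p) :
    ∃ (i : ℕ) (c w : R), IsUnit c ∧ p = c * y ^ i + x * w := by
  by_contra hcon
  push Not at hcon
  have key : ∀ n : ℕ, ∃ q w, p = q * y ^ n + x * w := by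
    intro n
    induction n with
    | zero => exact ⟨p, 0, by simp⟩
    | succ n ih =>
      obtain ⟨q, w, hq⟩ := ih
      rcases unit_or_mem q with hu | hm
      · exact absurd hq (hcon n q w hu)
      · obtain ⟨s, t, rfl⟩ := (mem_m_iff h q).1 hm
        exact ⟨t, w + s * y ^ n, by rw [hq]; ring⟩
  have hkr := Ideal.iInf_pow_smul_eq_bot_of_isLocalRing (M := R ⧸ Ideal.span {x}) (maximalIdeal R)
    (maximalIdeal.isMaximal R).ne_top
  have hmem : (Ideal.Quotient.mk (Ideal.span {x}) p) ∈
      (⨅ i, (maximalIdeal R) ^ i • (⊤ : Submodule R (R ⧸ Ideal.span {x}))) := by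
    rw [Submodule.mem_iInf]
    intro n
    obtain ⟨q, w, hq⟩ := key n
    have hy : y ∈ maximalIdeal R := (mem_m_iff h y).2 ⟨0, 1, by ring⟩
    have : Ideal.Quotient.mk (Ideal.span {x}) p = (y ^ n) • (Ideal.Quotient.mk (Ideal.span {x}) q) := by
      rw [← Ideal.Quotient.mk_eq_mk, ← Ideal.Quotient.mk_eq_mk, ← Submodule.Quotient.mk_smul,
        Submodule.Quotient.eq, Ideal.mem_span_singleton, hq]
      exact ⟨w, by simp [smul_eq_mul]; ring⟩
    rw [this]
    exact Submodule.smul_mem_smul (Ideal.pow_mem_pow hy n) trivial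
  rw [hkr, Submodule.mem_bot, Ideal.Quotient.eq_zero_iff_mem, Ideal.mem_span_singleton] at hmem
  exact hp hmem

lemma dvd_or_of {x y : R} (h : maximalIdeal R = Ideal.span {x, y}) (hn : ∀ n : ℕ, ¬ x ∣ y ^ n)
    (p q : R) (hpq : x ∣ p * q) : x ∣ p ∨ x ∣ q := by
  by_contra hcon
  push Not at hcon
  obtain ⟨i, c, w, hc, rfl⟩ := decomp h p hcon.1
  obtain ⟨j, d, v, hd, rfl⟩ := decomp h q hcon.2
  apply hn (i + j)
  have : x ∣ (c * d) * y ^ (i + j) := by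
    have h2 : x ∣ x * (w * (d * y ^ j + x * v) + c * y ^ i * v) := Dvd.intro _ rfl
    have := dvd_sub hpq h2
    convert this using 1
    ring
  exact (hc.mul hd).dvd_mul_left.1 this

lemma Par.x_mem {x y : R} (h : Par x y) : x ∈ maximalIdeal R := (mem_m_iff h.spn x).2 ⟨1, 0, by ring⟩
lemma Par.y_mem {x y : R} (h : Par x y) : y ∈ maximalIdeal R := (mem_m_iff h.spn y).2 ⟨0, 1, by ring⟩

lemma Par.ndvd_pow {x y : R} (h : Par x y) (n : ℕ) : ¬ x ∣ y ^ n :=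
  fun hd => h.ndvd (h.prm.dvd_of_dvd_pow hd)

lemma par_of {x y : R} (h : maximalIdeal R = Ideal.span {x, y}) (h0 : x ≠ 0)
    (hn : ∀ n : ℕ, ¬ x ∣ y ^ n) : Par x y := by
  refine ⟨h, ⟨h0, ?_, dvd_or_of h hn⟩, by simpa using hn 1⟩
  exact (mem_m_iff h x).2 ⟨1, 0, by ring⟩

variable [IsDomain R]

lemma Par.symm {x y : R} (h : Par x y) : Par y x := by
  have hy0 : y ≠ 0 := fun h0 => h.ndvd (h0 ▸ dvd_zero x)
  refine par_of (by rw [h.spn, Set.pair_comm]) hy0 ?_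
  intro n hd
  obtain ⟨i, -, hi⟩ := (dvd_prime_pow h.prm n).1 hd
  rcases Nat.eq_zero_or_pos i with rfl | hi0
  · rw [pow_zero] at hi
    exact h.y_mem (hi.isUnit_iff.2 isUnit_one)
  · exact h.ndvd ((dvd_pow_self x hi0.ne').trans hi.symm.dvd)

lemma Par.change {x y : R} (h : Par x y) (c : R) : Par (x - c * y) y := by
  have hm : x - c * y ∈ maximalIdeal R := (mem_m_iff h.spn _).2 ⟨1, -c, by ring⟩
  refine par_of ?_ ?_ ?_
  · apply le_antisymm
    · rw [h.spn, Ideal.span_le]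
      rintro z (rfl | rfl)
      · exact Ideal.mem_span_pair.2 ⟨1, c, by ring⟩
      · exact Ideal.mem_span_pair.2 ⟨0, 1, by ring⟩
    · rw [Ideal.span_le]
      rintro z (rfl | rfl)
      · exact hm
      · exact h.y_mem
  · intro h0
    have hx : x = c * y := by linear_combination h0
    rcases h.prm.irreducible.isUnit_or_isUnit hx with hc | hy
    · exact h.ndvd ((hc.dvd_mul_left).1 (hx ▸ dvd_rfl))
    · exact h.y_mem hy
  · intro n hd
    have h1 : x - c * y ∣ x ^ n := by
      have h2 : x - c * y ∣ x ^ n - (c * y) ^ n := sub_dvd_pow_sub_pow _ _ n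
      have h3 : x - c * y ∣ (c * y) ^ n := by rw [mul_pow]; exact hd.mul_left _
      have := dvd_add h2 h3
      simpa using this
    obtain ⟨i, -, hi⟩ := (dvd_prime_pow h.prm n).1 h1
    rcases Nat.eq_zero_or_pos i with rfl | hi0
    · rw [pow_zero] at hi
      exact hm (hi.isUnit_iff.2 isUnit_one)
    · exact h.ndvd_pow n (((dvd_pow_self x hi0.ne').trans hi.symm.dvd).trans hd)

end P0

section P0b
variable {R : Type u} [CommRing R] [IsNoetherianRing R] [IsLocalRing R]

lemma mem_pow_succ {x y : R} (h : maximalIdeal R = Ideal.span {x, y}) (d : ℕ) (f : R) :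
    f ∈ maximalIdeal R ^ (d + 1) ↔ ∃ g ∈ maximalIdeal R ^ d, ∃ c, f = x * g + c * y ^ (d + 1) := by
  have hx : x ∈ maximalIdeal R := (mem_m_iff h x).2 ⟨1, 0, by ring⟩
  have hy : y ∈ maximalIdeal R := (mem_m_iff h y).2 ⟨0, 1, by ring⟩
  constructor
  · induction d generalizing f with
    | zero =>
      intro hf
      rw [zero_add, pow_one] at hf
      obtain ⟨p, q, rfl⟩ := (mem_m_iff h f).1 hf
      exact ⟨p, by simp, q, by ring⟩
    | succ d ih =>
      intro hf
      rw [pow_succ'] at hf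
      refine Submodule.mul_induction_on hf ?_ ?_
      · intro m hm n hn
        obtain ⟨p, q, rfl⟩ := (mem_m_iff h m).1 hm
        obtain ⟨g, hg, c, rfl⟩ := ih n hn
        refine ⟨p * (x * g + c * y ^ (d + 1)) + q * (y * g), ?_, q * c, by ring⟩
        refine Ideal.add_mem _ (Ideal.mul_mem_left _ _ hn) (Ideal.mul_mem_left _ _ ?_)
        rw [pow_succ']
        exact Ideal.mul_mem_mul hy hg
      · rintro _ _ ⟨g, hg, c, rfl⟩ ⟨g', hg', c', rfl⟩
        exact ⟨g + g', add_mem hg hg', c + c', by ring⟩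
  · rintro ⟨g, hg, c, rfl⟩
    refine add_mem ?_ (Ideal.mul_mem_left _ _ (Ideal.pow_mem_pow hy _))
    rw [pow_succ']
    exact Ideal.mul_mem_mul hx hg

variable [IsDomain R]

lemma Par.qr {x y : R} (h : Par x y) (d : ℕ) (g c : R)
    (hm : x * g + c * y ^ d ∈ maximalIdeal R ^ (d + 1)) :
    c ∈ maximalIdeal R ∧ g ∈ maximalIdeal R ^ d := by
  obtain ⟨g', hg', c', hc'⟩ := (mem_pow_succ h.spn d _).1 hm
  have h1 : x ∣ (c - c' * y) * y ^ d := ⟨g' - g, by linear_combination hc'⟩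
  rcases h.prm.dvd_or_dvd h1 with h2 | h2
  · obtain ⟨e, he⟩ := h2
    constructor
    · rw [show c = c' * y + e * x by linear_combination he]
      exact add_mem (Ideal.mul_mem_left _ _ h.y_mem) (Ideal.mul_mem_left _ _ h.x_mem)
    · have : g = g' - e * y ^ d := by
        apply mul_left_cancel₀ h.prm.ne_zero
        linear_combination hc' - y ^ d * he
      rw [this]
      exact sub_mem hg' (Ideal.mul_mem_left _ _ (Ideal.pow_mem_pow h.y_mem d))
  · exact absurd h2 (h.ndvd_pow d)

lemma Par.of_x_mul {x y : R} (h : Par x y) (d : ℕ) (g : R)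
    (hm : x * g ∈ maximalIdeal R ^ (d + 1)) : g ∈ maximalIdeal R ^ d :=
  (h.qr d g 0 (by simpa using hm)).2

lemma Par.of_x_pow_mul {x y : R} (h : Par x y) (d e : ℕ) (g : R)
    (hm : x ^ e * g ∈ maximalIdeal R ^ (d + e)) : g ∈ maximalIdeal R ^ d := by
  induction e with
  | zero => simpa using hm
  | succ e ih => 
    apply ih
    apply h.of_x_mul (d + e)
    rw [← mul_assoc, ← pow_succ']
    exact hm

lemma exists_ord {g : R} (hg : g ≠ 0) :
    ∃ q, g ∈ maximalIdeal R ^ q ∧ g ∉ maximalIdeal R ^ (q + 1) := by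
  classical
  have hk := Ideal.iInf_pow_eq_bot_of_isLocalRing (maximalIdeal R) (maximalIdeal.isMaximal R).ne_top
  have hex : ∃ n, g ∉ maximalIdeal R ^ n := by
    by_contra hc
    push Not at hc
    apply hg
    rw [← Ideal.mem_bot, ← hk, Ideal.mem_iInf]
    exact hc
  have hs := Nat.find_spec hex
  obtain ⟨q, hq⟩ : ∃ q, Nat.find hex = q + 1 := by
    refine Nat.exists_eq_succ_of_ne_zero ?_
    intro h0
    rw [h0] at hs
    simp at hs
  refine ⟨q, ?_, hq ▸ hs⟩
  by_contra hc
  exact Nat.find_min hex (by omega) hc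

lemma exists_ord_ideal {J : Ideal R} (hJ : J ≠ ⊥) :
    ∃ q, J ≤ maximalIdeal R ^ q ∧ ∃ g ∈ J, g ∉ maximalIdeal R ^ (q + 1) := by
  classical
  obtain ⟨z, hz, hz0⟩ := Submodule.exists_mem_ne_zero_of_ne_bot hJ
  obtain ⟨q, hq, hq'⟩ := exists_ord hz0
  have hex : ∃ n, ¬ J ≤ maximalIdeal R ^ n := ⟨q + 1, fun h => hq' (h hz)⟩
  have hs := Nat.find_spec hex
  obtain ⟨q, hq⟩ : ∃ q, Nat.find hex = q + 1 := by
    refine Nat.exists_eq_succ_of_ne_zero ?_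
    intro h0
    rw [h0] at hs
    simp at hs
  refine ⟨q, ?_, ?_⟩
  · by_contra hc
    exact Nat.find_min hex (by omega) hc
  · rw [hq] at hs
    exact Set.not_subset.1 hs

lemma exists_poly {x y : R} (h : Par x y) (d : ℕ) (g : R) (hg : g ∈ maximalIdeal R ^ d) :
    ∃ P : Polynomial R, (∀ c, x - c * y ∣ g - P.eval c * y ^ d) ∧
      (P.map (residue R) = 0 → g ∈ maximalIdeal R ^ (d + 1)) := by
  induction d generalizing g with
  | zero =>
    refine ⟨Polynomial.C g, fun c => by simp, fun h0 => ?_⟩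
    rw [Polynomial.map_C, Polynomial.C_eq_zero, residue_eq_zero_iff] at h0
    simpa using h0
  | succ d ih =>
    obtain ⟨g', hg', e, rfl⟩ := (mem_pow_succ h.spn d g).1 hg
    obtain ⟨P, hP, hP'⟩ := ih g' hg'
    refine ⟨Polynomial.X * P + Polynomial.C e, fun c => ?_, fun h0 => ?_⟩
    · obtain ⟨w, hw⟩ := hP c
      refine ⟨g' + c * y * w, ?_⟩
      simp only [Polynomial.eval_add, Polynomial.eval_mul, Polynomial.eval_X, Polynomial.eval_C]
      linear_combination c * y * hw
    · rw [Polynomial.map_add, Polynomial.map_mul, Polynomial.map_X, Polynomial.map_C] at h0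
      have he : residue R e = 0 := by
        have := congrArg (Polynomial.coeff · 0) h0
        simpa using this
      rw [he, Polynomial.C_0, add_zero] at h0
      have hz : P.map (residue R) = 0 := by
        rcases mul_eq_zero.1 h0 with h1 | h1
        · exact absurd h1 Polynomial.X_ne_zero
        · exact h1
      refine add_mem ?_ ?_
      · rw [pow_succ']
        exact Ideal.mul_mem_mul h.x_mem (hP' hz)
      · rw [pow_succ']
        exact Ideal.mul_mem_mul ((residue_eq_zero_iff _).1 he) (Ideal.pow_mem_pow h.y_mem _)

/-- `g` is in general position with respect to the parameters `x, y`. -/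
def Gen (x y : R) (q : ℕ) (g : R) : Prop :=
  ∃ c h, IsUnit c ∧ h ∈ maximalIdeal R ^ (q - 1) ∧ g = c * y ^ q + x * h

lemma gen_of {x y : R} (h : Par x y) (q : ℕ) (g : R) (hg : g ∈ maximalIdeal R ^ q)
    (c : R) (hc : IsUnit c) (hd : x ∣ g - c * y ^ q) : Gen x y q g := by
  obtain ⟨w, hw⟩ := hd
  refine ⟨c, w, hc, ?_, by linear_combination hw⟩
  rcases Nat.eq_zero_or_pos q with rfl | hq
  · simp
  · obtain ⟨q, rfl⟩ : ∃ q', q = q' + 1 := ⟨q - 1, by omega⟩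
    apply h.of_x_mul
    rw [← hw]
    exact sub_mem hg (Ideal.mul_mem_left _ _ (Ideal.pow_mem_pow h.y_mem _))

lemma exists_eval_ne {k : Type*} [Field k] [Infinite k] {Q : Polynomial k} (hQ : Q ≠ 0) :
    ∃ c, Q.eval c ≠ 0 := by
  by_contra hc
  push Not at hc
  exact hQ (Polynomial.funext (by simpa using hc))

lemma exists_gen [Infinite (ResidueField R)] (hR : ∃ x y : R, Par x y) {q₁ q₂ : ℕ} {g₁ g₂ : R}
    (h1 : g₁ ∈ maximalIdeal R ^ q₁) (h1' : g₁ ∉ maximalIdeal R ^ (q₁ + 1))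
    (h2 : g₂ ∈ maximalIdeal R ^ q₂) (h2' : g₂ ∉ maximalIdeal R ^ (q₂ + 1)) :
    ∃ x y : R, Par x y ∧ Gen x y q₁ g₁ ∧ Gen x y q₂ g₂ := by
  obtain ⟨x, y, h⟩ := hR
  obtain ⟨P, hP, hP'⟩ := exists_poly h q₁ g₁ h1
  obtain ⟨Q, hQ, hQ'⟩ := exists_poly h q₂ g₂ h2
  have hne : P.map (residue R) * Q.map (residue R) ≠ 0 :=
    mul_ne_zero (fun h0 => h1' (hP' h0)) (fun h0 => h2' (hQ' h0))
  obtain ⟨c, hc⟩ := exists_eval_ne hne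
  obtain ⟨c, rfl⟩ := residue_surjective c
  rw [Polynomial.eval_mul, Polynomial.eval_map, Polynomial.eval₂_hom, Polynomial.eval_map,
    Polynomial.eval₂_hom] at hc
  refine ⟨x - c * y, y, h.change c, gen_of (h.change c) _ _ h1 (P.eval c) ?_ (hP c),
    gen_of (h.change c) _ _ h2 (Q.eval c) ?_ (hQ c)⟩
  · exact (residue_ne_zero_iff_isUnit _).1 (left_ne_zero_of_mul hc)
  · exact (residue_ne_zero_iff_isUnit _).1 (right_ne_zero_of_mul hc)

lemma Par.unit_of_dvd {x y : R} (h : Par x y) {b : R} {N M : ℕ} (h1 : b ∣ x ^ N) (h2 : b ∣ y ^ M) :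
    IsUnit b := by
  obtain ⟨i, -, hi⟩ := (dvd_prime_pow h.prm N).1 h1
  rcases Nat.eq_zero_or_pos i with rfl | hi0
  · rw [pow_zero] at hi
    exact hi.isUnit_iff.2 isUnit_one
  · exact absurd (((dvd_pow_self x hi0.ne').trans hi.symm.dvd).trans h2) (h.ndvd_pow _)

lemma Par.colon_descent {x y : R} (h : Par x y) (a : R) (N : ℕ) (g : R)
    (hg : ∀ z ∈ maximalIdeal R ^ N, a ∣ z * g) : a ∣ g := by
  induction N generalizing g with
  | zero => simpa using hg 1 (by simp)
  | succ N ih =>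
    apply ih
    intro z hz
    obtain ⟨p, hp⟩ := hg (x * z) (by rw [pow_succ']; exact Ideal.mul_mem_mul h.x_mem hz)
    obtain ⟨q, hq⟩ := hg (y * z) (by rw [pow_succ']; exact Ideal.mul_mem_mul h.y_mem hz)
    by_cases ha : a = 0
    · subst ha
      have : x * (z * g) = 0 := by linear_combination hp
      rw [(mul_eq_zero.1 this).resolve_left h.prm.ne_zero]
    · have h1 : y * p = x * q := by
        apply mul_left_cancel₀ ha
        linear_combination x * hq - y * hp
      obtain ⟨p', hp'⟩ := (h.prm.dvd_or_dvd ⟨q, h1⟩).resolve_left h.ndvd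
      refine ⟨p', ?_⟩
      apply mul_left_cancel₀ h.prm.ne_zero
      rw [hp'] at hp
      linear_combination hp

lemma Par.dvd_of_cm {x y : R} (h : Par x y) {a b t : R} {N : ℕ}
    (hN : maximalIdeal R ^ N ≤ Ideal.span {a, b}) (hd : a ∣ b * t) : a ∣ t := by
  apply h.colon_descent a N
  intro z hz
  obtain ⟨p, q, rfl⟩ := Ideal.mem_span_pair.1 (hN hz)
  obtain ⟨w, hw⟩ := hd
  exact ⟨p * t + q * w, by linear_combination q * hw⟩

lemma Par.cm {x y : R} (h : Par x y) {a b s t : R} {N : ℕ}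
    (hN : maximalIdeal R ^ N ≤ Ideal.span {a, b}) (hst : a * s + b * t = 0) :
    ∃ w, s = b * w ∧ t = - (a * w) := by
  obtain ⟨w, hw⟩ := h.dvd_of_cm hN (a := a) (b := b) (t := t) ⟨-s, by linear_combination hst⟩
  by_cases ha : a = 0
  · subst ha
    have hb : IsUnit b := by
      have e : ∀ z ∈ maximalIdeal R, b ∣ z ^ N := by
        intro z hz
        obtain ⟨p, q, hpq⟩ := Ideal.mem_span_pair.1 (hN (Ideal.pow_mem_pow hz N))
        exact ⟨q, by rw [← hpq]; ring⟩
      exact h.unit_of_dvd (e x h.x_mem) (e y h.y_mem)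
    obtain ⟨v, hv⟩ := hb.exists_right_inv
    exact ⟨v * s, by rw [← mul_assoc, hv, one_mul], by rw [hw]; ring⟩
  · refine ⟨-w, ?_, by rw [hw]; ring⟩
    apply mul_left_cancel₀ ha
    rw [hw] at hst
    linear_combination hst

end P0b

section P0c
variable {R : Type u} [CommRing R] [IsNoetherianRing R] [IsLocalRing R]

lemma exists_gens_of_muE {M : Type*} [AddCommGroup M] [Module R M] {N : Submodule R M}
    {n : ℕ} (h : muE N = n) :
    ∃ s : Finset M, s.card = n ∧ Submodule.span R (s : Set M) = N := by
  have hne : {n : ℕ∞ | ∃ s : Finset M, (s.card : ℕ∞) = n ∧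
      Submodule.span R (s : Set M) = N}.Nonempty := by
    by_contra hc
    rw [Set.not_nonempty_iff_eq_empty] at hc
    rw [muE, hc, sInf_empty] at h
    exact absurd h (ENat.top_ne_natCast n)
  obtain ⟨s, hs, hs'⟩ := csInf_mem hne
  refine ⟨s, ?_, hs'⟩
  rw [muE] at h
  rw [h] at hs
  exact_mod_cast hs

lemma no_chain {x y : R} (h : maximalIdeal R = Ideal.span {x, y}) (Q₀ Q₁ : Ideal R) [Q₀.IsPrime]
    [Q₁.IsPrime] (h01 : Q₀ < Q₁) (h1m : Q₁ < maximalIdeal R) (n : ℕ)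
    (hy : y ^ n ∈ Q₀ ⊔ Ideal.span {x}) : False := by
  have hmin : maximalIdeal R ∈ (Q₀ ⊔ Ideal.span {x}).minimalPrimes := by
    refine ⟨⟨inferInstance, ?_⟩, ?_⟩
    · refine sup_le (h01.le.trans h1m.le) ?_
      rw [Ideal.span_singleton_le_iff_mem]
      exact (mem_m_iff h x).2 ⟨1, 0, by ring⟩
    · rintro P ⟨hP, hP'⟩ -
      rw [h, Ideal.span_le]
      rintro z (rfl | rfl)
      · exact hP' (Ideal.mem_sup_right (Ideal.mem_span_singleton_self _))
      · exact hP.mem_of_pow_mem n (hP' hy)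
  have h1 := Ideal.map_height_le_one_of_mem_minimalPrimes hmin
  have hs : Function.Surjective (Ideal.Quotient.mk Q₀) := Ideal.Quotient.mk_surjective
  have hp : ∀ P : Ideal R, P.IsPrime → Q₀ ≤ P → (P.map (Ideal.Quotient.mk Q₀)).IsPrime := by
    intro P hP hle
    exact Ideal.map_isPrime_of_surjective hs (by rwa [Ideal.mk_ker])
  have hc : ∀ P : Ideal R, Q₀ ≤ P → (P.map (Ideal.Quotient.mk Q₀)).comap (Ideal.Quotient.mk Q₀) = P := by
    intro P hle
    rw [Ideal.comap_map_of_surjective' _ hs, Ideal.mk_ker]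
    exact sup_eq_left.2 hle
  have hlt : ∀ P P' : Ideal R, Q₀ ≤ P → P < P' →
      P.map (Ideal.Quotient.mk Q₀) < P'.map (Ideal.Quotient.mk Q₀) := by
    intro P P' hle hlt
    refine lt_of_le_of_ne (Ideal.map_mono hlt.le) ?_
    intro he
    have := congrArg (Ideal.comap (Ideal.Quotient.mk Q₀)) he
    rw [hc _ hle, hc _ (hle.trans hlt.le)] at this
    exact hlt.ne this
  haveI := hp Q₀ inferInstance le_rfl
  haveI := hp Q₁ inferInstance h01.le
  haveI := hp (maximalIdeal R) inferInstance (h01.le.trans h1m.le)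
  have e1 := Ideal.height_add_one_le_of_lt_of_isPrime (hlt _ _ le_rfl h01)
  have e2 := Ideal.height_add_one_le_of_lt_of_isPrime (hlt _ _ h01.le h1m)
  have e3 : (1 : ℕ∞) + 1 ≤ 1 := by
    calc (1 : ℕ∞) + 1 ≤ (Ideal.map (Ideal.Quotient.mk Q₀) Q₁).height + 1 := by
          gcongr
          exact le_trans (by simp) e1
      _ ≤ _ := e2
      _ ≤ 1 := h1
  exact absurd e3 (by decide)

theorem init_reg (hreg : IsRegularLocal R) (hdim : rDim R = 2) :
    IsDomain R ∧ ∃ x y : R, Par x y := by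
  have hmu : muE (maximalIdeal R) = (2 : ℕ) := by
    have := hreg.2.trans hdim
    have h2 : ((muE (maximalIdeal R) : ℕ∞) : WithBot ℕ∞) = ((2 : ℕ∞) : WithBot ℕ∞) := this
    rw [WithBot.coe_inj] at h2
    exact h2
  classical
  obtain ⟨s, hs, hspan⟩ := exists_gens_of_muE hmu
  obtain ⟨x, y, -, rfl⟩ := Finset.card_eq_two.1 hs
  have h : maximalIdeal R = Ideal.span {x, y} := by
    rw [← hspan]; simp [Ideal.span]
  have hd2 : ((2 : ℕ) : WithBot ℕ∞) ≤ Order.krullDim (PrimeSpectrum R) := by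
    rw [rDim, ringKrullDim] at hdim
    rw [hdim]; exact le_rfl
  obtain ⟨l, hl⟩ := Order.le_krullDim_iff.1 hd2
  set Q₀ : Ideal R := (l ⟨0, by omega⟩).asIdeal with hQ0
  set Q₁ : Ideal R := (l ⟨1, by omega⟩).asIdeal with hQ1
  have h01 : Q₀ < Q₁ := l.strictMono (by rw [Fin.lt_def]; norm_num)
  have h1m : Q₁ < maximalIdeal R := by
    refine lt_of_lt_of_le (b := (l ⟨2, by omega⟩).asIdeal) (l.strictMono (by rw [Fin.lt_def]; norm_num)) ?_
    exact le_maximalIdeal (l ⟨2, by omega⟩).isPrime.ne_top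
  haveI : Q₀.IsPrime := (l ⟨0, by omega⟩).isPrime
  haveI : Q₁.IsPrime := (l ⟨1, by omega⟩).isPrime
  have hnd : ∀ n : ℕ, ¬ x ∣ y ^ n := by
    intro n hd
    exact no_chain h Q₀ Q₁ h01 h1m n (Ideal.mem_sup_right (Ideal.mem_span_singleton.2 hd))
  -- `x` is not in `Q₀`
  have hQx : ∀ p ∈ Q₀, x ∣ p := by
    intro p hp
    by_contra hxp
    obtain ⟨i, c, w, hc, hpe⟩ := decomp h p hxp
    refine no_chain h Q₀ Q₁ h01 h1m i ?_
    obtain ⟨v, hv⟩ := hc.exists_left_inv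
    rw [show y ^ i = v * p + (-(v * w)) * x by rw [hpe]; linear_combination (-y ^ i) * hv]
    exact add_mem (Ideal.mem_sup_left (Ideal.mul_mem_left _ _ hp))
      (Ideal.mem_sup_right (Ideal.mul_mem_left _ _ (Ideal.mem_span_singleton_self _)))
  have hx0 : x ∉ Q₀ := by
    intro hx
    obtain ⟨p, hp1, hp0⟩ := Set.exists_of_ssubset h01
    have hxp : ¬ x ∣ p := fun hd => hp0 (Q₀.mem_of_dvd hd hx)
    obtain ⟨i, c, w, hc, hpe⟩ := decomp h p hxp
    have hy : c * y ^ i ∈ Q₁ := by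
      have : c * y ^ i = p - x * w := by rw [hpe]; ring
      rw [this]
      exact sub_mem hp1 (Ideal.mul_mem_right _ _ (h01.le hx))
    have hy' : y ∈ Q₁ := by
      rcases (inferInstance : Q₁.IsPrime).mem_or_mem hy with h1 | h1
      · exact absurd (Ideal.eq_top_of_isUnit_mem _ h1 hc) (inferInstance : Q₁.IsPrime).ne_top
      · exact (inferInstance : Q₁.IsPrime).mem_of_pow_mem i h1
    refine h1m.not_ge ?_
    rw [h, Ideal.span_le]
    rintro z (rfl | rfl)
    · exact h01.le hx
    · exact hy'
  have hbot : Q₀ = ⊥ := by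
    refine Submodule.eq_bot_of_le_smul_of_le_jacobson_bot (maximalIdeal R) Q₀
      (IsNoetherian.noetherian Q₀) ?_ ?_
    · intro p hp
      obtain ⟨w, rfl⟩ := hQx p hp
      have hw : w ∈ Q₀ := ((inferInstance : Q₀.IsPrime).mem_or_mem hp).resolve_left hx0
      exact Submodule.smul_mem_smul ((mem_m_iff h x).2 ⟨1, 0, by ring⟩) hw
    · exact (IsLocalRing.jacobson_eq_maximalIdeal ⊥ bot_ne_top).ge
  have hdom : IsDomain R := by
    have : (⊥ : Ideal R).IsPrime := by rw [← hbot]; infer_instance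
    exact IsDomain.of_bot_isPrime R
  refine ⟨hdom, x, y, par_of h ?_ hnd⟩
  rintro rfl
  exact hx0 (zero_mem _)

end P0c

section P1
variable {F : Type u} [Field F] {R : Type u} [CommRing R] [Algebra R F]

/-- The valuation ring `V` contains the image of `R`. -/
def Over (R : Type u) [CommRing R] [Algebra R F] (V : ValuationSubring F) : Prop :=
  ∀ r : R, algebraMap R F r ∈ V

lemma Over.le_one {V : ValuationSubring F} (h : Over R V) (r : R) :
    V.valuation (algebraMap R F r) ≤ 1 := (V.valuation_le_one_iff _).2 (h r)

/-- The valuative closure of a set. -/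
def vcl (R : Type u) [CommRing R] [Algebra R F] (T : Set F) : Set F :=
  {z | ∀ V : ValuationSubring F, Over R V → ∃ t ∈ T, V.valuation z ≤ V.valuation t}

lemma v_span_le {V : ValuationSubring F} (h : Over R V) {T : Set R} {γ : V.ValueGroup}
    (hT : ∀ t ∈ T, V.valuation (algebraMap R F t) ≤ γ) {z : R} (hz : z ∈ Ideal.span T) :
    V.valuation (algebraMap R F z) ≤ γ := by
  refine Submodule.span_induction (p := fun z _ => V.valuation (algebraMap R F z) ≤ γ) ?_ ?_ ?_ ?_ hz
  · exact fun t ht => hT t ht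
  · simp
  · intro a b _ _ ha hb
    rw [map_add]
    exact (V.valuation.map_add _ _).trans (max_le ha hb)
  · intro r a _ ha
    rw [smul_eq_mul, map_mul, map_mul]
    calc _ ≤ 1 * γ := mul_le_mul' (h.le_one r) ha
      _ = γ := one_mul _

lemma v_mul_le {V : ValuationSubring F} {A B : Ideal R} {α β : V.ValueGroup}
    (hA : ∀ t ∈ A, V.valuation (algebraMap R F t) ≤ α)
    (hB : ∀ t ∈ B, V.valuation (algebraMap R F t) ≤ β) {z : R} (hz : z ∈ A * B) :
    V.valuation (algebraMap R F z) ≤ α * β := by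
  refine Submodule.mul_induction_on hz ?_ ?_
  · intro a ha b hb
    rw [map_mul, map_mul]
    exact mul_le_mul' (hA a ha) (hB b hb)
  · intro a b ha hb
    rw [map_add]
    exact (V.valuation.map_add _ _).trans (max_le ha hb)

lemma v_pow_le {V : ValuationSubring F} (h : Over R V) {A : Ideal R} {α : V.ValueGroup}
    (hA : ∀ t ∈ A, V.valuation (algebraMap R F t) ≤ α) (n : ℕ) {z : R} (hz : z ∈ A ^ n) :
    V.valuation (algebraMap R F z) ≤ α ^ n := by
  induction n generalizing z with
  | zero => simpa using h.le_one z
  | succ n ih =>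
    rw [pow_succ] at hz ⊢
    exact v_mul_le (fun t ht => ih ht) hA hz

lemma exists_max {V : ValuationSubring F} (h : Over R V) {J : Ideal R} (hJ : J.FG) :
    ∃ w ∈ J, ∀ z ∈ J, V.valuation (algebraMap R F z) ≤ V.valuation (algebraMap R F w) := by
  obtain ⟨s, rfl⟩ := hJ
  rcases s.eq_empty_or_nonempty with rfl | hs
  · refine ⟨0, zero_mem _, ?_⟩
    intro z hz
    simp at hz
    simp [hz]
  · obtain ⟨w, hw, hmax⟩ := s.exists_max_image (fun z => V.valuation (algebraMap R F z)) hs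
    exact ⟨w, Submodule.subset_span hw, fun z hz => v_span_le h (fun t ht => hmax t ht) hz⟩

lemma v_red [IsNoetherianRing R] {V : ValuationSubring F} (h : Over R V) {H J : Ideal R}
    (hr : IsReduction H J) {z : R} (hz : z ∈ J) :
    ∃ i ∈ H, V.valuation (algebraMap R F z) ≤ V.valuation (algebraMap R F i) := by
  obtain ⟨w, hw, hwm⟩ := exists_max h (IsNoetherian.noetherian J)
  obtain ⟨i, hi, him⟩ := exists_max h (IsNoetherian.noetherian H)
  refine ⟨i, hi, (hwm z hz).trans ?_⟩
  obtain ⟨-, r, hr⟩ := hr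
  have h1 : w ^ (r + 1) ∈ H * J ^ r := hr ▸ Ideal.pow_mem_pow hw _
  have h2 := v_mul_le him (fun t ht => v_pow_le h hwm r ht) h1
  rw [map_pow, map_pow, pow_succ'] at h2
  by_cases h0 : V.valuation (algebraMap R F w) = 0
  · rw [h0]; exact zero_le
  · exact le_of_mul_le_mul_right h2 (zero_lt_iff.2 (pow_ne_zero r h0))

lemma pow_sup_span_le (I : Ideal R) (z : R) (s : ℕ) :
    (I ⊔ Ideal.span {z}) ^ (s + 1) ≤ I * (I ⊔ Ideal.span {z}) ^ s ⊔ Ideal.span {z ^ (s + 1)} := by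
  induction s with
  | zero => simp
  | succ s ih =>
    rw [pow_succ' _ (s + 1)]
    rw [Ideal.sup_mul]
    refine sup_le le_sup_left ?_
    refine (Ideal.mul_mono_right ih).trans ?_
    rw [Ideal.mul_sup]
    refine sup_le (le_sup_of_le_left ?_) (le_sup_of_le_right ?_)
    · rw [mul_left_comm, pow_succ' _ s]
      exact Ideal.mul_mono_right (Ideal.mul_mono_left le_sup_right)
    · rw [Ideal.span_singleton_mul_span_singleton, ← pow_succ']

lemma red_of_pow_mem {I : Ideal R} {z : R} {s : ℕ}
    (h : z ^ (s + 1) ∈ I * (I ⊔ Ideal.span {z}) ^ s) : IsReduction I (I ⊔ Ideal.span {z}) := by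
  refine ⟨le_sup_left, s, le_antisymm ?_ ?_⟩
  · refine (pow_sup_span_le I z s).trans (sup_le le_rfl ?_)
    rwa [Ideal.span_singleton_le_iff_mem]
  · rw [pow_succ']
    exact Ideal.mul_mono_left le_sup_left

lemma exists_pow_mem [FaithfulSMul R F] (I : Ideal R) {z : R}
    (h : ∀ V : ValuationSubring F, Over R V → ∃ i ∈ I,
      V.valuation (algebraMap R F z) ≤ V.valuation (algebraMap R F i)) :
    ∃ s, z ^ (s + 1) ∈ I * (I ⊔ Ideal.span {z}) ^ s := by
  have hinj : Function.Injective (algebraMap R F) := FaithfulSMul.algebraMap_injective R F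
  by_cases hz : z = 0
  · subst hz
    exact ⟨0, by simp⟩
  have hz' : algebraMap R F z ≠ 0 := fun h0 => hz (hinj (by rw [h0, map_zero]))
  set L := I ⊔ Ideal.span {z} with hL
  have hzL : z ∈ L := Ideal.mem_sup_right (Ideal.mem_span_singleton_self _)
  set G : Set F := (fun i : R => algebraMap R F i / algebraMap R F z) '' I with hG
  set S := Algebra.adjoin R G with hS
  set Q : Ideal S.toSubring := Ideal.span {t | (t : F) ∈ G} with hQ
  have hGS : ∀ i ∈ I, algebraMap R F i / algebraMap R F z ∈ S.toSubring :=
    fun i hi => Algebra.subset_adjoin ⟨i, hi, rfl⟩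
  have hSp : ∀ t ∈ S, ∃ s, ∃ p ∈ L ^ s, t * algebraMap R F z ^ s = algebraMap R F p := by
    intro t ht
    refine Algebra.adjoin_induction
      (p := fun t _ => ∃ s, ∃ p ∈ L ^ s, t * algebraMap R F z ^ s = algebraMap R F p) ?_ ?_ ?_ ?_ ht
    · rintro _ ⟨i, hi, rfl⟩
      exact ⟨1, i, by rw [pow_one]; exact Ideal.mem_sup_left hi, by field_simp⟩
    · intro r
      exact ⟨0, r, by simp, by simp⟩
    · rintro t t' _ _ ⟨s, p, hp, e⟩ ⟨s', p', hp', e'⟩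
      refine ⟨s + s', p * z ^ s' + z ^ s * p', ?_, ?_⟩
      · rw [pow_add]
        exact add_mem (Ideal.mul_mem_mul hp (Ideal.pow_mem_pow hzL _))
          (Ideal.mul_mem_mul (Ideal.pow_mem_pow hzL _) hp')
      · simp only [map_add, map_mul, map_pow, ← e, ← e']
        ring
    · rintro t t' _ _ ⟨s, p, hp, e⟩ ⟨s', p', hp', e'⟩
      refine ⟨s + s', p * p', ?_, ?_⟩
      · rw [pow_add]
        exact Ideal.mul_mem_mul hp hp'
      · simp only [map_mul, ← e, ← e']
        ring
  have hQp : ∀ t ∈ Q, ∃ s, ∃ p ∈ I * L ^ s, (t : F) * algebraMap R F z ^ (s + 1) = algebraMap R F p := by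
    intro t ht
    refine Submodule.span_induction
      (p := fun (t : S.toSubring) _ => ∃ s, ∃ p ∈ I * L ^ s, (t : F) * algebraMap R F z ^ (s + 1) = algebraMap R F p)
      ?_ ?_ ?_ ?_ ht
    · rintro t ⟨i, hi, hit⟩
      refine ⟨0, i, by simpa using hi, ?_⟩
      rw [← hit]
      field_simp
      ring
    · exact ⟨0, 0, zero_mem _, by simp⟩
    · rintro t t' _ _ ⟨s, p, hp, e⟩ ⟨s', p', hp', e'⟩
      refine ⟨s + s' , p * z ^ s' + p' * z ^ s, ?_, ?_⟩
      · refine add_mem ?_ ?_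
        · rw [pow_add, ← mul_assoc]
          exact Ideal.mul_mem_mul hp (Ideal.pow_mem_pow hzL _)
        · rw [add_comm, pow_add, ← mul_assoc]
          exact Ideal.mul_mem_mul hp' (Ideal.pow_mem_pow hzL _)
      · simp only [map_add, map_mul, map_pow, ← e, ← e', Subring.coe_add]
        ring
    · rintro t t' _ ⟨s', p', hp', e'⟩
      obtain ⟨s, p, hp, e⟩ := hSp t t.2
      refine ⟨s + s', p' * p, ?_, ?_⟩
      · rw [add_comm, pow_add, ← mul_assoc]
        exact Ideal.mul_mem_mul hp' hp
      · simp only [map_mul, ← e, ← e', Subring.coe_mul, smul_eq_mul]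
        ring
  by_cases hQt : Q = ⊤
  · obtain ⟨s, p, hp, e⟩ := hQp 1 (hQt ▸ trivial)
    refine ⟨s, ?_⟩
    rw [Subring.coe_one, one_mul, ← map_pow] at e
    rw [hinj e]
    exact hp
  · exfalso
    obtain ⟨V, hV, hVn⟩ := Ideal.image_subset_nonunits_valuationSubring Q hQt
    obtain ⟨i, hi, hle⟩ := h V (fun r => hV (S.algebraMap_mem r))
    have h1 : algebraMap R F i / algebraMap R F z ∈ V.nonunits := by
      refine hVn ⟨⟨_, hGS i hi⟩, Ideal.subset_span ⟨i, hi, rfl⟩, rfl⟩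
    rw [ValuationSubring.mem_nonunits_iff, map_div₀,
      div_lt_one₀ (zero_lt_iff.2 ((Valuation.ne_zero_iff _).2 hz'))] at h1
    exact absurd hle (not_le.2 h1)

lemma mem_of_v [FaithfulSMul R F] {I : Ideal R} (hI : IsIntClosedIdeal I) {z : R}
    (h : ∀ V : ValuationSubring F, Over R V → ∃ i ∈ I,
      V.valuation (algebraMap R F z) ≤ V.valuation (algebraMap R F i)) : z ∈ I := by
  obtain ⟨s, hs⟩ := exists_pow_mem (F := F) I h
  have := hI _ (red_of_pow_mem hs)
  rw [← this]
  exact Ideal.mem_sup_right (Ideal.mem_span_singleton_self _)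

/-- Existence of a valuation ring centered on a given prime. -/
lemma exists_center [FaithfulSMul R F] (P : Ideal R) [hP : P.IsPrime] :
    ∃ V : ValuationSubring F, Over R V ∧
      (∀ r ∈ P, V.valuation (algebraMap R F r) < 1) ∧
      (∀ r, r ∉ P → V.valuation (algebraMap R F r) = 1) := by
  have hinj : Function.Injective (algebraMap R F) := FaithfulSMul.algebraMap_injective R F
  have hne : ∀ r, r ∉ P → algebraMap R F r ≠ 0 := by
    intro r hr h0
    apply hr
    rw [hinj (h0.trans (map_zero _).symm)]
    exact zero_mem _
  let A : Subring F :=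
    { carrier := {z | ∃ r s : R, s ∉ P ∧ z * algebraMap R F s = algebraMap R F r}
      mul_mem' := by
        rintro a b ⟨r, s, hs, e⟩ ⟨r', s', hs', e'⟩
        refine ⟨r * r', s * s', fun h => (hP.mem_or_mem h).elim hs hs', ?_⟩
        rw [map_mul, map_mul, ← e, ← e']; ring
      one_mem' := ⟨1, 1, fun h => hP.ne_top ((Ideal.eq_top_iff_one _).2 h), by simp⟩
      add_mem' := by
        rintro a b ⟨r, s, hs, e⟩ ⟨r', s', hs', e'⟩
        refine ⟨r * s' + r' * s, s * s', fun h => (hP.mem_or_mem h).elim hs hs', ?_⟩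
        rw [map_mul, map_add, map_mul, map_mul, ← e, ← e']; ring
      zero_mem' := ⟨0, 1, fun h => hP.ne_top ((Ideal.eq_top_iff_one _).2 h), by simp⟩
      neg_mem' := by
        rintro a ⟨r, s, hs, e⟩
        exact ⟨-r, s, hs, by rw [map_neg, ← e]; ring⟩ }
  have h1P : (1 : R) ∉ P := fun h => hP.ne_top ((Ideal.eq_top_iff_one _).2 h)
  let Q : Ideal A :=
    { carrier := {z | ∃ r s : R, r ∈ P ∧ s ∉ P ∧ (z : F) * algebraMap R F s = algebraMap R F r}
      add_mem' := by
        rintro a b ⟨r, s, hr, hs, e⟩ ⟨r', s', hr', hs', e'⟩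
        refine ⟨r * s' + r' * s, s * s', add_mem (Ideal.mul_mem_right _ _ hr)
          (Ideal.mul_mem_right _ _ hr'), fun h => (hP.mem_or_mem h).elim hs hs', ?_⟩
        rw [Subring.coe_add, map_mul, map_add, map_mul, map_mul, ← e, ← e']; ring
      zero_mem' := ⟨0, 1, zero_mem _, h1P, by simp⟩
      smul_mem' := by
        rintro ⟨a, r', s', hs', e'⟩ b ⟨r, s, hr, hs, e⟩
        refine ⟨r' * r, s' * s, Ideal.mul_mem_left _ _ hr,
          fun h => (hP.mem_or_mem h).elim hs' hs, ?_⟩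
        rw [smul_eq_mul, Subring.coe_mul, map_mul, map_mul]
        linear_combination (a * algebraMap R F s') * e + algebraMap R F r * e' }
  have hQ : Q ≠ ⊤ := by
    intro h
    have : (1 : A) ∈ Q := h ▸ trivial
    obtain ⟨r, s, hr, hs, e⟩ := this
    rw [Subring.coe_one, one_mul] at e
    exact hs (hinj e ▸ hr)
  obtain ⟨V, hV, hVn⟩ := Ideal.image_subset_nonunits_valuationSubring Q hQ
  have hov : ∀ r : R, algebraMap R F r ∈ A := fun r => ⟨r, 1, h1P, by simp⟩
  refine ⟨V, fun r => hV (hov r), ?_, ?_⟩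
  · intro r hr
    rw [← ValuationSubring.mem_nonunits_iff]
    exact hVn ⟨⟨_, hov r⟩, ⟨r, 1, hr, h1P, by simp⟩, rfl⟩
  · intro r hr
    refine le_antisymm ((V.valuation_le_one_iff _).2 (hV (hov r))) ?_
    have : (algebraMap R F r)⁻¹ ∈ V := hV (show (algebraMap R F r)⁻¹ ∈ A from
      ⟨1, r, hr, by rw [inv_mul_cancel₀ (hne r hr), map_one]⟩)
    rw [← V.valuation_le_one_iff, map_inv₀] at this
    exact (inv_le_one₀ (zero_lt_iff.2 ((Valuation.ne_zero_iff _).2 (hne r hr)))).1 this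

end P1

section P2
variable (F : Type u) [Field F] {R : Type u} [CommRing R] [IsNoetherianRing R] [IsLocalRing R]
  [IsDomain R] [Algebra R F] [FaithfulSMul R F]

/-- The affine chart `R[y/x]` of the blow-up of the maximal ideal. -/
abbrev chart (x y : R) : Subalgebra R F :=
  Algebra.adjoin R {algebraMap R F y / algebraMap R F x}

variable {F}

lemma inj_of : Function.Injective (algebraMap R F) := FaithfulSMul.algebraMap_injective R F

lemma Par.x_ne {x y : R} (h : Par x y) : algebraMap R F x ≠ 0 :=
  fun h0 => h.prm.ne_zero (inj_of (F := F) (h0.trans (map_zero _).symm))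

lemma T_mem (x y : R) : algebraMap R F y / algebraMap R F x ∈ chart F x y :=
  Algebra.subset_adjoin rfl

lemma div_mem {x y : R} (h : Par x y) (d : ℕ) {f : R} (hf : f ∈ maximalIdeal R ^ d) :
    algebraMap R F f / algebraMap R F x ^ d ∈ chart F x y := by
  have hx := h.x_ne (F := F)
  induction d generalizing f with
  | zero => simp
  | succ d ih =>
    obtain ⟨g, hg, c, rfl⟩ := (mem_pow_succ h.spn d f).1 hf
    have e : algebraMap R F (x * g + c * y ^ (d + 1)) / algebraMap R F x ^ (d + 1)
        = algebraMap R F g / algebraMap R F x ^ d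
          + algebraMap R F c * (algebraMap R F y / algebraMap R F x) ^ (d + 1) := by
      rw [map_add, map_mul, map_mul, map_pow, div_pow]
      field_simp <;> ring
    rw [e]
    exact add_mem (ih hg) (mul_mem ((chart F x y).algebraMap_mem c) (pow_mem (T_mem x y) _))

lemma exists_num {x y : R} (h : Par x y) {t : F} (ht : t ∈ chart F x y) :
    ∃ d : ℕ, ∃ f ∈ maximalIdeal R ^ d, t * algebraMap R F x ^ d = algebraMap R F f := by
  have hx := h.x_ne (F := F)
  refine Algebra.adjoin_induction
    (p := fun t _ => ∃ d : ℕ, ∃ f ∈ maximalIdeal R ^ d, t * algebraMap R F x ^ d = algebraMap R F f)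
      ?_ ?_ ?_ ?_ ht
  · rintro _ rfl
    exact ⟨1, y, by rw [pow_one]; exact h.y_mem, by field_simp⟩
  · intro r
    exact ⟨0, r, by simp, by simp⟩
  · rintro t t' _ _ ⟨s, p, hp, e⟩ ⟨s', p', hp', e'⟩
    refine ⟨s + s', p * x ^ s' + x ^ s * p', ?_, ?_⟩
    · rw [pow_add]
      exact add_mem (Ideal.mul_mem_mul hp (Ideal.pow_mem_pow h.x_mem _))
        (Ideal.mul_mem_mul (Ideal.pow_mem_pow h.x_mem _) hp')
    · simp only [map_add, map_mul, map_pow, ← e, ← e']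
      ring
  · rintro t t' _ _ ⟨s, p, hp, e⟩ ⟨s', p', hp', e'⟩
    refine ⟨s + s', p * p', ?_, ?_⟩
    · rw [pow_add]
      exact Ideal.mul_mem_mul hp hp'
    · simp only [map_mul, ← e, ← e']
      ring

lemma mem_pow_of_chart {x y : R} (h : Par x y) {t : F} (ht : t ∈ chart F x y) {d : ℕ} {g : R}
    (e : algebraMap R F g = t * algebraMap R F x ^ d) : g ∈ maximalIdeal R ^ d := by
  obtain ⟨k, f, hf, hft⟩ := exists_num h ht
  apply h.of_x_pow_mul d k
  have : x ^ k * g = x ^ d * f := by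
    apply inj_of (F := F)
    rw [map_mul, map_mul, map_pow, map_pow, e, ← hft]
    ring
  rw [this, pow_add]
  exact Ideal.mul_mem_mul (Ideal.pow_mem_pow h.x_mem _) hf

lemma D1 {x y : R} (h : Par x y) {r : ℕ} (hr : 1 ≤ r) {a : R} (ha : Gen x y r a) {t : F}
    (ht : t ∈ chart F x y) : ∃ w ∈ chart F x y, ∃ f ∈ maximalIdeal R ^ (r - 1),
      (t + w * (algebraMap R F a / algebraMap R F x ^ r)) * algebraMap R F x ^ (r - 1)
        = algebraMap R F f := by
  have hx := h.x_ne (F := F)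
  obtain ⟨ρ, rfl⟩ : ∃ ρ, r = ρ + 1 := ⟨r - 1, by omega⟩
  rw [Nat.add_sub_cancel]
  obtain ⟨c, g₀, hc, hg₀, ha⟩ := ha
  rw [Nat.add_sub_cancel] at hg₀
  obtain ⟨c', hc'⟩ := hc.exists_left_inv
  obtain ⟨d, f, hf, e⟩ := exists_num h ht
  have ht' : t = algebraMap R F f / algebraMap R F x ^ d := by
    rw [← e]; field_simp <;> ring
  clear e ht
  subst ht'
  induction d generalizing f with
  | zero =>
    refine ⟨0, zero_mem _, f * x ^ ρ, Ideal.mul_mem_left _ _ (Ideal.pow_mem_pow h.x_mem _), ?_⟩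
    simp
  | succ d ih =>
    by_cases hdr : d + 1 ≤ ρ
    · obtain ⟨j, rfl⟩ : ∃ j, ρ = d + 1 + j := ⟨ρ - (d + 1), by omega⟩
      refine ⟨0, zero_mem _, f * x ^ j, ?_, ?_⟩
      · rw [pow_add]
        exact Ideal.mul_mem_mul hf (Ideal.pow_mem_pow h.x_mem _)
      · rw [zero_mul, add_zero, map_mul, map_pow, pow_add _ (d + 1) j, ← mul_assoc,
          div_mul_cancel₀ _ (pow_ne_zero _ hx)]
    · obtain ⟨g, hg, q, rfl⟩ := (mem_pow_succ h.spn d f).1 hf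
      obtain ⟨j, rfl⟩ : ∃ j, d = j + ρ := ⟨d - ρ, by omega⟩
      have hg' : g - q * c' * (y ^ j * g₀) ∈ maximalIdeal R ^ (j + ρ) := by
        refine sub_mem hg (Ideal.mul_mem_left _ _ ?_)
        rw [pow_add]
        exact Ideal.mul_mem_mul (Ideal.pow_mem_pow h.y_mem _) hg₀
      obtain ⟨w, hw, f', hf', e⟩ := ih _ hg'
      refine ⟨w - algebraMap R F (q * c') * (algebraMap R F y / algebraMap R F x) ^ j, ?_, f', hf', ?_⟩
      · exact sub_mem hw (mul_mem ((chart F x y).algebraMap_mem _) (pow_mem (T_mem x y) _))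
      · rw [← e]
        congr 1
        have hc2 : algebraMap R F c' * algebraMap R F c = 1 := by rw [← map_mul, hc', map_one]
        obtain ⟨T, hT⟩ : ∃ T, algebraMap R F y = T * algebraMap R F x :=
          ⟨algebraMap R F y / algebraMap R F x, by field_simp⟩
        rw [ha]
        simp only [map_sub, map_add, map_mul, map_pow, hT]
        rw [mul_div_assoc, div_self hx, mul_one]
        have e1 : (algebraMap R F x * algebraMap R F g + algebraMap R F q * (T * algebraMap R F x) ^ (j + ρ + 1))
            / algebraMap R F x ^ (j + ρ + 1)
            = algebraMap R F g / algebraMap R F x ^ (j + ρ) + algebraMap R F q * T ^ (j + ρ + 1) := by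
          rw [mul_pow]; field_simp <;> ring
        have e2 : (algebraMap R F c * (T * algebraMap R F x) ^ (ρ + 1) + algebraMap R F x * algebraMap R F g₀)
            / algebraMap R F x ^ (ρ + 1)
            = algebraMap R F c * T ^ (ρ + 1) + algebraMap R F g₀ / algebraMap R F x ^ ρ := by
          rw [mul_pow]; field_simp <;> ring
        have e3 : (algebraMap R F g - algebraMap R F q * algebraMap R F c' * ((T * algebraMap R F x) ^ j * algebraMap R F g₀))
            / algebraMap R F x ^ (j + ρ)
            = algebraMap R F g / algebraMap R F x ^ (j + ρ)
              - algebraMap R F q * algebraMap R F c' * (T ^ j * (algebraMap R F g₀ / algebraMap R F x ^ ρ)) := by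
          rw [mul_pow, pow_add]; field_simp <;> ring
        rw [e1, e2, e3]
        linear_combination (-(algebraMap R F q) * T ^ (j + ρ + 1)) * hc2

lemma D2 {x y : R} (h : Par x y) {r : ℕ} {a : R} (ha : Gen x y r a) {s : F}
    (hs : s ∈ chart F x y) {d : ℕ} {g : R}
    (e : (algebraMap R F a / algebraMap R F x ^ r) * s * algebraMap R F x ^ (d + r)
      = algebraMap R F g) :
    ∃ f ∈ maximalIdeal R ^ d, s * algebraMap R F x ^ d = algebraMap R F f := by
  have hx := h.x_ne (F := F)
  obtain ⟨c, g₀, hc, hg₀, ha⟩ := ha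
  have e' : algebraMap R F a * s * algebraMap R F x ^ d = algebraMap R F g := by
    rw [← e, pow_add]; field_simp <;> ring
  obtain ⟨k, f, hf, hft⟩ := exists_num h hs
  induction k generalizing f with
  | zero =>
    refine ⟨f * x ^ d, Ideal.mul_mem_left _ _ (Ideal.pow_mem_pow h.x_mem _), ?_⟩
    rw [map_mul, map_pow, ← hft]; simp
  | succ k ih =>
    by_cases hkd : k + 1 ≤ d
    · obtain ⟨j, rfl⟩ : ∃ j, d = k + 1 + j := ⟨d - (k + 1), by omega⟩
      refine ⟨f * x ^ j, ?_, ?_⟩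
      · rw [pow_add]
        exact Ideal.mul_mem_mul hf (Ideal.pow_mem_pow h.x_mem _)
      · rw [map_mul, map_pow, ← hft, pow_add]; ring
    · obtain ⟨j, rfl⟩ : ∃ j, k = d + j := ⟨k - d, by omega⟩
      have h1 : a * f = x * (x ^ j * g) := by
        apply inj_of (F := F)
        simp only [map_mul, map_pow]
        rw [← hft, ← e']
        ring
      obtain ⟨p, hp, q, hq⟩ := (mem_pow_succ h.spn _ f).1 hf
      have h2 : x ∣ c * q * y ^ (r + (d + j + 1)) := by
        refine ⟨x ^ j * g - a * p - g₀ * q * y ^ (d + j + 1), ?_⟩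
        rw [hq, ha] at h1
        rw [ha]
        linear_combination h1
      have h3 : x ∣ q := by
        rcases h.prm.dvd_or_dvd h2 with h4 | h4
        · rcases h.prm.dvd_or_dvd h4 with h5 | h5
          · exact absurd (isUnit_of_dvd_unit h5 hc) h.prm.not_isUnit
          · exact h5
        · exact absurd h4 (h.ndvd_pow _)
      obtain ⟨q', rfl⟩ := h3
      refine ih (p + q' * y ^ (d + j + 1)) ?_ ?_
      · refine add_mem hp (Ideal.mul_mem_left _ _ (Ideal.pow_le_pow_right (by omega)
          (Ideal.pow_mem_pow h.y_mem (d + j + 1))))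
      · apply mul_right_cancel₀ hx
        rw [mul_assoc, ← pow_succ, hft, hq, ← map_mul]
        congr 1
        ring

lemma not_x_dvd_of_gen {x y : R} (h : Par x y) {r : ℕ} {a : R} (ha : Gen x y r a) {t : F}
    (ht : t ∈ chart F x y) :
    algebraMap R F a / algebraMap R F x ^ r ≠ algebraMap R F x * t := by
  intro e
  have hx := h.x_ne (F := F)
  obtain ⟨c, g₀, hc, hg₀, ha⟩ := ha
  have h1 : a ∈ maximalIdeal R ^ (r + 1) := by
    apply mem_pow_of_chart h ht
    rw [div_eq_iff (pow_ne_zero _ hx)] at e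
    rw [e]; ring
  have h2 := (h.qr r g₀ c (by rw [ha] at h1; convert h1 using 1; ring)).1
  exact h2 hc

/-- homogenization -/
lemma exists_hom {x y : R} (h : Par x y) (d : ℕ) (P : Polynomial R) (hP : P.natDegree ≤ d) :
    ∃ g ∈ maximalIdeal R ^ d, algebraMap R F g
      = Polynomial.aeval (algebraMap R F y / algebraMap R F x) P * algebraMap R F x ^ d := by
  have hx := h.x_ne (F := F)
  refine ⟨∑ i ∈ Finset.range (d + 1), P.coeff i * (y ^ i * x ^ (d - i)), ?_, ?_⟩
  · refine sum_mem (fun i hi => Ideal.mul_mem_left _ _ ?_)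
    rw [Finset.mem_range] at hi
    have := Ideal.mul_mem_mul (Ideal.pow_mem_pow h.y_mem i) (Ideal.pow_mem_pow h.x_mem (d - i))
    rwa [← pow_add, Nat.add_sub_cancel' (by omega)] at this
  · rw [Polynomial.aeval_eq_sum_range' (Nat.lt_succ_of_le hP), map_sum, Finset.sum_mul]
    refine Finset.sum_congr rfl (fun i hi => ?_)
    rw [Finset.mem_range] at hi
    obtain ⟨j, rfl⟩ : ∃ j, d = i + j := ⟨d - i, by omega⟩
    rw [Nat.add_sub_cancel_left, Algebra.smul_def, map_mul, map_mul, map_pow, map_pow, pow_add, div_pow]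
    field_simp <;> ring

lemma map_eq_zero_of_hom {x y : R} (h : Par x y) (d : ℕ) (P : Polynomial R) (hP : P.natDegree ≤ d)
    (g : R) (hg : g ∈ maximalIdeal R ^ (d + 1)) (e : algebraMap R F g
      = Polynomial.aeval (algebraMap R F y / algebraMap R F x) P * algebraMap R F x ^ d) :
    P.map (residue R) = 0 := by
  have hx := h.x_ne (F := F)
  induction d generalizing P g with
  | zero =>
    rw [Polynomial.eq_C_of_natDegree_le_zero hP] at e ⊢
    simp only [Polynomial.aeval_C, pow_zero, mul_one] at e
    have := inj_of (F := F) e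
    rw [Polynomial.map_C, Polynomial.C_eq_zero, residue_eq_zero_iff, ← this]
    simpa using hg
  | succ d ih =>
    have hd : P.divX.natDegree ≤ d := by
      rw [Polynomial.natDegree_divX_eq_natDegree_tsub_one]; omega
    obtain ⟨g', hg', e'⟩ := exists_hom (F := F) h d P.divX hd
    have hge : g = y * g' + P.coeff 0 * x ^ (d + 1) := by
      apply inj_of (F := F)
      rw [e]
      nth_rewrite 1 [← Polynomial.X_mul_divX_add P]
      simp only [map_add, map_mul, map_pow, e', Polynomial.aeval_X, Polynomial.aeval_C]
      field_simp <;> ring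
    rw [hge] at hg
    obtain ⟨h1, h2⟩ := h.symm.qr (d + 1) g' (P.coeff 0) hg
    have h3 := ih P.divX hd g' h2 e'
    rw [← Polynomial.X_mul_divX_add P, Polynomial.map_add, Polynomial.map_mul, h3, Polynomial.map_C,
      (residue_eq_zero_iff _).2 h1]
    simp

lemma exists_poly_chart {x y : R} {t : F} (ht : t ∈ chart F x y) : ∃ P : Polynomial R,
    Polynomial.aeval (algebraMap R F y / algebraMap R F x) P = t := by
  rw [chart, Algebra.adjoin_singleton_eq_range_aeval] at ht
  exact ht

lemma dvd_iff_map {x y : R} (h : Par x y) (P : Polynomial R) :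
    (∃ t ∈ chart F x y, Polynomial.aeval (algebraMap R F y / algebraMap R F x) P
      = algebraMap R F x * t) ↔ P.map (residue R) = 0 := by
  have hx := h.x_ne (F := F)
  constructor
  · rintro ⟨t, ht, e⟩
    obtain ⟨g, hg, hge⟩ := exists_hom (F := F) h P.natDegree P le_rfl
    refine map_eq_zero_of_hom h P.natDegree P le_rfl g ?_ hge
    apply mem_pow_of_chart h ht
    rw [hge, e]; ring
  · intro h0
    rw [Polynomial.aeval_eq_sum_range]
    have hmem : ∀ i, ∃ t ∈ chart F x y, P.coeff i • (algebraMap R F y / algebraMap R F x) ^ i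
        = algebraMap R F x * t := by
      intro i
      have hi : P.coeff i ∈ maximalIdeal R := by
        rw [← residue_eq_zero_iff, ← Polynomial.coeff_map, h0, Polynomial.coeff_zero]
      obtain ⟨p, q, hpq⟩ := (mem_m_iff h.spn _).1 hi
      refine ⟨(algebraMap R F p + algebraMap R F q * (algebraMap R F y / algebraMap R F x)) *
        (algebraMap R F y / algebraMap R F x) ^ i, ?_, ?_⟩
      · exact mul_mem (add_mem ((chart F x y).algebraMap_mem _)
          (mul_mem ((chart F x y).algebraMap_mem _) (T_mem x y))) (pow_mem (T_mem x y) _)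
      · rw [hpq, Algebra.smul_def, map_add, map_mul, map_mul]
        field_simp <;> ring
    choose t ht hte using hmem
    refine ⟨∑ i ∈ Finset.range (P.natDegree + 1), t i, sum_mem (fun i _ => ht i), ?_⟩
    rw [Finset.mul_sum]
    exact Finset.sum_congr rfl (fun i _ => hte i)

end P2

section P2b
variable {F : Type u} [Field F] {R : Type u} [CommRing R] [IsNoetherianRing R] [IsLocalRing R]
  [IsDomain R] [Algebra R F] [FaithfulSMul R F]

lemma dvd_iff_map' {x y : R} (h : Par x y) (P : Polynomial R) :
    algebraMap R (chart F x y) x ∣ Polynomial.aeval (⟨_, T_mem x y⟩ : chart F x y) P ↔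
      P.map (residue R) = 0 := by
  rw [← dvd_iff_map (F := F) h P]
  have hc : ((Polynomial.aeval (⟨_, T_mem x y⟩ : chart F x y) P : chart F x y) : F)
      = Polynomial.aeval (algebraMap R F y / algebraMap R F x) P := by
    exact (Polynomial.aeval_algHom_apply (chart F x y).val (⟨_, T_mem x y⟩ : chart F x y) P).symm
  constructor
  · rintro ⟨t, ht⟩
    refine ⟨t, t.2, ?_⟩
    rw [← hc, ht]; rfl
  · rintro ⟨t, ht, e⟩
    refine ⟨⟨t, ht⟩, Subtype.ext ?_⟩
    rw [hc, e]; rfl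

lemma exists_poly_chart' {x y : R} (t : chart F x y) : ∃ P : Polynomial R,
    Polynomial.aeval (⟨_, T_mem x y⟩ : chart F x y) P = t := by
  obtain ⟨P, hP⟩ := exists_poly_chart t.2
  refine ⟨P, Subtype.ext ?_⟩
  rw [← hP]
  exact (Polynomial.aeval_algHom_apply (chart F x y).val (⟨_, T_mem x y⟩ : chart F x y) P).symm

instance chart_noeth (x y : R) : IsNoetherianRing (chart F x y) :=
  isNoetherianRing_of_surjective (Polynomial R) (chart F x y)
    (Polynomial.aeval (⟨_, T_mem x y⟩ : chart F x y)).toRingHom exists_poly_chart'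

lemma chart_prime {x y : R} (h : Par x y) : Prime (algebraMap R (chart F x y) x) := by
  refine ⟨?_, ?_, ?_⟩
  · intro h0
    apply h.x_ne (F := F)
    exact congrArg Subtype.val h0
  · intro hu
    have := (dvd_iff_map' (F := F) h 1).1 (hu.dvd)
    simp at this
  · intro s t hst
    obtain ⟨P, rfl⟩ := exists_poly_chart' s
    obtain ⟨Q, rfl⟩ := exists_poly_chart' t
    rw [← map_mul, dvd_iff_map' h, Polynomial.map_mul, mul_eq_zero] at hst
    rwa [dvd_iff_map' h, dvd_iff_map' h]

lemma chart_max {x y : R} (h : Par x y) (N : Ideal (chart F x y)) [hN : N.IsMaximal]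
    (hx : algebraMap R (chart F x y) x ∈ N) : ∃ g, N = Ideal.span {algebraMap R (chart F x y) x, g}
      ∧ ¬ algebraMap R (chart F x y) x ∣ g := by
  set T : chart F x y := ⟨_, T_mem x y⟩ with hT
  set ev : Polynomial R →+* chart F x y := (Polynomial.aeval T).toRingHom with hev
  have hsurj : Function.Surjective (Polynomial.mapRingHom (residue R)) :=
    Polynomial.map_surjective _ IsLocalRing.residue_surjective
  set M := Ideal.map (Polynomial.mapRingHom (residue R)) (N.comap ev) with hM
  obtain ⟨G', hG'⟩ := IsPrincipalIdealRing.principal M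
  have hG'M : G' ∈ M := by rw [hG']; exact Submodule.mem_span_singleton_self _
  obtain ⟨G, hG, rfl⟩ := (Ideal.mem_map_iff_of_surjective _ hsurj).1 hG'M
  have hmem : ∀ P : Polynomial R, ev P ∈ N → ∃ Q : Polynomial R,
      P.map (residue R) = (Q * G).map (residue R) := by
    intro P hP
    have h1 : Polynomial.mapRingHom (residue R) P ∈ M := Ideal.mem_map_of_mem _ hP
    rw [hG', Submodule.mem_span_singleton] at h1
    obtain ⟨q, hq⟩ := h1
    obtain ⟨Q, rfl⟩ := hsurj q
    refine ⟨Q, ?_⟩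
    rw [Polynomial.map_mul]
    exact hq.symm
  refine ⟨ev G, le_antisymm ?_ ?_, ?_⟩
  · intro s hs
    obtain ⟨P, rfl⟩ := exists_poly_chart' s
    obtain ⟨Q, hQ⟩ := hmem P hs
    have h2 : (P - Q * G).map (residue R) = 0 := by rw [Polynomial.map_sub, hQ, sub_self]
    obtain ⟨t, ht⟩ := (dvd_iff_map' (F := F) h _).2 h2
    rw [Ideal.mem_span_pair]
    refine ⟨t, ev Q, ?_⟩
    rw [map_sub, map_mul] at ht
    change t * _ + (Polynomial.aeval T) Q * (Polynomial.aeval T) G = _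
    linear_combination -ht
  · rw [Ideal.span_le]
    rintro _ (rfl | rfl)
    · exact hx
    · exact hG
  · intro hd
    have h0 : G.map (residue R) = 0 := (dvd_iff_map' (F := F) h _).1 hd
    have hz : ∀ P : Polynomial R, ev P ∈ N → P.map (residue R) = 0 := by
      intro P hP
      obtain ⟨Q, hQ⟩ := hmem P hP
      rw [hQ, Polynomial.map_mul, h0, mul_zero]
    by_cases hTN : T ∈ N
    · have := hz Polynomial.X (by change Polynomial.aeval T _ ∈ N; rwa [Polynomial.aeval_X])
      rw [Polynomial.map_X] at this
      exact Polynomial.X_ne_zero this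
    · obtain ⟨q, hq⟩ := hN.exists_inv hTN
      obtain ⟨n, hn, e⟩ := hq
      obtain ⟨Q, rfl⟩ := exists_poly_chart' q
      have := hz (1 - Q * Polynomial.X) (by
        change Polynomial.aeval T _ ∈ N
        rw [map_sub, map_mul, Polynomial.aeval_X, map_one, ← e]
        convert hn using 1
        ring)
      rw [Polynomial.map_sub, Polynomial.map_mul, Polynomial.map_X, Polynomial.map_one] at this
      have := congrArg (fun P => Polynomial.coeff P 0) this
      simp at this

end P2b

section P2c

lemma artinian_quot {R : Type u} [CommRing R] [IsNoetherianRing R] [IsLocalRing R]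
    (J : Ideal R) {n : ℕ} (hn : maximalIdeal R ^ n ≤ J) : IsArtinian R (R ⧸ J) := by
  by_cases hJ : J = ⊤
  · have : Subsingleton (R ⧸ J) := Ideal.Quotient.subsingleton_iff.2 hJ
    infer_instance
  have : Nontrivial (R ⧸ J) := Ideal.Quotient.nontrivial_iff.2 hJ
  have : IsLocalRing (R ⧸ J) := IsLocalRing.of_surjective' (Ideal.Quotient.mk J) Ideal.Quotient.mk_surjective
  have hart : IsArtinianRing (R ⧸ J) := by
    rw [isArtinianRing_iff_isNilpotent_maximalIdeal]
    refine ⟨n, ?_⟩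
    have : maximalIdeal (R ⧸ J) ≤ Ideal.map (Ideal.Quotient.mk J) (maximalIdeal R) := by
      intro z hz
      obtain ⟨w, rfl⟩ := Ideal.Quotient.mk_surjective z
      refine Ideal.mem_map_of_mem _ ?_
      rw [mem_maximalIdeal, mem_nonunits_iff] at hz ⊢
      exact fun hw => hz (hw.map _)
    rw [Ideal.zero_eq_bot, eq_bot_iff]
    refine (Ideal.pow_right_mono this n).trans ?_
    rw [← Ideal.map_pow]
    refine (Ideal.map_mono hn).trans ?_
    rw [Ideal.map_quotient_self]
  exact isArtinian_of_surjective_algebraMap (R := R ⧸ J) (S := R) Ideal.Quotient.mk_surjective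

/-- abstract comparison of lengths -/
lemma length_lt_of {R B : Type u} [CommRing R] [IsNoetherianRing R] [IsLocalRing R] [CommRing B] [Algebra R B]
    (J : Ideal R) (J' : Ideal B) (W : Ideal R) (hJW : J ≤ W) (hW : W ≠ ⊤)
    {n : ℕ} (hn : maximalIdeal R ^ n ≤ J)
    (ψ : W →ₗ[R] B ⧸ J') (hψ : Function.Surjective ψ) (hk : ∀ w : W, (w : R) ∈ J → ψ w = 0) :
    Module.length B (B ⧸ J') < Module.length R (R ⧸ J) := by
  have hart := artinian_quot J hn
  have h1 : Module.length B (B ⧸ J') ≤ Module.length R (B ⧸ J') := by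
    have := Submodule.length_le_length_restrictScalars R (⊤ : Submodule B (B ⧸ J'))
    rwa [Submodule.restrictScalars_top, Module.length_top, Module.length_top] at this
  let W' : Submodule R (R ⧸ J) := Submodule.map J.mkQ W
  have hW' : W' ≠ ⊤ := by
    intro h
    have : J.mkQ 1 ∈ W' := h ▸ trivial
    obtain ⟨w, hw, e⟩ := this
    have h2 : w - 1 ∈ J := by
      rwa [Submodule.mkQ_apply, Submodule.mkQ_apply, Submodule.Quotient.eq] at e
    apply hW
    rw [Ideal.eq_top_iff_one]
    have := W.sub_mem hw (hJW h2)
    simpa using this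
  refine h1.trans_lt (lt_of_le_of_lt ?_ (Submodule.length_lt hW'))
  let f : W →ₗ[R] W' := (J.mkQ.restrict (p := W) (q := W') (fun w hw => ⟨w, hw, rfl⟩))
  have hf : Function.Surjective f := by
    rintro ⟨_, w, hw, rfl⟩
    exact ⟨⟨w, hw⟩, rfl⟩
  have hker : LinearMap.ker f ≤ LinearMap.ker ψ := by
    intro w hw
    rw [LinearMap.mem_ker] at hw ⊢
    apply hk
    have := congrArg Subtype.val hw
    change J.mkQ (w : R) = 0 at this
    rwa [Submodule.mkQ_apply, Submodule.Quotient.mk_eq_zero] at this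
  rw [← (f.quotKerEquivOfSurjective hf).length_eq]
  refine Module.length_le_of_surjective ((LinearMap.ker f).liftQ ψ hker) ?_
  intro z
  obtain ⟨w, rfl⟩ := hψ z
  exact ⟨Submodule.Quotient.mk w, by simp⟩

end P2c

section P2d
variable {S B : Type u} [CommRing S] [IsDomain S] [IsNoetherianRing S] (N : Ideal S) [hN : N.IsMaximal]
  [CommRing B] [IsDomain B] [IsNoetherianRing B] [IsLocalRing B] [Algebra S B] [IsLocalization.AtPrime B N]

lemma loc_inj (N : Ideal S) [hN : N.IsMaximal] [IsLocalization.AtPrime B N] : Function.Injective (algebraMap S B) :=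
  IsLocalization.injective (M := N.primeCompl) B (Ideal.primeCompl_le_nonZeroDivisors N)

lemma loc_dvd {x t : S} (hx : Prime x) (hxN : x ∈ N) (h : algebraMap S B x ∣ algebraMap S B t) : x ∣ t := by
  obtain ⟨β, hβ⟩ := h
  obtain ⟨⟨s, e⟩, hs⟩ := IsLocalization.surj N.primeCompl β
  have h1 : t * e = x * s := by
    apply loc_inj (B := B) N
    rw [map_mul, map_mul, hβ, ← hs]; ring
  rcases hx.dvd_or_dvd (⟨s, h1⟩ : x ∣ t * e) with h2 | h2
  · exact h2
  · exact absurd (N.mem_of_dvd h2 hxN) e.2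

lemma loc_par {x g : S} (hx : Prime x) (hNe : N = Ideal.span {x, g}) (hg : ¬ x ∣ g) :
    Par (algebraMap S B x) (algebraMap S B g) := by
  have hxN : x ∈ N := by rw [hNe]; exact Ideal.subset_span (by simp)
  refine par_of ?_ ?_ ?_
  · rw [← IsLocalization.AtPrime.map_eq_maximalIdeal N B]
    conv_lhs => rw [hNe]
    rw [Ideal.map_span, Set.image_pair]
  · intro h0
    exact hx.ne_zero (loc_inj (B := B) N (h0.trans (map_zero _).symm))
  · intro n hd
    rw [← map_pow] at hd
    exact hg (hx.dvd_of_dvd_pow (loc_dvd N hx hxN hd))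

lemma loc_primary {x g a b : S} (hx : Prime x) (hNe : N = Ideal.span {x, g}) (hg : ¬ x ∣ g) {n : ℕ}
    (hn : x ^ n ∈ Ideal.span {a, b}) (ha : ¬ x ∣ a) :
    ∃ q, maximalIdeal B ^ q ≤ Ideal.span {algebraMap S B a, algebraMap S B b} := by
  have hP := loc_par (B := B) N hx hNe hg
  have hxN : x ∈ N := by rw [hNe]; exact Ideal.subset_span (by simp)
  apply Ideal.exists_pow_le_of_le_radical_of_fg _ (IsNoetherian.noetherian _)
  have h1 : algebraMap S B x ∈ (Ideal.span {algebraMap S B a, algebraMap S B b}).radical := by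
    refine ⟨n, ?_⟩
    rw [← map_pow, ← Set.image_pair, ← Ideal.map_span]
    exact Ideal.mem_map_of_mem _ hn
  obtain ⟨i, c, w, hc, e⟩ := decomp hP.spn (algebraMap S B a) (fun hd => ha (loc_dvd N hx hxN hd))
  rw [hP.spn, Ideal.span_le]
  rintro _ (rfl | rfl)
  · exact h1
  · have h2 : c * algebraMap S B g ^ i ∈ (Ideal.span {algebraMap S B a, algebraMap S B b}).radical := by
      have : c * algebraMap S B g ^ i = algebraMap S B a - algebraMap S B x * w := by rw [e]; ring
      rw [this]
      exact sub_mem (Ideal.le_radical (Ideal.subset_span (by simp))) (Ideal.mul_mem_right _ _ h1)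
    rw [Ideal.unit_mul_mem_iff_mem _ hc] at h2
    exact Ideal.radical_isRadical _ ⟨i, h2⟩

lemma loc_quot_surj (N : Ideal S) [hN : N.IsMaximal] [IsLocalization.AtPrime B N] {J : Ideal B} {q : ℕ} (hq : maximalIdeal B ^ q ≤ J) (β : B) :
    ∃ s : S, β - algebraMap S B s ∈ J := by
  obtain ⟨⟨s, e⟩, hs⟩ := IsLocalization.surj N.primeCompl β
  have hu : IsUnit (algebraMap S B e) := IsLocalization.map_units B e
  have hco : N ^ q ⊔ Ideal.span {(e : S)} = ⊤ := by
    have h1 : N ⊔ Ideal.span {(e : S)} = ⊤ := by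
      by_contra hne
      have := hN.eq_of_le hne le_sup_left
      exact e.2 (by
        have h2 : (e : S) ∈ N ⊔ Ideal.span {(e : S)} := Ideal.mem_sup_right (Ideal.mem_span_singleton_self _)
        rwa [← this] at h2)
    rw [← Ideal.isCoprime_iff_sup_eq] at h1 ⊢
    exact h1.pow_left
  have h1 : (1 : S) ∈ N ^ q ⊔ Ideal.span {(e : S)} := hco ▸ trivial
  obtain ⟨ν, hν, w, hw, hsum⟩ := Submodule.mem_sup.1 h1
  obtain ⟨u, rfl⟩ := Ideal.mem_span_singleton'.1 hw
  refine ⟨s * u, ?_⟩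
  have h2 : algebraMap S B ν ∈ J := by
    apply hq
    rw [← IsLocalization.AtPrime.map_eq_maximalIdeal N B, ← Ideal.map_pow]
    exact Ideal.mem_map_of_mem _ hν
  rw [← Ideal.unit_mul_mem_iff_mem _ hu]
  have h3 : algebraMap S B ν + algebraMap S B u * algebraMap S B e = 1 := by
    rw [← map_mul, ← map_add, hsum, map_one]
  have : algebraMap S B e * (β - algebraMap S B (s * u)) = algebraMap S B s * algebraMap S B ν := by
    rw [map_mul, mul_sub, mul_comm _ β, hs]
    linear_combination -algebraMap S B s * h3
  rw [this]
  exact Ideal.mul_mem_left _ _ h2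

variable {F : Type u} [Field F] [Algebra S F] [Algebra B F] [IsScalarTower S B F]

lemma Over.of_loc {V : ValuationSubring F} (h : Over B V) : Over S V := by
  intro s
  rw [IsScalarTower.algebraMap_apply S B F]
  exact h _

lemma loc_patch {x g a b : S} (hx : Prime x) (hNe : N = Ideal.span {x, g}) (hg : ¬ x ∣ g) {n : ℕ}
    (hn : x ^ n ∈ Ideal.span {a, b}) (ha : ¬ x ∣ a) :
    ∃ e, e ∉ N ∧ ∀ s : S, algebraMap S F s ∈ vcl B {algebraMap S F a, algebraMap S F b} →
      algebraMap S F (e * s) ∈ vcl S {algebraMap S F a, algebraMap S F b} := by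
  obtain ⟨q, hq⟩ := loc_primary (B := B) N hx hNe hg hn ha
  have hP := loc_par (B := B) N hx hNe hg
  have h1 : algebraMap S B (g ^ q) ∈ Ideal.map (algebraMap S B) (Ideal.span {a, b}) := by
    rw [Ideal.map_span, Set.image_pair, map_pow]
    exact hq (Ideal.pow_mem_pow hP.y_mem q)
  rw [IsLocalization.mem_map_algebraMap_iff N.primeCompl] at h1
  obtain ⟨⟨⟨w, hw⟩, e⟩, he⟩ := h1
  have he' : g ^ q * e = w := by
    apply loc_inj (B := B) N
    rw [map_mul]; exact he
  have hmax : ∀ V : ValuationSubring F, Over S V → ∀ w ∈ Ideal.span {a, b}, ∀ z : F, V.valuation z ≤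
    V.valuation (algebraMap S F w) → ∃ t ∈ ({algebraMap S F a, algebraMap S F b} : Set F),
      V.valuation z ≤ V.valuation t := by
    intro V hV w hw z hz
    have := v_span_le hV (γ := max (V.valuation (algebraMap S F a)) (V.valuation (algebraMap S F b)))
      (by rintro _ (rfl | rfl) <;> simp) hw
    rcases le_max_iff.1 (hz.trans this) with h | h
    · exact ⟨_, by simp, h⟩
    · exact ⟨_, by simp, h⟩
  refine ⟨e, e.2, ?_⟩
  intro s hs V hV
  by_cases hB : ∀ d, d ∉ N → V.valuation (algebraMap S F d) = 1
  · have hBV : Over B V := by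
      intro β
      obtain ⟨⟨s, e⟩, hs⟩ := IsLocalization.surj N.primeCompl β
      have h2 := congrArg (algebraMap B F) hs
      rw [map_mul, ← IsScalarTower.algebraMap_apply, ← IsScalarTower.algebraMap_apply] at h2
      have h3 := congrArg V.valuation h2
      rw [map_mul, hB e e.2, mul_one] at h3
      rw [← V.valuation_le_one_iff, h3]
      exact hV.le_one s
    obtain ⟨t, ht, hle⟩ := hs V hBV
    refine ⟨t, ht, ?_⟩
    rw [map_mul, map_mul]
    calc _ ≤ 1 * V.valuation t := mul_le_mul' (hV.le_one _) hle
      _ = _ := one_mul _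
  · push Not at hB
    obtain ⟨d, hd, hd1⟩ := hB
    have hd2 : V.valuation (algebraMap S F d) < 1 := lt_of_le_of_ne (hV.le_one d) hd1
    obtain ⟨c, n', hn', hsum⟩ := hN.exists_inv hd
    have h3 : V.valuation (algebraMap S F x) = 1 ∨ V.valuation (algebraMap S F g) = 1 := by
      by_contra hcon
      push Not at hcon
      have hlx := lt_of_le_of_ne (hV.le_one x) hcon.1
      have hlg := lt_of_le_of_ne (hV.le_one g) hcon.2
      have hlN : V.valuation (algebraMap S F n') < 1 := by
        have hm : max (V.valuation (algebraMap S F x)) (V.valuation (algebraMap S F g)) < 1 := max_lt hlx hlg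
        refine lt_of_le_of_lt (v_span_le hV (T := {x, g}) ?_ (hNe ▸ hn')) hm
        rintro _ (rfl | rfl) <;> simp
      have hlc : V.valuation (algebraMap S F (c * d)) < 1 := by
        rw [map_mul, map_mul]
        refine lt_of_le_of_lt (mul_le_mul' (hV.le_one c) le_rfl) ?_
        rwa [one_mul]
      have : V.valuation (algebraMap S F 1) < 1 := by
        rw [← hsum, map_add]
        exact lt_of_le_of_lt (V.valuation.map_add _ _) (max_lt hlc hlN)
      simp at this
    have hes : V.valuation (algebraMap S F (e * s)) ≤ V.valuation (algebraMap S F e) := by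
      rw [map_mul, map_mul]
      calc _ ≤ V.valuation (algebraMap S F e) * 1 := mul_le_mul' le_rfl (hV.le_one _)
        _ = _ := mul_one _
    rcases h3 with h3 | h3
    · refine hmax V hV _ hn _ ((hV.le_one _).trans ?_)
      rw [map_pow, map_pow, h3, one_pow]
    · refine hmax V hV _ hw _ (hes.trans ?_)
      rw [← he', map_mul, map_mul, map_pow, map_pow, h3, one_pow, one_mul]

end P2d

section P2e
variable {F : Type u} [Field F] {R : Type u} [CommRing R] [IsNoetherianRing R] [IsLocalRing R]
  [IsDomain R] [Algebra R F] [FaithfulSMul R F]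

lemma Gen.mem {x y : R} (h : Par x y) {r : ℕ} (hr : 1 ≤ r) {a : R} (ha : Gen x y r a) :
    a ∈ maximalIdeal R ^ r := by
  obtain ⟨c, g₀, hc, hg₀, rfl⟩ := ha
  refine add_mem (Ideal.mul_mem_left _ _ (Ideal.pow_mem_pow h.y_mem _)) ?_
  have := Ideal.mul_mem_mul h.x_mem hg₀
  rwa [← pow_succ', Nat.sub_add_cancel hr] at this

lemma chart_xpow {x y : R} (h : Par x y) {r : ℕ} {a b : R} {n : ℕ}
    (hn : maximalIdeal R ^ n ≤ Ideal.span {a, b}) (a' b' : chart F x y)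
    (ha' : (a' : F) * algebraMap R F x ^ r = algebraMap R F a)
    (hb' : (b' : F) * algebraMap R F x ^ r = algebraMap R F b) :
    algebraMap R (chart F x y) x ^ n ∈ Ideal.span {a', b'} := by
  obtain ⟨p, q, e⟩ := Ideal.mem_span_pair.1 (hn (Ideal.pow_mem_pow h.x_mem n))
  refine Ideal.mem_span_pair.2 ⟨algebraMap R _ (p * x ^ r), algebraMap R _ (q * x ^ r), ?_⟩
  apply Subtype.ext
  have e2 := congrArg (algebraMap R F) e
  simp only [map_add, map_mul, map_pow, ← ha', ← hb'] at e2
  simp only [Subalgebra.coe_add, Subalgebra.coe_mul, Subalgebra.coe_algebraMap, Subalgebra.coe_pow, map_mul, map_pow]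
  rw [← e2]
  ring

lemma chart_ndvd {x y : R} (h : Par x y) {r : ℕ} {a : R} (ha : Gen x y r a) (a' : chart F x y)
    (ha' : (a' : F) * algebraMap R F x ^ r = algebraMap R F a) :
    ¬ algebraMap R (chart F x y) x ∣ a' := by
  rintro ⟨t, rfl⟩
  refine not_x_dvd_of_gen h ha t.2 ?_
  rw [← ha', mul_div_assoc, div_self (pow_ne_zero _ h.x_ne), mul_one]
  rfl

lemma blow_length {x y : R} (h : Par x y) {r : ℕ} (hr : 1 ≤ r) {a b : R} (ha : Gen x y r a)
    (hb : b ∈ maximalIdeal R ^ r) {n : ℕ} (hn : maximalIdeal R ^ n ≤ Ideal.span {a, b})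
    (a' b' : chart F x y) (ha' : (a' : F) * algebraMap R F x ^ r = algebraMap R F a)
    (hb' : (b' : F) * algebraMap R F x ^ r = algebraMap R F b)
    (N : Ideal (chart F x y)) [hN : N.IsMaximal] {B : Type u} [CommRing B] [IsDomain B] [IsNoetherianRing B]
    [IsLocalRing B] [Algebra (chart F x y) B] [IsLocalization.AtPrime B N] [Algebra R B]
    [IsScalarTower R (chart F x y) B] {q : ℕ}
    (hq : maximalIdeal B ^ q ≤ Ideal.span {algebraMap (chart F x y) B a', algebraMap (chart F x y) B b'}) :
    Module.length B (B ⧸ Ideal.span {algebraMap (chart F x y) B a', algebraMap (chart F x y) B b'})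
      < Module.length R (R ⧸ Ideal.span {a, b}) := by
  have hx0 := h.x_ne (F := F)
  have hWt : maximalIdeal R ^ r ≠ ⊤ := by
    intro ht
    have := Ideal.pow_le_self (I := maximalIdeal R) (n := r) (by omega)
    rw [ht, top_le_iff] at this
    exact (maximalIdeal.isMaximal R).ne_top this
  let J' := Ideal.span {algebraMap (chart F x y) B a', algebraMap (chart F x y) B b'}
  let ψ₀ : ↥(maximalIdeal R ^ r) →ₗ[R] (chart F x y) :=
    { toFun := fun w => ⟨_, div_mem h r w.2⟩
      map_add' := fun w w' => Subtype.ext (by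
        simp [add_div])
      map_smul' := fun c w => Subtype.ext (by
        simp [mul_div_assoc, Algebra.smul_def]) }
  let ψ : ↥(maximalIdeal R ^ r) →ₗ[R] B ⧸ J' :=
    ((Ideal.Quotient.mkₐ R J').toLinearMap.comp (IsScalarTower.toAlgHom R (chart F x y) B).toLinearMap).comp ψ₀
  have hψ : ∀ w, ψ w = Ideal.Quotient.mk J' (algebraMap (chart F x y) B (ψ₀ w)) := fun w => rfl
  have haJ : Ideal.span {a, b} ≤ maximalIdeal R ^ r := by
    rw [Ideal.span_le]
    rintro _ (rfl | rfl)
    · exact ha.mem h hr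
    · exact hb
  refine length_lt_of _ J' (maximalIdeal R ^ r) haJ hWt hn ψ ?_ ?_
  · intro z
    obtain ⟨β, rfl⟩ := Ideal.Quotient.mk_surjective z
    obtain ⟨s, hs⟩ := loc_quot_surj N hq β
    obtain ⟨w, hw, f, hf, e⟩ := D1 h hr ha s.2
    refine ⟨⟨x * f, ?_⟩, ?_⟩
    · have := Ideal.mul_mem_mul h.x_mem hf
      rwa [← pow_succ', Nat.sub_add_cancel hr] at this
    · rw [hψ, Ideal.Quotient.eq]
      have e2 : ψ₀ ⟨x * f, by
          have := Ideal.mul_mem_mul h.x_mem hf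
          rwa [← pow_succ', Nat.sub_add_cancel hr] at this⟩ = s + ⟨w, hw⟩ * a' := by
        apply Subtype.ext
        change algebraMap R F (x * f) / algebraMap R F x ^ r = s + w * a'
        rw [map_mul, ← e, div_eq_iff (pow_ne_zero _ hx0)]
        have e3 : algebraMap R F x ^ r = algebraMap R F x * algebraMap R F x ^ (r - 1) := by
          rw [← pow_succ', Nat.sub_add_cancel hr]
        have e4 : algebraMap R F a / algebraMap R F x ^ r = a' := by
          rw [← ha', mul_div_assoc, div_self (pow_ne_zero _ hx0), mul_one]
        rw [e4, e3]
        ring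
      rw [e2, map_add, map_mul]
      have : algebraMap (chart F x y) B s + algebraMap (chart F x y) B ⟨w, hw⟩ * algebraMap (chart F x y) B a' - β =
        algebraMap (chart F x y) B ⟨w, hw⟩ * algebraMap (chart F x y) B a' - (β - algebraMap (chart F x y) B s) := by ring
      rw [this]
      exact sub_mem (Ideal.mul_mem_left _ _ (Ideal.subset_span (Or.inl rfl))) hs
  · rintro ⟨w, hw⟩ hwJ
    obtain ⟨p, q, rfl⟩ := Ideal.mem_span_pair.1 hwJ
    rw [hψ, Ideal.Quotient.eq_zero_iff_mem]
    have : ψ₀ ⟨p * a + q * b, hw⟩ = algebraMap R (chart F x y) p * a' + algebraMap R (chart F x y) q * b' := by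
      apply Subtype.ext
      change algebraMap R F (p * a + q * b) / algebraMap R F x ^ r
        = algebraMap R F p * a' + algebraMap R F q * b'
      rw [div_eq_iff (pow_ne_zero _ hx0), map_add, map_mul, map_mul, ← ha', ← hb']
      ring
    rw [this, map_add, map_mul, map_mul]
    exact Ideal.mem_span_pair.2 ⟨_, _, rfl⟩

lemma blow [Infinite (ResidueField R)] {x y : R} (h : Par x y) {r : ℕ} (hr : 1 ≤ r) {a b : R} (ha : Gen x y r a)
    (hb : b ∈ maximalIdeal R ^ r) {n : ℕ} (hn : maximalIdeal R ^ n ≤ Ideal.span {a, b})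
    (a' b' : chart F x y) (ha' : (a' : F) * algebraMap R F x ^ r = algebraMap R F a)
    (hb' : (b' : F) * algebraMap R F x ^ r = algebraMap R F b)
    (N : Ideal (chart F x y)) [hN : N.IsMaximal] (haN : a' ∈ N) (hbN : b' ∈ N) :
    ∃ (B : Type u) (_ : CommRing B) (_ : IsDomain B) (_ : IsNoetherianRing B) (_ : IsLocalRing B)
      (_ : Algebra B F) (_ : FaithfulSMul B F) (_ : Infinite (ResidueField B)) (a₁ b₁ : B),
      (∃ x y : B, Par x y) ∧ algebraMap B F a₁ = a' ∧ algebraMap B F b₁ = b' ∧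
      (∃ q, maximalIdeal B ^ q ≤ Ideal.span {a₁, b₁}) ∧
      Module.length B (B ⧸ Ideal.span {a₁, b₁}) < Module.length R (R ⧸ Ideal.span {a, b}) ∧
      (∀ s : chart F x y, ∃ β : B, algebraMap B F β = s) ∧
      (∀ β : B, ∃ s e : chart F x y, e ∉ N ∧ algebraMap B F β * e = s) ∧
      (∀ e : chart F x y, e ∉ N → ∃ β : B, algebraMap B F β * e = 1) ∧
      ∃ e, e ∉ N ∧ ∀ s : chart F x y, (s : F) ∈ vcl B {(a' : F), (b' : F)} →
        ((e * s : chart F x y) : F) ∈ vcl (chart F x y) {(a' : F), (b' : F)} := by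
  have hx0 := h.x_ne (F := F)
  have hxp : Prime (algebraMap R (chart F x y) x) := chart_prime h
  have hxn := chart_xpow h hn a' b' ha' hb'
  have hand := chart_ndvd h ha a' ha'
  have hxN : algebraMap R (chart F x y) x ∈ N := by
    refine hN.isPrime.mem_of_pow_mem n ?_
    refine (Ideal.span_le.2 ?_ : Ideal.span {a', b'} ≤ N) hxn
    rintro _ (rfl | rfl)
    · exact haN
    · exact hbN
  obtain ⟨g, hNe, hg⟩ := chart_max h N hxN
  let B := Localization.AtPrime N
  have hBd : IsDomain B := IsLocalization.isDomain_localization (Ideal.primeCompl_le_nonZeroDivisors N)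
  have hBn : IsNoetherianRing B := IsLocalization.isNoetherianRing N.primeCompl B inferInstance
  have hunits : ∀ e : N.primeCompl, IsUnit (algebraMap (chart F x y) F e) := by
    intro e
    rw [isUnit_iff_ne_zero]
    intro h0
    have : (e : (chart F x y)) = 0 := Subtype.ext h0
    exact e.2 (this ▸ zero_mem _)
  letI hBF : Algebra B F := (IsLocalization.lift (M := N.primeCompl) hunits).toAlgebra
  haveI htow : IsScalarTower (chart F x y) B F := IsScalarTower.of_algebraMap_eq (fun s => by
    exact (IsLocalization.lift_eq (M := N.primeCompl) hunits s).symm)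
  have hinjB : Function.Injective (algebraMap B F) := by
    rw [injective_iff_map_eq_zero]
    intro β hβ
    obtain ⟨⟨s, e⟩, hs⟩ := IsLocalization.surj N.primeCompl β
    have h2 := congrArg (algebraMap B F) hs
    rw [map_mul, hβ, zero_mul, ← IsScalarTower.algebraMap_apply] at h2
    have h3 : s = 0 := Subtype.ext h2.symm
    rw [h3, map_zero] at hs
    exact (mul_eq_zero.1 hs).resolve_right (IsLocalization.map_units B e).ne_zero
  haveI hfaith : FaithfulSMul B F := (faithfulSMul_iff_algebraMap_injective B F).2 hinjB
  have hP : Par (algebraMap (chart F x y) B (algebraMap R (chart F x y) x)) (algebraMap (chart F x y) B g) := loc_par N hxp hNe hg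
  obtain ⟨q, hq⟩ := loc_primary (B := B) N hxp hNe hg hxn hand
  have hyx : algebraMap R (chart F x y) y = algebraMap R (chart F x y) x * ⟨_, T_mem x y⟩ := by
    apply Subtype.ext
    change algebraMap R F y = algebraMap R F x * (algebraMap R F y / algebraMap R F x)
    field_simp
  have hmB : ∀ z ∈ maximalIdeal R, algebraMap R B z ∈ maximalIdeal B := by
    intro z hz
    obtain ⟨p, q, rfl⟩ := (mem_m_iff h.spn z).1 hz
    rw [IsScalarTower.algebraMap_apply R (chart F x y) B, map_add, map_mul, map_mul, hyx, map_add, map_mul, map_mul, map_mul]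
    exact add_mem (Ideal.mul_mem_left _ _ hP.x_mem)
      (Ideal.mul_mem_left _ _ (Ideal.mul_mem_right _ _ hP.x_mem))
  haveI : IsLocalHom (algebraMap R B) := by
    constructor
    intro z hz
    by_contra hcon
    exact hmB z hcon hz
  have hinf : Infinite (ResidueField B) :=
    Infinite.of_injective (ResidueField.map (algebraMap R B)) (RingHom.injective _)
  refine ⟨B, inferInstance, hBd, hBn, inferInstance, hBF, hfaith, hinf, algebraMap (chart F x y) B a', algebraMap (chart F x y) B b',
    ⟨_, _, hP⟩, ?_, ?_, ⟨q, hq⟩, ?_, ?_, ?_, ?_, ?_⟩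
  · exact (IsScalarTower.algebraMap_apply (chart F x y) B F a').symm
  · exact (IsScalarTower.algebraMap_apply (chart F x y) B F b').symm
  · exact blow_length h hr ha hb hn a' b' ha' hb' N hq
  · intro s
    exact ⟨algebraMap (chart F x y) B s, (IsScalarTower.algebraMap_apply (chart F x y) B F s).symm⟩
  · intro β
    obtain ⟨⟨s, e⟩, hs⟩ := IsLocalization.surj N.primeCompl β
    refine ⟨s, e, e.2, ?_⟩
    have h2 := congrArg (algebraMap B F) hs
    rw [map_mul, ← IsScalarTower.algebraMap_apply, ← IsScalarTower.algebraMap_apply] at h2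
    exact h2
  · intro e he
    obtain ⟨β, hβ⟩ := (IsLocalization.map_units B (⟨e, he⟩ : N.primeCompl)).exists_left_inv
    refine ⟨β, ?_⟩
    have h2 := congrArg (algebraMap B F) hβ
    rw [map_mul, map_one, ← IsScalarTower.algebraMap_apply] at h2
    exact h2
  · exact loc_patch (B := B) N hxp hNe hg hxn hand

end P2e

section P3
variable (F : Type u) [Field F] {R : Type u} [CommRing R] [Algebra R F]

/-- Integral closure of a two generated ideal, by valuations. -/
def Iv (a b : R) : Ideal R where
  carrier := {z | algebraMap R F z ∈ vcl R {algebraMap R F a, algebraMap R F b}}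
  add_mem' := by
    intro z w hz hw V hV
    obtain ⟨t, ht, h1⟩ := hz V hV
    obtain ⟨t', ht', h2⟩ := hw V hV
    rw [map_add]
    rcases le_max_iff.1 (V.valuation.map_add (algebraMap R F z) (algebraMap R F w)) with h | h
    · exact ⟨t, ht, h.trans h1⟩
    · exact ⟨t', ht', h.trans h2⟩
  zero_mem' := by
    intro V hV
    exact ⟨_, Or.inl rfl, by simp⟩
  smul_mem' := by
    intro c z hz V hV
    obtain ⟨t, ht, h1⟩ := hz V hV
    refine ⟨t, ht, ?_⟩
    rw [smul_eq_mul, map_mul, map_mul]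
    calc _ ≤ 1 * V.valuation t := mul_le_mul' (hV.le_one _) h1
      _ = _ := one_mul _

/-- The colon of `(a,b)` by its integral closure. -/
def Kc (a b : R) : Ideal R where
  carrier := {k | ∀ i ∈ Iv F a b, k * i ∈ Ideal.span {a, b}}
  add_mem' := by
    intro k l hk hl i hi
    rw [add_mul]
    exact add_mem (hk i hi) (hl i hi)
  zero_mem' := by
    intro i hi
    rw [zero_mul]; exact zero_mem _
  smul_mem' := by
    intro c k hk i hi
    rw [smul_eq_mul, mul_assoc]
    exact Ideal.mul_mem_left _ _ (hk i hi)

variable {F}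

lemma mem_Iv {a b z : R} : z ∈ Iv F a b ↔
    algebraMap R F z ∈ vcl R {algebraMap R F a, algebraMap R F b} := Iff.rfl

lemma mem_Kc {a b k : R} : k ∈ Kc F a b ↔ ∀ i ∈ Iv F a b, k * i ∈ Ideal.span {a, b} := Iff.rfl

lemma left_mem_Iv (a b : R) : a ∈ Iv F a b := fun V hV => ⟨_, Or.inl rfl, le_rfl⟩
lemma right_mem_Iv (a b : R) : b ∈ Iv F a b := fun V hV => ⟨_, Or.inr rfl, le_rfl⟩

lemma span_le_Iv (a b : R) : Ideal.span {a, b} ≤ Iv F a b := by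
  rw [Ideal.span_le]
  rintro _ (rfl | rfl)
  · exact left_mem_Iv _ _
  · exact right_mem_Iv _ _

lemma Iv_comm (a b : R) : Iv F a b = Iv F b a := by
  ext z
  rw [mem_Iv, mem_Iv, Set.pair_comm]

lemma span_le_Kc (a b : R) : Ideal.span {a, b} ≤ Kc F a b := by
  intro z hz i hi
  exact Ideal.mul_mem_right _ _ hz

lemma Kc_comm (a b : R) : Kc F a b = Kc F b a := by
  ext z
  rw [mem_Kc, mem_Kc, Set.pair_comm, Iv_comm]

lemma mem_Iv_of_le {a b z w : R} (hw : w ∈ Iv F a b) (h : ∀ V : ValuationSubring F, Over R V →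
    V.valuation (algebraMap R F z) ≤ V.valuation (algebraMap R F w)) : z ∈ Iv F a b := by
  intro V hV
  obtain ⟨t, ht, h1⟩ := hw V hV
  exact ⟨t, ht, (h V hV).trans h1⟩

lemma mem_span_mul {a b z : R} {C : Ideal R} : z ∈ Ideal.span {a, b} * C ↔
    ∃ s ∈ C, ∃ t ∈ C, z = a * s + b * t := by
  rw [Ideal.span_insert, Ideal.sup_mul, Submodule.mem_sup]
  constructor
  · rintro ⟨u, hu, v, hv, rfl⟩
    obtain ⟨s, hs, rfl⟩ := Ideal.mem_span_singleton_mul.1 hu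
    obtain ⟨t, ht, rfl⟩ := Ideal.mem_span_singleton_mul.1 hv
    exact ⟨s, hs, t, ht, rfl⟩
  · rintro ⟨s, hs, t, ht, rfl⟩
    exact ⟨_, Ideal.mem_span_singleton_mul.2 ⟨s, hs, rfl⟩, _, Ideal.mem_span_singleton_mul.2 ⟨t, ht, rfl⟩, rfl⟩

end P3

section P3b
variable {F : Type u} [Field F] {R : Type u} [CommRing R] [IsNoetherianRing R] [IsLocalRing R]
  [IsDomain R] [Algebra R F] [FaithfulSMul R F]

lemma over_of_chart {x y : R} {V : ValuationSubring F} (hV : Over (chart F x y) V) : Over R V :=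
  fun r => hV (algebraMap R (chart F x y) r)

lemma v_alt {x y : R} (h : Par x y) {V : ValuationSubring F} (hV : Over R V) :
    Over (chart F x y) V ∨ ∃ γ : V.ValueGroup, γ ≠ 0 ∧
      (∀ d, ∀ f ∈ maximalIdeal R ^ d, V.valuation (algebraMap R F f) ≤ γ ^ d) ∧
      ∀ r, 1 ≤ r → ∀ a, Gen x y r a → V.valuation (algebraMap R F a) = γ ^ r := by
  have hx := h.x_ne (F := F)
  by_cases hyx : V.valuation (algebraMap R F y) ≤ V.valuation (algebraMap R F x)
  · left
    rintro ⟨s, hs⟩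
    change s ∈ V
    refine Algebra.adjoin_induction (p := fun s _ => s ∈ V) ?_ ?_ ?_ ?_ hs
    · rintro _ rfl
      rw [← V.valuation_le_one_iff, map_div₀]
      exact div_le_one_of_le₀ hyx zero_le
    · exact hV
    · exact fun _ _ _ _ h1 h2 => add_mem h1 h2
    · exact fun _ _ _ _ h1 h2 => mul_mem h1 h2
  · right
    rw [not_le] at hyx
    have hm : ∀ f ∈ maximalIdeal R, V.valuation (algebraMap R F f) ≤ V.valuation (algebraMap R F y) := by
      intro f hf
      rw [h.spn] at hf
      refine v_span_le hV ?_ hf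
      rintro _ (rfl | rfl)
      · exact hyx.le
      · exact le_rfl
    have hy0 : V.valuation (algebraMap R F y) ≠ 0 := (lt_of_le_of_lt zero_le hyx).ne'
    have hmd : ∀ d, ∀ f ∈ maximalIdeal R ^ d, V.valuation (algebraMap R F f)
      ≤ V.valuation (algebraMap R F y) ^ d := fun d f hf => v_pow_le hV hm d hf
    refine ⟨_, hy0, hmd, ?_⟩
    rintro r hr a ⟨c, g₀, hc, hg₀, rfl⟩
    have hc1 : V.valuation (algebraMap R F c) = 1 := by
      refine le_antisymm (hV.le_one c) ?_
      obtain ⟨c', hc'⟩ := hc.exists_left_inv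
      have := congrArg (fun z => V.valuation (algebraMap R F z)) hc'
      simp only [map_mul, map_one] at this
      rw [← this]
      calc _ ≤ 1 * V.valuation (algebraMap R F c) := mul_le_mul' (hV.le_one _) le_rfl
        _ = _ := one_mul _
    have h1 : V.valuation (algebraMap R F (c * y ^ r)) = V.valuation (algebraMap R F y) ^ r := by
      rw [map_mul, map_mul, hc1, one_mul, map_pow, map_pow]
    have h2 : V.valuation (algebraMap R F (x * g₀)) < V.valuation (algebraMap R F y) ^ r := by
      rw [map_mul, map_mul]
      have : V.valuation (algebraMap R F y) ^ r = V.valuation (algebraMap R F y) *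
        V.valuation (algebraMap R F y) ^ (r - 1) := by
        rw [← pow_succ', Nat.sub_add_cancel hr]
      rw [this]
      refine lt_of_le_of_lt (mul_le_mul' le_rfl (hmd _ _ hg₀)) ?_
      exact mul_lt_mul_of_pos_right hyx (zero_lt_iff.2 (pow_ne_zero _ hy0))
    rw [map_add, Valuation.map_add_eq_of_lt_left _ (by rw [h1]; exact h2), h1]

lemma ord_vcl {x y : R} (h : Par x y) {d : ℕ} {T : Set F}
    (hT : ∀ t ∈ T, ∃ f ∈ maximalIdeal R ^ d, t = algebraMap R F f) {z : R}
    (hz : algebraMap R F z ∈ vcl R T) : z ∈ maximalIdeal R ^ d := by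
  by_contra hzd
  have hx := h.x_ne (F := F)
  have hz0 : z ≠ 0 := by
    rintro rfl
    exact hzd (zero_mem _)
  obtain ⟨q, hq, hq'⟩ := exists_ord hz0
  have hqd : q < d := by
    by_contra hcon
    exact hzd (Ideal.pow_le_pow_right (not_lt.1 hcon) hq)
  have hp := chart_prime (F := F) h
  haveI : (Ideal.span {algebraMap R (chart F x y) x}).IsPrime :=
    (Ideal.span_singleton_prime hp.ne_zero).2 hp
  obtain ⟨V, hV, h1, h2⟩ := exists_center (F := F) (Ideal.span {algebraMap R (chart F x y) x})
  have hvx : V.valuation (algebraMap R F x) < 1 := h1 _ (Ideal.mem_span_singleton_self _)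
  have hvx0 : V.valuation (algebraMap R F x) ≠ 0 := (Valuation.ne_zero_iff _).2 hx
  have hvz : V.valuation (algebraMap R F z) = V.valuation (algebraMap R F x) ^ q := by
    have := h2 ⟨_, div_mem h q hq⟩ (by
      rw [Ideal.mem_span_singleton]
      rintro ⟨t, ht⟩
      apply hq'
      apply mem_pow_of_chart h t.2
      have := congrArg Subtype.val ht
      change algebraMap R F z / algebraMap R F x ^ q = algebraMap R F x * t at this
      rw [div_eq_iff (pow_ne_zero _ hx)] at this
      rw [this]; ring)
    change V.valuation (algebraMap R F z / algebraMap R F x ^ q) = 1 at this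
    rw [map_div₀, div_eq_one_iff_eq (by rw [map_pow]; exact pow_ne_zero _ hvx0), map_pow] at this
    exact this
  obtain ⟨t, ht, hle⟩ := hz V (over_of_chart hV)
  obtain ⟨f, hf, rfl⟩ := hT t ht
  have hvf : V.valuation (algebraMap R F f) ≤ V.valuation (algebraMap R F x) ^ d := by
    have := hV.le_one ⟨_, div_mem h d hf⟩
    change V.valuation (algebraMap R F f / algebraMap R F x ^ d) ≤ 1 at this
    rw [map_div₀, map_pow, div_le_one₀ (zero_lt_iff.2 (pow_ne_zero _ hvx0))] at this
    exact this
  have h3 : V.valuation (algebraMap R F x) ^ d < V.valuation (algebraMap R F x) ^ q :=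
    pow_lt_pow_right_of_lt_one₀ (zero_lt_iff.2 hvx0) hvx hqd
  rw [hvz] at hle
  exact absurd (hle.trans hvf) (not_le.2 h3)

lemma lift_Iv {x y : R} (h : Par x y) {r : ℕ} (hr : 1 ≤ r) {a b : R} (ha : Gen x y r a)
    {a' b' : chart F x y} (ha' : (a' : F) * algebraMap R F x ^ r = algebraMap R F a)
    (hb' : (b' : F) * algebraMap R F x ^ r = algebraMap R F b) {s : chart F x y} (hs : s ∈ Iv F a' b')
    {f : R} (hf : f ∈ maximalIdeal R ^ r) (e : (s : F) * algebraMap R F x ^ r = algebraMap R F f) :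
    f ∈ Iv F a b := by
  intro V hV
  rcases v_alt h hV with hS | ⟨γ, hγ, h1, h2⟩
  · obtain ⟨t, ht, hle⟩ := hs V hS
    refine ⟨t * algebraMap R F x ^ r, ?_, ?_⟩
    · rcases ht with rfl | rfl
      · left; exact ha'
      · right; exact hb'
    · rw [← e, map_mul, map_mul]
      exact mul_le_mul' hle le_rfl
  · exact ⟨_, Or.inl rfl, by rw [h2 r hr a ha]; exact h1 r f hf⟩

/-- descent to the chart of membership in the closure -/
lemma chart_vcl {x y : R} (h : Par x y) {d : ℕ} {T : Set F} {T' : Set F}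
    (hT : ∀ t ∈ T, t / algebraMap R F x ^ d ∈ T') {z : R}
    (hz : algebraMap R F z ∈ vcl R T) :
    algebraMap R F z / algebraMap R F x ^ d ∈ vcl (chart F x y) T' := by
  intro V hV
  obtain ⟨t, ht, hle⟩ := hz V (over_of_chart hV)
  refine ⟨_, hT t ht, ?_⟩
  rw [map_div₀, map_div₀]
  exact div_le_div_of_nonneg_right hle zero_le

end P3b

section P3c
variable (F : Type u) [Field F]

/-- Part (A) for all regular local rings of colength less than `n`. -/
def HA (n : ℕ) : Prop := ∀ (R : Type u) [CommRing R] [IsDomain R] [IsNoetherianRing R] [IsLocalRing R]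
  [Algebra R F] [FaithfulSMul R F] [Infinite (ResidueField R)], (∃ x y : R, Par x y) →
  ∀ (a b : R), (∃ q, maximalIdeal R ^ q ≤ Ideal.span {a, b}) →
  Module.length R (R ⧸ Ideal.span {a, b}) < n →
  ∀ z : R, algebraMap R F z ∈ vcl R {algebraMap R F a * algebraMap R F a, algebraMap R F b * algebraMap R F b} →
  z ∈ Ideal.span {a, b} * Iv F a b

variable {F} {R : Type u} [CommRing R] [IsDomain R] [IsNoetherianRing R] [IsLocalRing R]
  [Algebra R F] [FaithfulSMul R F] [Infinite (ResidueField R)]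

lemma vcl_chart_le_loc {B : Type u} [CommRing B] [Algebra B F] {S : Subalgebra R F}
    (hSB : ∀ s : S, ∃ β : B, algebraMap B F β = s) {T : Set F} {z : F} (hz : z ∈ vcl S T) : z ∈ vcl B T := by
  intro V hV
  refine hz V ?_
  intro s
  obtain ⟨β, hβ⟩ := hSB s
  change (s : F) ∈ V
  rw [← hβ]
  exact hV β

lemma stepA {n : ℕ} (IH : HA F n) {x y : R} (h : Par x y) {r : ℕ} (hr : 1 ≤ r) {a b : R} (ha : Gen x y r a)
    (hb : b ∈ maximalIdeal R ^ r) {q : ℕ} (hq : maximalIdeal R ^ q ≤ Ideal.span {a, b})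
    (hl : Module.length R (R ⧸ Ideal.span {a, b}) < (n + 1 : ℕ)) (z : R)
    (hz : algebraMap R F z ∈ vcl R {algebraMap R F a * algebraMap R F a, algebraMap R F b * algebraMap R F b}) :
    z ∈ Ideal.span {a, b} * Iv F a b := by
  have hx0 := h.x_ne (F := F)
  have ham := ha.mem h hr
  have hzm : z ∈ maximalIdeal R ^ (r + r) := by
    refine ord_vcl h ?_ hz
    rintro _ (rfl | rfl)
    · exact ⟨a * a, by rw [pow_add]; exact Ideal.mul_mem_mul ham ham, by rw [map_mul]⟩
    · exact ⟨b * b, by rw [pow_add]; exact Ideal.mul_mem_mul hb hb, by rw [map_mul]⟩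
  obtain ⟨a', ha'⟩ : ∃ a' : chart F x y, (a' : F) = algebraMap R F a / algebraMap R F x ^ r :=
    ⟨⟨_, div_mem h r ham⟩, rfl⟩
  obtain ⟨b', hb'⟩ : ∃ b' : chart F x y, (b' : F) = algebraMap R F b / algebraMap R F x ^ r :=
    ⟨⟨_, div_mem h r hb⟩, rfl⟩
  obtain ⟨z', hz'⟩ : ∃ z' : chart F x y, (z' : F) = algebraMap R F z / algebraMap R F x ^ (r + r) :=
    ⟨⟨_, div_mem h _ hzm⟩, rfl⟩
  have ha2 : (a' : F) * algebraMap R F x ^ r = algebraMap R F a := by rw [ha', div_mul_cancel₀ _ (pow_ne_zero _ hx0)]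
  have hb2 : (b' : F) * algebraMap R F x ^ r = algebraMap R F b := by rw [hb', div_mul_cancel₀ _ (pow_ne_zero _ hx0)]
  have hz2 : (z' : F) * algebraMap R F x ^ (r + r) = algebraMap R F z := by rw [hz', div_mul_cancel₀ _ (pow_ne_zero _ hx0)]
  have hzS : (z' : F) ∈ vcl (chart F x y) {(a' : F) * a', (b' : F) * b'} := by
    rw [hz']
    refine chart_vcl h ?_ hz
    rintro _ (rfl | rfl)
    · left; rw [ha', pow_add, mul_div_mul_comm]
    · right; rw [Set.mem_singleton_iff, hb', pow_add, mul_div_mul_comm]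
  let L : Ideal (chart F x y) := Submodule.comap (LinearMap.mulRight (chart F x y) z')
    (Ideal.span {a', b'} * Iv F a' b')
  have hLmem : ∀ e, e ∈ L ↔ e * z' ∈ Ideal.span {a', b'} * Iv F a' b' := fun e => Iff.rfl
  have hLtop : L = ⊤ := by
    by_contra hL
    obtain ⟨N, hN, hLN⟩ := Ideal.exists_le_maximal L hL
    have haN : a' ∈ N := by
      have : a' * a' ∈ L := by
        rw [hLmem, mul_assoc]
        exact Ideal.mul_mem_mul (Ideal.subset_span (Or.inl rfl)) (Ideal.mul_mem_right _ _ (left_mem_Iv _ _))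
      exact (hN.isPrime.mem_or_mem (hLN this)).elim id id
    have hbN : b' ∈ N := by
      have : b' * b' ∈ L := by
        rw [hLmem, mul_assoc]
        exact Ideal.mul_mem_mul (Ideal.subset_span (Or.inr rfl)) (Ideal.mul_mem_right _ _ (right_mem_Iv _ _))
      exact (hN.isPrime.mem_or_mem (hLN this)).elim id id
    obtain ⟨B, _, _, _, _, _, _, _, a₁, b₁, hP, ha1, hb1, hq1, hlen, hSB, hfr, -, e, heN, hpatch⟩ :=
      blow h hr ha hb hq a' b' ha2 hb2 N haN hbN
    obtain ⟨z₁, hz1⟩ := hSB z'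
    have hlen' : Module.length B (B ⧸ Ideal.span {a₁, b₁}) < n := by
      refine lt_of_lt_of_le hlen ?_
      rw [Nat.cast_add, Nat.cast_one] at hl
      exact Order.le_of_lt_add_one hl
    have hz1v : algebraMap B F z₁ ∈ vcl B {algebraMap B F a₁ * algebraMap B F a₁, algebraMap B F b₁ * algebraMap B F b₁} := by
      rw [hz1, ha1, hb1]
      exact vcl_chart_le_loc hSB hzS
    obtain ⟨s, hs, t, ht, est⟩ := mem_span_mul.1 (IH B hP a₁ b₁ hq1 hlen' z₁ hz1v)
    obtain ⟨s₀, e₁, he1, hse⟩ := hfr s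
    obtain ⟨t₀, e₂, he2, hte⟩ := hfr t
    have key : ∀ (u : B) (u₀ f₁ f₂ : chart F x y), u ∈ Iv F a₁ b₁ → algebraMap B F u * f₁ = u₀ →
        e * (f₂ * u₀) ∈ Iv F a' b' := by
      intro u u₀ f₁ f₂ hu huf
      refine hpatch _ ?_
      obtain ⟨f₁', hf1⟩ := hSB f₁
      obtain ⟨f₂', hf2⟩ := hSB f₂
      have : f₂' * (u * f₁') ∈ Iv F a₁ b₁ := Ideal.mul_mem_left _ _ (Ideal.mul_mem_right _ _ hu)
      rw [mem_Iv, map_mul, map_mul, hf1, hf2, huf, ha1, hb1] at this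
      exact this
    have hmem : e * e₁ * e₂ ∈ L := by
      rw [hLmem, mem_span_mul]
      refine ⟨_, key s s₀ e₁ e₂ hs hse, _, key t t₀ e₂ e₁ ht hte, ?_⟩
      apply Subtype.ext
      have e3 := congrArg (algebraMap B F) est
      rw [hz1, map_add, map_mul, map_mul, ha1, hb1] at e3
      simp only [Subalgebra.coe_mul, Subalgebra.coe_add]
      rw [e3, ← hse, ← hte]
      ring
    have := hLN hmem
    rcases hN.isPrime.mem_or_mem this with h4 | h4
    · rcases hN.isPrime.mem_or_mem h4 with h5 | h5
      · exact heN h5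
      · exact he1 h5
    · exact he2 h4
  have h1 : (1 : chart F x y) ∈ L := hLtop ▸ trivial
  rw [hLmem, one_mul, mem_span_mul] at h1
  obtain ⟨s, hs, t, ht, est⟩ := h1
  obtain ⟨w, hw, f, hf, ef⟩ := D1 h hr ha t.2
  have hs2 : s - ⟨w, hw⟩ * b' ∈ Iv F a' b' := sub_mem hs (Ideal.mul_mem_left _ _ (right_mem_Iv _ _))
  have ht2 : t + ⟨w, hw⟩ * a' ∈ Iv F a' b' := add_mem ht (Ideal.mul_mem_left _ _ (left_mem_Iv _ _))
  have est2 : (z' : F) = a' * (s - w * b') + b' * (t + w * a') := by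
    have := congrArg Subtype.val est
    simp only [Subalgebra.coe_mul, Subalgebra.coe_add] at this
    rw [this]; ring
  have hxf : x * f ∈ maximalIdeal R ^ r := by
    have := Ideal.mul_mem_mul h.x_mem hf
    rwa [← pow_succ', Nat.sub_add_cancel hr] at this
  have et : (t + w * a' : F) * algebraMap R F x ^ r = algebraMap R F (x * f) := by
    rw [map_mul, ← ef, ← ha']
    have e3 : algebraMap R F x ^ r = algebraMap R F x * algebraMap R F x ^ (r - 1) := by
      rw [← pow_succ', Nat.sub_add_cancel hr]
    rw [e3]; ring
  obtain ⟨f₂, hf2, es⟩ := D2 h ha (s := s - w * b') (sub_mem s.2 (mul_mem hw b'.2)) (d := r) (g := z - b * (x * f)) (by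
    rw [← ha', map_sub, map_mul, ← et, ← hb2, ← hz2, est2]
    ring)
  rw [mem_span_mul]
  refine ⟨f₂, lift_Iv h hr ha ha2 hb2 hs2 hf2 es, x * f, lift_Iv h hr ha ha2 hb2 ht2 hxf et, ?_⟩
  apply inj_of (F := F)
  rw [map_add, map_mul, map_mul, ← es, ← et, ← ha2, ← hb2, ← hz2, est2]
  ring

lemma primary_ne_bot {J : Ideal R} (hP : ∃ x y : R, Par x y) {q : ℕ} (hq : maximalIdeal R ^ q ≤ J) : J ≠ ⊥ := by
  obtain ⟨x, y, h⟩ := hP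
  rintro rfl
  have := hq (Ideal.pow_mem_pow h.x_mem q)
  exact pow_ne_zero q h.prm.ne_zero this

/-- Choice of good coordinates. -/
lemma exists_setup (hP : ∃ x y : R, Par x y) {a b : R} {q : ℕ} (hq : maximalIdeal R ^ q ≤ Ideal.span {a, b})
    (ht : Ideal.span {a, b} ≠ ⊤) : ∃ r, 1 ≤ r ∧ a ∈ maximalIdeal R ^ r ∧ b ∈ maximalIdeal R ^ r ∧
      (a ∉ maximalIdeal R ^ (r + 1) ∨ b ∉ maximalIdeal R ^ (r + 1)) := by
  obtain ⟨r, hJr, g, hg, hgr⟩ := exists_ord_ideal (primary_ne_bot hP hq)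
  refine ⟨r, ?_, hJr (Ideal.subset_span (Or.inl rfl)), hJr (Ideal.subset_span (Or.inr rfl)), ?_⟩
  · by_contra hcon
    have : r = 0 := by omega
    subst this
    rw [zero_add, pow_one] at hgr
    exact hgr (le_maximalIdeal ht hg)
  · by_contra hcon
    push Not at hcon
    apply hgr
    refine (Ideal.span_le.2 ?_ : Ideal.span {a, b} ≤ _) hg
    rintro _ (rfl | rfl)
    · exact hcon.1
    · exact hcon.2

lemma Iv_eq_top_of_unit {a b : R} (h : IsUnit a) : Iv F a b = ⊤ :=
  Ideal.eq_top_of_isUnit_mem _ (left_mem_Iv a b) h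

lemma span_pair_eq_top {a b : R} (h : Ideal.span {a, b} = ⊤) : IsUnit a ∨ IsUnit b := by
  by_contra hcon
  push Not at hcon
  have : Ideal.span {a, b} ≤ maximalIdeal R := by
    rw [Ideal.span_le]
    rintro _ (rfl | rfl)
    · exact hcon.1
    · exact hcon.2
  rw [h, top_le_iff] at this
  exact (maximalIdeal.isMaximal R).ne_top this

theorem partA' (n : ℕ) : HA F n := by
  induction n with
  | zero =>
    intro R _ _ _ _ _ _ _ hP a b hq hl
    simp at hl
  | succ n IH =>
    intro R _ _ _ _ _ _ _ hP a b hq hl z hz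
    obtain ⟨q, hq⟩ := hq
    by_cases ht : Ideal.span {a, b} = ⊤
    · have : Iv F a b = ⊤ := by
        rcases span_pair_eq_top ht with h | h
        · exact Iv_eq_top_of_unit h
        · rw [Iv_comm]; exact Iv_eq_top_of_unit h
      rw [ht, this, Ideal.top_mul]; trivial
    · obtain ⟨r, hr, har, hbr, hor⟩ := exists_setup hP hq ht
      rcases hor with ha | hb
      · obtain ⟨x, y, h, hga, -⟩ := exists_gen hP har ha har ha
        exact stepA IH h hr hga hbr hq hl z hz
      · obtain ⟨x, y, h, hgb, -⟩ := exists_gen hP hbr hb hbr hb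
        rw [Set.pair_comm] at hq hl hz
        rw [Set.pair_comm, Iv_comm]
        exact stepA IH h hr hgb har hq hl z hz

theorem partA (hP : ∃ x y : R, Par x y) {a b : R} {q : ℕ} (hq : maximalIdeal R ^ q ≤ Ideal.span {a, b})
    {z : R} (hz : algebraMap R F z ∈ vcl R {algebraMap R F a * algebraMap R F a, algebraMap R F b * algebraMap R F b}) :
    z ∈ Ideal.span {a, b} * Iv F a b := by
  have hart := artinian_quot _ hq
  have hfin : Module.length R (R ⧸ Ideal.span {a, b}) ≠ ⊤ := Module.length_ne_top
  obtain ⟨m, hm⟩ := ENat.ne_top_iff_exists.1 hfin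
  refine partA' (m + 1) R hP a b ⟨q, hq⟩ ?_ z hz
  rw [← hm]
  exact_mod_cast Nat.lt_succ_self m

end P3c

section P3d
variable {F : Type u} [Field F] {R : Type u} [CommRing R] [IsDomain R] [IsNoetherianRing R] [IsLocalRing R]
  [Algebra R F] [FaithfulSMul R F] [Infinite (ResidueField R)]

lemma Iv_mul_Iv (hP : ∃ x y : R, Par x y) {a b : R} {q : ℕ} (hq : maximalIdeal R ^ q ≤ Ideal.span {a, b})
    {i j : R} (hi : i ∈ Iv F a b) (hj : j ∈ Iv F a b) : i * j ∈ Ideal.span {a, b} * Iv F a b := by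
  refine partA hP hq ?_
  intro V hV
  obtain ⟨s, hs, h1⟩ := hi V hV
  obtain ⟨t, ht, h2⟩ := hj V hV
  rw [map_mul, map_mul]
  rcases le_total (V.valuation s) (V.valuation t) with h3 | h3
  · refine ⟨t * t, ?_, ?_⟩
    · rcases ht with rfl | rfl
      · left; rfl
      · right; rfl
    · rw [map_mul]; exact mul_le_mul' (h1.trans h3) h2
  · refine ⟨s * s, ?_, ?_⟩
    · rcases hs with rfl | rfl
      · left; rfl
      · right; rfl
    · rw [map_mul]; exact mul_le_mul' h1 (h2.trans h3)

/-- `I K ⊆ J K` whenever `I² ⊆ J I` and `K = J : I`. -/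
lemma colon_mul (hP : ∃ x y : R, Par x y) {a b : R} {q : ℕ} (hq : maximalIdeal R ^ q ≤ Ideal.span {a, b})
    {I : Ideal R} (h2 : ∀ i ∈ I, ∀ j ∈ I, i * j ∈ Ideal.span {a, b} * I) {k i : R}
    (hk : ∀ i ∈ I, k * i ∈ Ideal.span {a, b}) (hi : i ∈ I) :
    ∃ s t, (∀ i ∈ I, s * i ∈ Ideal.span {a, b}) ∧ (∀ i ∈ I, t * i ∈ Ideal.span {a, b}) ∧
      k * i = a * s + b * t := by
  obtain ⟨x, y, h⟩ := hP
  obtain ⟨s, t, hst⟩ := Ideal.mem_span_pair.1 (hk i hi)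
  have key : ∀ j ∈ I, s * j ∈ Ideal.span {a, b} ∧ t * j ∈ Ideal.span {a, b} := by
    intro j hj
    obtain ⟨p, hp, p', hp', e⟩ := mem_span_mul.1 (h2 i hi j hj)
    obtain ⟨w, hw1, hw2⟩ := h.cm hq (s := s * j - k * p) (t := t * j - k * p') (by
      linear_combination j * hst + k * e)
    constructor
    · have : s * j = k * p + w * b := by linear_combination hw1
      rw [this]
      exact add_mem (hk p hp) (Ideal.mul_mem_left _ _ (Ideal.subset_span (Or.inr rfl)))
    · have : t * j = k * p' + (-w) * a := by linear_combination hw2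
      rw [this]
      exact add_mem (hk p' hp') (Ideal.mul_mem_left _ _ (Ideal.subset_span (Or.inl rfl)))
  exact ⟨s, t, fun j hj => (key j hj).1, fun j hj => (key j hj).2, by linear_combination -hst⟩

lemma Kc_ord_aux {x y : R} (h : Par x y) {r : ℕ} {a b : R} (ha : Gen x y r a)
    (hb : b ∈ maximalIdeal R ^ r) {q : ℕ} (hq : maximalIdeal R ^ q ≤ Ideal.span {a, b}) {k : R}
    (hk : k ∈ Kc F a b) {e : ℕ} (hke : Gen x y e k) (her : e + 1 < r) : False := by
  have hr : 1 ≤ r := by omega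
  have ham := ha.mem h hr
  obtain ⟨ρ, rfl⟩ : ∃ ρ, r = ρ + 1 := ⟨r - 1, by omega⟩
  have ha0 := ha
  obtain ⟨c, g₀, hc, hg₀, ea⟩ := ha
  obtain ⟨g₁, hg₁, c₁, eb⟩ := (mem_pow_succ h.spn ρ b).1 hb
  obtain ⟨c', hc'⟩ := hc.exists_left_inv
  rw [Nat.add_sub_cancel] at hg₀
  obtain ⟨b₁, hb1⟩ : ∃ b₁, b₁ = g₁ - c₁ * c' * g₀ := ⟨_, rfl⟩
  have hb1m : b₁ ∈ maximalIdeal R ^ ρ := hb1 ▸ sub_mem hg₁ (Ideal.mul_mem_left _ _ hg₀)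
  have eb1 : b = c₁ * c' * a + x * b₁ := by
    rw [hb1, eb, ea]; linear_combination (- c₁ * y ^ (ρ + 1)) * hc'
  have hyb : y * b₁ ∈ Iv F a b := by
    intro V hV
    rcases v_alt h hV with hS | ⟨γ, hγ, h1, h2⟩
    · have hle : V.valuation (algebraMap R F (y * b₁)) ≤ V.valuation (algebraMap R F (x * b₁)) := by
        have := hS.le_one ⟨_, T_mem x y⟩
        change V.valuation (algebraMap R F y / algebraMap R F x) ≤ 1 at this
        rw [map_div₀, div_le_one₀ (zero_lt_iff.2 ((Valuation.ne_zero_iff _).2 (h.x_ne (F := F))))] at this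
        rw [map_mul, map_mul, map_mul, map_mul]
        exact mul_le_mul' this le_rfl
      have : x * b₁ ∈ Iv F a b := by
        have : x * b₁ = b - c₁ * c' * a := by rw [eb1]; ring
        rw [this]
        exact sub_mem (right_mem_Iv _ _) (Ideal.mul_mem_left _ _ (left_mem_Iv _ _))
      obtain ⟨t, ht, h3⟩ := this V hV
      exact ⟨t, ht, hle.trans h3⟩
    · refine ⟨_, Or.inl rfl, ?_⟩
      rw [h2 _ hr a ha0]
      refine h1 _ _ ?_
      rw [pow_succ']
      exact Ideal.mul_mem_mul h.y_mem hb1m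
  obtain ⟨s, t, hst⟩ := Ideal.mem_span_pair.1 (hk _ hyb)
  have hq' : maximalIdeal R ^ q ≤ Ideal.span {a, b₁} := by
    refine hq.trans (Ideal.span_le.2 ?_)
    rintro _ (rfl | rfl)
    · exact Ideal.subset_span (Or.inl rfl)
    · refine (congrArg (· ∈ Ideal.span {a, b₁}) eb1).mpr ?_
      exact add_mem (Ideal.mul_mem_left _ _ (Ideal.subset_span (Or.inl rfl)))
        (Ideal.mul_mem_left _ _ (Ideal.subset_span (Or.inr rfl)))
  obtain ⟨u, hu⟩ := h.dvd_of_cm hq' (a := a) (b := b₁) (t := k * y - x * t) ⟨s + t * c₁ * c', by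
    linear_combination -hst + t * eb1⟩
  obtain ⟨d, k₀, hd, -, ek⟩ := hke
  obtain ⟨δ, rfl⟩ : ∃ δ, ρ = e + 1 + δ := ⟨ρ - (e + 1), by omega⟩
  have hdv : x ∣ y ^ (e + 1) * (d - u * c * y ^ (δ + 1)) := by
    refine ⟨t + g₀ * u - k₀ * y, ?_⟩
    rw [ek, ea] at hu
    linear_combination hu
  have hun : IsUnit (d - u * c * y ^ (δ + 1)) := by
    by_contra hcon
    have h3 : d - u * c * y ^ (δ + 1) ∈ maximalIdeal R := hcon
    have h4 : u * c * y ^ (δ + 1) ∈ maximalIdeal R :=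
      Ideal.mul_mem_left _ _ (Ideal.pow_mem_of_mem _ h.y_mem _ (by omega))
    have := add_mem h3 h4
    rw [sub_add_cancel] at this
    exact this hd
  rcases h.prm.dvd_or_dvd hdv with h5 | h5
  · exact h.ndvd_pow _ h5
  · exact h.prm.not_unit (isUnit_of_dvd_unit h5 hun)

lemma Kc_ord (hP : ∃ x y : R, Par x y) {r : ℕ} {a b : R} (ha : a ∈ maximalIdeal R ^ r)
    (ha' : a ∉ maximalIdeal R ^ (r + 1))
    (hb : b ∈ maximalIdeal R ^ r) {q : ℕ} (hq : maximalIdeal R ^ q ≤ Ideal.span {a, b}) {k : R}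
    (hk : k ∈ Kc F a b) : k ∈ maximalIdeal R ^ (r - 1) := by
  by_contra hcon
  have hk0 : k ≠ 0 := by
    rintro rfl
    exact hcon (zero_mem _)
  obtain ⟨e, he, he'⟩ := exists_ord hk0
  have : e + 1 < r := by
    by_contra hlt
    exact hcon (Ideal.pow_le_pow_right (by omega) he)
  obtain ⟨x, y, h, h1, h2⟩ := exists_gen hP ha ha' he he'
  exact Kc_ord_aux (F := F) h h1 hb hq hk h2 this

end P3d

section P3e
variable (F : Type u) [Field F]

/-- The set of products `k a`, `k b` with `k ∈ K`. -/
def TB {R : Type u} [CommRing R] [Algebra R F] (a b : R) : Set F :=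
  {t | ∃ k ∈ Kc F a b, t = algebraMap R F k * algebraMap R F a ∨ t = algebraMap R F k * algebraMap R F b}

/-- Part (B) for all regular local rings of colength less than `n`. -/
def HB (n : ℕ) : Prop := ∀ (R : Type u) [CommRing R] [IsDomain R] [IsNoetherianRing R] [IsLocalRing R]
  [Algebra R F] [FaithfulSMul R F] [Infinite (ResidueField R)], (∃ x y : R, Par x y) →
  ∀ (a b : R), (∃ q, maximalIdeal R ^ q ≤ Ideal.span {a, b}) →
  Module.length R (R ⧸ Ideal.span {a, b}) < n →
  ∀ z : R, algebraMap R F z ∈ vcl R (TB F a b) → z ∈ Ideal.span {a, b}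

variable {F} {R : Type u} [CommRing R] [IsDomain R] [IsNoetherianRing R] [IsLocalRing R]
  [Algebra R F] [FaithfulSMul R F] [Infinite (ResidueField R)]

lemma TB_comm (a b : R) : TB F a b = TB F b a := by
  ext t
  simp only [TB, Set.mem_setOf_eq]
  rw [Kc_comm]
  constructor <;> rintro ⟨k, hk, h | h⟩ <;> exact ⟨k, hk, by tauto⟩

lemma stepB {n : ℕ} (IH : HB F n) {x y : R} (h : Par x y) {r : ℕ} (hr : 1 ≤ r) {a b : R} (ha : Gen x y r a)
    (har : a ∉ maximalIdeal R ^ (r + 1))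
    (hb : b ∈ maximalIdeal R ^ r) {q : ℕ} (hq : maximalIdeal R ^ q ≤ Ideal.span {a, b})
    (hl : Module.length R (R ⧸ Ideal.span {a, b}) < (n + 1 : ℕ)) (z : R)
    (hz : algebraMap R F z ∈ vcl R (TB F a b)) :
    z ∈ Ideal.span {a, b} := by
  have hx0 := h.x_ne (F := F)
  have ham := ha.mem h hr
  have hPP : ∃ x y : R, Par x y := ⟨x, y, h⟩
  have hKo : ∀ k ∈ Kc F a b, k ∈ maximalIdeal R ^ (r - 1) := fun k hk => Kc_ord hPP ham har hb hq hk
  have hzm : z ∈ maximalIdeal R ^ (r - 1 + r) := by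
    refine ord_vcl h ?_ hz
    rintro _ ⟨k, hk, (rfl | rfl)⟩
    · exact ⟨k * a, by rw [pow_add]; exact Ideal.mul_mem_mul (hKo k hk) ham, by rw [map_mul]⟩
    · exact ⟨k * b, by rw [pow_add]; exact Ideal.mul_mem_mul (hKo k hk) hb, by rw [map_mul]⟩
  obtain ⟨a', ha'⟩ : ∃ a' : chart F x y, (a' : F) = algebraMap R F a / algebraMap R F x ^ r :=
    ⟨⟨_, div_mem h r ham⟩, rfl⟩
  obtain ⟨b', hb'⟩ : ∃ b' : chart F x y, (b' : F) = algebraMap R F b / algebraMap R F x ^ r :=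
    ⟨⟨_, div_mem h r hb⟩, rfl⟩
  obtain ⟨z', hz'⟩ : ∃ z' : chart F x y, (z' : F) = algebraMap R F z / algebraMap R F x ^ (r - 1 + r) :=
    ⟨⟨_, div_mem h _ hzm⟩, rfl⟩
  have ha2 : (a' : F) * algebraMap R F x ^ r = algebraMap R F a := by rw [ha', div_mul_cancel₀ _ (pow_ne_zero _ hx0)]
  have hb2 : (b' : F) * algebraMap R F x ^ r = algebraMap R F b := by rw [hb', div_mul_cancel₀ _ (pow_ne_zero _ hx0)]
  have hz2 : (z' : F) * algebraMap R F x ^ (r - 1 + r) = algebraMap R F z := by rw [hz', div_mul_cancel₀ _ (pow_ne_zero _ hx0)]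
  have hxr : algebraMap R F x ^ r = algebraMap R F x * algebraMap R F x ^ (r - 1) := by
      rw [← pow_succ', Nat.sub_add_cancel hr]
  -- the transform of `K`
  have hKtr : ∀ k ∈ Kc F a b, ∃ k' : chart F x y, (k' : F) = algebraMap R F k / algebraMap R F x ^ (r - 1) ∧
      ∀ s ∈ Iv F a' b', k' * s ∈ Ideal.span {a', b'} := by
    intro k hk
    refine ⟨⟨_, div_mem h _ (hKo k hk)⟩, rfl, ?_⟩
    intro s hs
    obtain ⟨w, hw, f, hf, ef⟩ := D1 h hr ha s.2
    have hs2 : s + ⟨w, hw⟩ * a' ∈ Iv F a' b' := add_mem hs (Ideal.mul_mem_left _ _ (left_mem_Iv _ _))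
    have hxf : x * f ∈ maximalIdeal R ^ r := by
      have := Ideal.mul_mem_mul h.x_mem hf
      rwa [← pow_succ', Nat.sub_add_cancel hr] at this
    have et : (s + w * a' : F) * algebraMap R F x ^ r = algebraMap R F (x * f) := by
      rw [map_mul, ← ef, ← ha', hxr]; ring
    have hI := lift_Iv h hr ha ha2 hb2 hs2 hxf et
    obtain ⟨k₁, k₂, hk1, hk2, ek⟩ := colon_mul hPP hq (fun i hi j hj => Iv_mul_Iv hPP hq hi hj) hk hI
    have hd1 := div_mem (F := F) h _ (hKo k₁ hk1)
    have hd2 := div_mem (F := F) h _ (hKo k₂ hk2)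
    rw [Ideal.mem_span_pair]
    refine ⟨⟨_, hd1⟩ - ⟨_, div_mem h _ (hKo k hk)⟩ * ⟨w, hw⟩, ⟨_, hd2⟩, ?_⟩
    apply Subtype.ext
    simp only [Subalgebra.coe_mul, Subalgebra.coe_add, Subalgebra.coe_sub]
    have e4 := congrArg (algebraMap R F) ek
    rw [map_mul, ← et, map_add, map_mul, map_mul, ← ha2, ← hb2] at e4
    have e5 : algebraMap R F k * (s + w * a' : F) = a' * algebraMap R F k₁ + b' * algebraMap R F k₂ := by
      apply mul_right_cancel₀ (pow_ne_zero r hx0)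
      linear_combination e4
    field_simp
    linear_combination -e5
  have hzS : (z' : F) ∈ vcl (chart F x y) {t | ∃ k ∈ Kc F a b,
      t = algebraMap R F k / algebraMap R F x ^ (r - 1) * a' ∨
      t = algebraMap R F k / algebraMap R F x ^ (r - 1) * b'} := by
    rw [hz']
    refine chart_vcl h ?_ hz
    rintro _ ⟨k, hk, (rfl | rfl)⟩
    · exact ⟨k, hk, Or.inl (by rw [ha', pow_add, mul_div_mul_comm])⟩
    · exact ⟨k, hk, Or.inr (by rw [hb', pow_add, mul_div_mul_comm])⟩
  let L : Ideal (chart F x y) := Submodule.comap (LinearMap.mulRight (chart F x y) z')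
    (Ideal.span {a', b'})
  have hLmem : ∀ e, e ∈ L ↔ e * z' ∈ Ideal.span {a', b'} := fun e => Iff.rfl
  have hLtop : L = ⊤ := by
    by_contra hL
    obtain ⟨N, hN, hLN⟩ := Ideal.exists_le_maximal L hL
    have haN : a' ∈ N := hLN ((hLmem _).2 (Ideal.mul_mem_right _ _ (Ideal.subset_span (Or.inl rfl))))
    have hbN : b' ∈ N := hLN ((hLmem _).2 (Ideal.mul_mem_right _ _ (Ideal.subset_span (Or.inr rfl))))
    obtain ⟨B, _, _, _, _, _, _, _, a₁, b₁, hP, ha1, hb1, hq1, hlen, hSB, hfr, hun, e, heN, hpatch⟩ :=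
      blow h hr ha hb hq a' b' ha2 hb2 N haN hbN
    obtain ⟨z₁, hz1⟩ := hSB z'
    have hlen' : Module.length B (B ⧸ Ideal.span {a₁, b₁}) < n := by
      refine lt_of_lt_of_le hlen ?_
      rw [Nat.cast_add, Nat.cast_one] at hl
      exact Order.le_of_lt_add_one hl
    have hz1v : algebraMap B F z₁ ∈ vcl B (TB F a₁ b₁) := by
      rw [hz1]
      intro V hV
      obtain ⟨t, ht, hle⟩ := vcl_chart_le_loc hSB hzS V hV
      refine ⟨t, ?_, hle⟩
      obtain ⟨k, hk, ht⟩ := ht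
      obtain ⟨k', hk', hkI⟩ := hKtr k hk
      obtain ⟨k₁, hk1⟩ := hSB k'
      refine ⟨k₁, ?_, ?_⟩
      · intro u hu
        obtain ⟨u₀, e₁, he1, hue⟩ := hfr u
        have hIv : e * u₀ ∈ Iv F a' b' := by
          refine hpatch _ ?_
          obtain ⟨f₁', hf1⟩ := hSB e₁
          have : u * f₁' ∈ Iv F a₁ b₁ := Ideal.mul_mem_right _ _ hu
          rw [mem_Iv, map_mul, hf1, hue, ha1, hb1] at this
          exact this
        obtain ⟨p₁, p₂, hp⟩ := Ideal.mem_span_pair.1 (hkI _ hIv)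
        obtain ⟨q₁, hq1⟩ := hSB p₁
        obtain ⟨q₂, hq2⟩ := hSB p₂
        obtain ⟨ε, hε⟩ := hun e heN
        obtain ⟨ε₁, hε1⟩ := hun e₁ he1
        rw [Ideal.mem_span_pair]
        refine ⟨ε * ε₁ * q₁, ε * ε₁ * q₂, ?_⟩
        apply inj_of (F := F)
        have hp' := congrArg Subtype.val hp
        simp only [Subalgebra.coe_mul, Subalgebra.coe_add] at hp'
        simp only [map_add, map_mul]
        rw [hq1, hq2, ha1, hb1, hk1]
        rw [← hue] at hp'
        linear_combination (algebraMap B F ε * algebraMap B F ε₁) * hp' +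
          (k' * algebraMap B F u * algebraMap B F ε₁ * e₁ : F) * hε + (k' * algebraMap B F u : F) * hε1
      · rw [hk1, ha1, hb1, hk']
        exact ht
    obtain ⟨s, t, est⟩ := Ideal.mem_span_pair.1 (IH B hP a₁ b₁ hq1 hlen' z₁ hz1v)
    obtain ⟨s₀, e₁, he1, hse⟩ := hfr s
    obtain ⟨t₀, e₂, he2, hte⟩ := hfr t
    have hmem : e₁ * e₂ ∈ L := by
      rw [hLmem, Ideal.mem_span_pair]
      refine ⟨e₂ * s₀, e₁ * t₀, ?_⟩
      apply Subtype.ext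
      have e3 := congrArg (algebraMap B F) est
      rw [hz1, map_add, map_mul, map_mul, ha1, hb1] at e3
      simp only [Subalgebra.coe_mul, Subalgebra.coe_add]
      rw [← e3, ← hse, ← hte]
      ring
    rcases hN.isPrime.mem_or_mem (hLN hmem) with h5 | h5
    · exact he1 h5
    · exact he2 h5
  have h1 : (1 : chart F x y) ∈ L := hLtop ▸ trivial
  rw [hLmem, one_mul, Ideal.mem_span_pair] at h1
  obtain ⟨s, t, est⟩ := h1
  obtain ⟨w, hw, f, hf, ef⟩ := D1 h hr ha t.2
  have est2 : (z' : F) = a' * (s - w * b') + b' * (t + w * a') := by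
    have := congrArg Subtype.val est
    simp only [Subalgebra.coe_mul, Subalgebra.coe_add] at this
    rw [← this]; ring
  rw [← ha'] at ef
  obtain ⟨f₂, hf2, es⟩ := D2 h ha (s := s - w * b') (sub_mem s.2 (mul_mem hw b'.2)) (d := r - 1) (g := z - b * f) (by
    rw [← ha', map_sub, map_mul, ← ef, ← hb2, ← hz2, est2]
    ring)
  rw [Ideal.mem_span_pair]
  refine ⟨f₂, f, ?_⟩
  apply inj_of (F := F)
  rw [map_add, map_mul, map_mul, ← es, ← ef, ← ha2, ← hb2, ← hz2, est2]
  ring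

theorem partB' (n : ℕ) : HB F n := by
  induction n with
  | zero =>
    intro R _ _ _ _ _ _ _ hP a b hq hl
    simp at hl
  | succ n IH =>
    intro R _ _ _ _ _ _ _ hP a b hq hl z hz
    obtain ⟨q, hq⟩ := hq
    by_cases ht : Ideal.span {a, b} = ⊤
    · rw [ht]; trivial
    · obtain ⟨r, hr, har, hbr, hor⟩ := exists_setup hP hq ht
      rcases hor with ha | hb
      · obtain ⟨x, y, h, hga, -⟩ := exists_gen hP har ha har ha
        exact stepB IH h hr hga ha hbr hq hl z hz
      · obtain ⟨x, y, h, hgb, -⟩ := exists_gen hP hbr hb hbr hb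
        rw [TB_comm] at hz
        rw [Set.pair_comm] at hq hl
        rw [Set.pair_comm]
        exact stepB IH h hr hgb hb har hq hl z hz

theorem partB (hP : ∃ x y : R, Par x y) {a b : R} {q : ℕ} (hq : maximalIdeal R ^ q ≤ Ideal.span {a, b})
    {z : R} (hz : algebraMap R F z ∈ vcl R (TB F a b)) :
    z ∈ Ideal.span {a, b} := by
  have hart := artinian_quot _ hq
  have hfin : Module.length R (R ⧸ Ideal.span {a, b}) ≠ ⊤ := Module.length_ne_top
  obtain ⟨m, hm⟩ := ENat.ne_top_iff_exists.1 hfin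
  refine partB' (m + 1) R hP a b ⟨q, hq⟩ ?_ z hz
  rw [← hm]
  exact_mod_cast Nat.lt_succ_self m

end P3e

section P4
variable {R : Type u} [CommRing R]

/-- The determinant of `u, v, z₁, …, z_k`. -/
def DD {k : ℕ} (z : Fin k → Fin (k + 2) → R) (u v : Fin (k + 2) → R) : R :=
  Matrix.det (Matrix.of (Matrix.vecCons u (Matrix.vecCons v z)))

lemma lin_eq {n : ℕ} (π : (Fin n → R) →ₗ[R] R) (w : Fin n → R) :
    π w = ∑ j, w j * π (Pi.single j 1) := by
  conv_lhs => rw [LinearMap.pi_apply_eq_sum_univ π w]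
  refine Finset.sum_congr rfl fun j _ => ?_
  rw [smul_eq_mul]
  congr 2
  ext i
  simp [Pi.single_apply, eq_comm]

lemma three_term [IsDomain R] {k : ℕ} (π : (Fin (k + 2) → R) →ₗ[R] R) (z : Fin k → Fin (k + 2) → R)
    (hz : ∀ i, π (z i) = 0) (u v w : Fin (k + 2) → R) :
    π u * DD z v w - π v * DD z u w + π w * DD z u v = 0 := by
  let ρ : Fin (k + 3) → Fin (k + 2) → R := Matrix.vecCons u (Matrix.vecCons v (Matrix.vecCons w z))
  let M : Matrix (Fin (k + 3)) (Fin (k + 3)) R := Matrix.of fun i => Matrix.vecCons (π (ρ i)) (ρ i)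
  have hdet : M.det = 0 := by
    rw [← Matrix.exists_mulVec_eq_zero_iff]
    refine ⟨Matrix.vecCons (-1) (fun j => π (Pi.single j 1)), ?_, ?_⟩
    · intro h
      have := congrFun h 0
      simp at this
    · ext i
      simp only [M, Matrix.mulVec, dotProduct, Matrix.of_apply]
      rw [Fin.sum_univ_succ]
      simp only [Matrix.cons_val_zero, Matrix.cons_val_succ, Pi.zero_apply]
      rw [lin_eq π (ρ i)]
      ring
  rw [Matrix.det_succ_column_zero, Fin.sum_univ_succ, Fin.sum_univ_succ, Fin.sum_univ_succ] at hdet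
  have h0 : M.submatrix (Fin.succAbove 0) Fin.succ = Matrix.of (Matrix.vecCons v (Matrix.vecCons w z)) := by
    ext i j
    simp [M, ρ]
  have h1 : M.submatrix (Fin.succAbove (Fin.succ 0)) Fin.succ = Matrix.of (Matrix.vecCons u (Matrix.vecCons w z)) := by
    ext i j
    refine Fin.cases ?_ (fun i => ?_) i
    · simp [M, ρ]
    · simp [M, ρ]
  have h2 : M.submatrix (Fin.succAbove (Fin.succ (Fin.succ 0))) Fin.succ = Matrix.of (Matrix.vecCons u (Matrix.vecCons v z)) := by
    ext i j
    refine Fin.cases ?_ (fun i => ?_) i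
    · rw [Matrix.submatrix_apply, Fin.succ_succAbove_zero]; rfl
    · rw [Matrix.submatrix_apply, Fin.succ_succAbove_succ]
      refine Fin.cases ?_ (fun i => ?_) i
      · rw [Fin.succ_succAbove_zero]; rfl
      · rw [Fin.succ_succAbove_succ]; rfl
  rw [h0, h1, h2] at hdet
  have hs : ∀ i : Fin k, M i.succ.succ.succ 0 = 0 := by
    intro i
    simp [M, ρ, hz]
  simp only [hs, mul_zero, zero_mul, Finset.sum_const_zero, add_zero] at hdet
  have m0 : M 0 0 = π u := rfl
  have m1 : M (Fin.succ 0) 0 = π v := rfl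
  have m2 : M (Fin.succ (Fin.succ 0)) 0 = π w := rfl
  rw [m0, m1, m2, Fin.val_succ, Fin.val_succ, Fin.val_succ] at hdet
  simp only [Fin.val_zero] at hdet
  simp only [DD]
  linear_combination hdet

/-- All determinants lie in the colon ideal. -/
lemma DD_mem [IsDomain R] [IsNoetherianRing R] [IsLocalRing R] [Infinite (ResidueField R)] (hP : ∃ x y : R, Par x y) {k : ℕ}
    (π : (Fin (k + 2) → R) →ₗ[R] R) (z : Fin k → Fin (k + 2) → R)
    (hz : ∀ i, π (z i) = 0) {I : Ideal R} (hI : LinearMap.range π = I) {a b : R} (ha : a ∈ I) (hb : b ∈ I)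
    {q : ℕ} (hq : maximalIdeal R ^ q ≤ Ideal.span {a, b})
    (h2 : ∀ i ∈ I, ∀ j ∈ I, i * j ∈ Ideal.span {a, b} * I) (w w' : Fin (k + 2) → R) :
    ∀ i ∈ I, DD z w w' * i ∈ Ideal.span {a, b} := by
  have hcm := hP
  obtain ⟨x, y, h⟩ := hcm
  have ha' := ha
  have hb' := hb
  rw [← hI] at ha' hb'
  obtain ⟨u, rfl⟩ := ha'
  obtain ⟨v, rfl⟩ := hb'
  have h3 := three_term π z hz
  have hmem : ∀ w, π w ∈ I := fun w => hI ▸ ⟨w, rfl⟩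
  have hJ : ∀ s, ∀ i : R, s ∈ Ideal.span {π u, π v} → s * i ∈ Ideal.span {π u, π v} :=
    fun s i hs => Ideal.mul_mem_right _ _ hs
  have hl : ∀ t, t * π u ∈ Ideal.span {π u, π v} := fun t => Ideal.mul_mem_left _ _ (Ideal.subset_span (Or.inl rfl))
  have hr : ∀ t, t * π v ∈ Ideal.span {π u, π v} := fun t => Ideal.mul_mem_left _ _ (Ideal.subset_span (Or.inr rfl))
  have c0 : ∀ i ∈ I, DD z u v * i ∈ Ideal.span {π u, π v} := by
    intro i hi
    rw [← hI] at hi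
    obtain ⟨w, rfl⟩ := hi
    have : DD z u v * π w = DD z u w * π v + (- DD z v w) * π u := by linear_combination h3 u v w
    rw [this]
    exact add_mem (hr _) (hl _)
  have c1 : ∀ w, (∀ i ∈ I, DD z v w * i ∈ Ideal.span {π u, π v}) ∧
      (∀ i ∈ I, DD z u w * i ∈ Ideal.span {π u, π v}) := by
    intro w
    obtain ⟨s, t, hs, ht, e⟩ := colon_mul hP hq h2 c0 (hmem w)
    obtain ⟨ω, hw1, hw2⟩ := h.cm hq (s := s + DD z v w) (t := t - DD z u w) (by
      linear_combination h3 u v w - e)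
    constructor
    · intro i hi
      have : DD z v w * i = (ω * i) * π v - s * i := by linear_combination i * hw1
      rw [this]
      exact sub_mem (hr _) (hs i hi)
    · intro i hi
      have : DD z u w * i = t * i + (ω * i) * π u := by linear_combination -i * hw2
      rw [this]
      exact add_mem (ht i hi) (hl _)
  obtain ⟨s, t, hs, ht, e⟩ := colon_mul hP hq h2 (c1 w').2 (hmem w)
  obtain ⟨s', t', hs', ht', e'⟩ := colon_mul hP hq h2 (c1 w).2 (hmem w')
  obtain ⟨ω, hw1, hw2⟩ := h.cm hq (s := s - s' - DD z w w') (t := t - t') (by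
      linear_combination -h3 u w w' - e + e')
  intro i hi
  have : DD z w w' * i = s * i - s' * i - (ω * i) * π v := by linear_combination -i * hw1
  rw [this]
  exact sub_mem (sub_mem (hs i hi) (hs' i hi)) (hr _)

end P4

section P4b
variable {R : Type u} [CommRing R] [IsDomain R] [IsNoetherianRing R] [IsLocalRing R]

lemma quot_pid {x y : R} (h : Par x y) : IsDomain (R ⧸ Ideal.span {x}) ∧ IsPrincipalIdealRing (R ⧸ Ideal.span {x}) := by
  haveI : (Ideal.span {x}).IsPrime := (Ideal.span_singleton_prime h.prm.ne_zero).2 h.prm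
  haveI hd : IsDomain (R ⧸ Ideal.span {x}) := Ideal.Quotient.isDomain _
  refine ⟨hd, ?_⟩
  haveI : IsLocalRing (R ⧸ Ideal.span {x}) := IsLocalRing.of_surjective' (Ideal.Quotient.mk _) Ideal.Quotient.mk_surjective
  have := (tfae_of_isNoetherianRing_of_isLocalRing_of_isDomain (R ⧸ Ideal.span {x})).out 4 0
  refine this.1 ⟨⟨Ideal.Quotient.mk _ y, ?_⟩⟩
  apply le_antisymm
  · intro z hz
    obtain ⟨z, rfl⟩ := Ideal.Quotient.mk_surjective z
    have hz' : z ∈ maximalIdeal R := by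
      intro hu
      exact hz (hu.map _)
    obtain ⟨p, q, rfl⟩ := (mem_m_iff h.spn z).1 hz'
    rw [Submodule.mem_span_singleton]
    refine ⟨Ideal.Quotient.mk _ q, ?_⟩
    rw [smul_eq_mul, ← map_mul, Ideal.Quotient.mk_eq_mk_iff_sub_mem]
    exact Ideal.mem_span_singleton.2 ⟨-p, by ring⟩
  · rw [Submodule.span_le, Set.singleton_subset_iff]
    change ¬ IsUnit _
    intro hu
    obtain ⟨v, hv⟩ := hu.exists_left_inv
    obtain ⟨v, rfl⟩ := Ideal.Quotient.mk_surjective v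
    rw [← map_mul, ← map_one (Ideal.Quotient.mk _), Ideal.Quotient.mk_eq_mk_iff_sub_mem] at hv
    obtain ⟨w, hw⟩ := Ideal.mem_span_singleton.1 hv
    have : (1 : R) ∈ maximalIdeal R := by
      have e : (1 : R) = v * y - x * w := by linear_combination -hw
      rw [e]
      exact sub_mem (Ideal.mul_mem_left _ _ h.y_mem) (Ideal.mul_mem_right _ _ h.x_mem)
    exact this isUnit_one

open Pointwise in
lemma ker_free (hP : ∃ x y : R, Par x y) {n : ℕ} (π : (Fin n → R) →ₗ[R] R) : Module.Free R (LinearMap.ker π) := by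
  obtain ⟨x, y, h⟩ := hP
  obtain ⟨hd, hpid⟩ := quot_pid h
  haveI : Module.FinitePresentation R (LinearMap.ker π) := Module.finitePresentation_of_finite R _
  have hx0 := h.prm.ne_zero
  rw [← Module.free_quotSMulTop_iff_free R (LinearMap.ker π) (x := x)
    (by rw [IsLocalRing.jacobson_eq_maximalIdeal _ bot_ne_top]; exact h.x_mem)
    (by
      intro z w hzw
      simp only at hzw
      exact smul_right_injective _ hx0 hzw)]
  haveI : Module.Finite (R ⧸ Ideal.span {x}) (QuotSMulTop x (LinearMap.ker π)) := Module.Finite.of_restrictScalars_finite R _ _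
  haveI : Module.IsTorsionFree (R ⧸ Ideal.span {x}) (QuotSMulTop x (LinearMap.ker π)) := by
    rw [Module.isTorsionFree_iff_smul_eq_zero]
    intro r m hrm
    obtain ⟨r, rfl⟩ := Ideal.Quotient.mk_surjective r
    obtain ⟨z, rfl⟩ := Submodule.mkQ_surjective _ m
    have hrm' : Submodule.mkQ (x • (⊤ : Submodule R (LinearMap.ker π))) (r • z) = 0 := hrm
    rw [Submodule.mkQ_apply, Submodule.Quotient.mk_eq_zero, Submodule.mem_smul_pointwise_iff_exists] at hrm'
    obtain ⟨z', -, hz'⟩ := hrm'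
    by_cases hr : x ∣ r
    · left
      rw [Ideal.Quotient.eq_zero_iff_mem]
      exact Ideal.mem_span_singleton.2 hr
    · right
      rw [Submodule.mkQ_apply, Submodule.Quotient.mk_eq_zero, Submodule.mem_smul_pointwise_iff_exists]
      have hdv : ∀ i, x ∣ (z : Fin n → R) i := by
        intro i
        have e : x * (z' : Fin n → R) i = r * (z : Fin n → R) i := congrFun (congrArg Subtype.val hz') i
        exact (h.prm.dvd_or_dvd ⟨_, e.symm⟩).resolve_left hr
      choose w hw using hdv
      have hzw : (z : Fin n → R) = x • w := funext hw
      have hπ : π w = 0 := by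
        have : π (z : Fin n → R) = 0 := z.2
        rw [hzw, map_smul, smul_eq_mul] at this
        exact (mul_eq_zero.1 this).resolve_left hx0
      exact ⟨⟨w, hπ⟩, trivial, Subtype.ext hzw.symm⟩
  exact Module.free_of_finite_type_torsion_free'

lemma ker_basis (hP : ∃ x y : R, Par x y) {n : ℕ} (π : (Fin (n + 1) → R) →ₗ[R] R) (hπ : LinearMap.range π ≠ ⊥) :
    Nonempty (Module.Basis (Fin n) R (LinearMap.ker π)) := by
  haveI := ker_free hP π
  have h1 := LinearMap.rank_range_add_rank_ker π
  have h2 : Module.rank R (LinearMap.range π) = 1 := by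
    apply le_antisymm
    · refine (Submodule.rank_le _).trans ?_
      rw [Module.rank_self]
    · rw [Cardinal.one_le_iff_pos]
      haveI : Nontrivial (LinearMap.range π) := Submodule.nontrivial_iff_ne_bot.2 hπ
      exact rank_pos
  rw [h2, ← Module.finrank_eq_rank R (LinearMap.ker π), rank_fin_fun] at h1
  have h3 : Module.finrank R (LinearMap.ker π) = n := by
    have : 1 + Module.finrank R (LinearMap.ker π) = n + 1 := by exact_mod_cast h1
    omega
  exact ⟨Module.finBasisOfFinrankEq R _ h3⟩

end P4b

section P4c
variable {R : Type u} [CommRing R]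

lemma exists_delta {n : ℕ} (ψ : Fin n → Fin (n + 1) → R) :
    ∃ δ : (Fin (n + 1) → R) →ₗ[R] R, ∀ w, δ w = Matrix.det (Matrix.of (Matrix.vecCons w ψ)) := by
  refine ⟨∑ j : Fin (n + 1), ((-1) ^ (j : ℕ) * (Matrix.det (Matrix.of fun i l => ψ i (j.succAbove l)))) • LinearMap.proj j, ?_⟩
  intro w
  rw [Matrix.det_succ_row_zero]
  simp only [LinearMap.sum_apply, LinearMap.smul_apply, LinearMap.proj_apply, smul_eq_mul]
  refine Finset.sum_congr rfl fun j _ => ?_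
  have : (Matrix.of (Matrix.vecCons w ψ)).submatrix Fin.succ j.succAbove = Matrix.of fun i l => ψ i (j.succAbove l) := by
    ext i l; simp
  rw [this]
  simp only [Matrix.of_apply, Matrix.cons_val_zero]
  ring

/-- linear dependence from vanishing of maximal minors, over a domain -/
lemma exists_dep {A : Type u} [CommRing A] [IsDomain A] {n : ℕ} (ψ : Fin n → Fin (n + 1) → A)
    (h : ∀ w, Matrix.det (Matrix.of (Matrix.vecCons w ψ)) = 0) :
    ∃ c : Fin n → A, (∃ i, c i ≠ 0) ∧ ∀ j, ∑ i, c i * ψ i j = 0 := by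
  let κ := FractionRing A
  let ψ' : Fin n → Fin (n + 1) → κ := fun i j => algebraMap A κ (ψ i j)
  have h1 : ¬ LinearIndependent κ ψ' := by
    intro hli
    have hne : Submodule.span κ (Set.range ψ') ≠ ⊤ := by
      intro ht
      have := finrank_span_eq_card hli
      rw [ht, finrank_top] at this
      simp at this
    obtain ⟨w, hw⟩ := SetLike.exists_not_mem_of_ne_top _ hne rfl
    have hli2 : LinearIndependent κ (Matrix.vecCons w ψ' : Fin (n + 1) → Fin (n + 1) → κ) :=
      linearIndependent_finCons.2 ⟨hli, hw⟩
    have hu := (Matrix.linearIndependent_rows_iff_isUnit (A := Matrix.of (Matrix.vecCons w ψ'))).1 hli2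
    rw [Matrix.isUnit_iff_isUnit_det] at hu
    obtain ⟨δ, hδ⟩ := exists_delta ψ'
    have : δ = 0 := by
      refine LinearMap.pi_ext' fun j => LinearMap.ext_ring ?_
      simp only [LinearMap.comp_apply, LinearMap.single_apply, LinearMap.zero_apply]
      rw [hδ]
      have h2 := congrArg (algebraMap A κ) (h (Pi.single j 1))
      rw [map_zero, RingHom.map_det] at h2
      rw [← h2]
      congr 1
      ext i l
      refine Fin.cases ?_ (fun i => ?_) i
      · simp only [Matrix.of_apply, Matrix.cons_val_zero, RingHom.mapMatrix_apply, Matrix.map_apply]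
        by_cases hlj : l = j
        · subst hlj; simp
        · simp [hlj]
      · simp [ψ']
    rw [← hδ, this] at hu
    simp at hu
  rw [← LinearIndependent.iff_fractionRing A κ, Fintype.linearIndependent_iff] at h1
  push Not at h1
  obtain ⟨g, hg, i, hi⟩ := h1
  refine ⟨g, ⟨i, hi⟩, fun j => ?_⟩
  apply IsFractionRing.injective A κ
  have := congrFun hg j
  simp only [Finset.sum_apply, Pi.smul_apply, Pi.zero_apply, ψ', Algebra.smul_def] at this
  rw [map_sum, map_zero, ← this]
  refine Finset.sum_congr rfl fun i _ => by rw [map_mul]; rfl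

/-- Hilbert Burch. -/
lemma hilbert_burch [IsDomain R] [IsNoetherianRing R] [IsLocalRing R] {x y : R} (h : Par x y) {n : ℕ} (π : (Fin (n + 1) → R) →ₗ[R] R)
    {q : ℕ} (hq : maximalIdeal R ^ q ≤ LinearMap.range π) (ψ : Module.Basis (Fin n) R (LinearMap.ker π)) :
    ∃ η : R, IsUnit η ∧ ∀ w, Matrix.det (Matrix.of (Matrix.vecCons w (fun i => (ψ i : Fin (n + 1) → R)))) = η * π w := by
  obtain ⟨δ, hδ⟩ := exists_delta (fun i => (ψ i : Fin (n + 1) → R))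
  have hδψ : ∀ i, δ (ψ i) = 0 := by
    intro i
    rw [hδ]
    exact Matrix.det_zero_of_row_eq (i := 0) (j := i.succ) (Fin.succ_ne_zero i).symm (by ext l; simp)
  have hδZ : ∀ z, π z = 0 → δ z = 0 := by
    intro z hz
    have := ψ.sum_repr ⟨z, hz⟩
    have h2 := congrArg (fun s : LinearMap.ker π => δ (s : Fin (n + 1) → R)) this
    simp only [Submodule.coe_sum, Submodule.coe_smul, map_sum, map_smul, hδψ, smul_zero, Finset.sum_const_zero] at h2
    exact h2.symm
  have hcross : ∀ w w', π w * δ w' = π w' * δ w := by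
    intro w w'
    have := hδZ (π w • w' - π w' • w) (by rw [map_sub, map_smul, map_smul, smul_eq_mul, smul_eq_mul]; ring)
    rw [map_sub, map_smul, map_smul, smul_eq_mul, smul_eq_mul] at this
    exact sub_eq_zero.1 this
  obtain ⟨u, hu⟩ := hq (Ideal.pow_mem_pow h.x_mem q)
  obtain ⟨v, hv⟩ := hq (Ideal.pow_mem_pow h.y_mem q)
  have hx0 := pow_ne_zero q h.prm.ne_zero
  obtain ⟨η, hη⟩ : x ^ q ∣ δ u := by
    refine h.prm.pow_dvd_of_dvd_mul_left q (h.ndvd_pow q) (b := δ u) ?_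
    rw [← hv, ← hcross u v, hu]
    exact dvd_mul_right _ _
  have hδη : ∀ w, δ w = η * π w := by
    intro w
    apply mul_left_cancel₀ hx0
    have := hcross u w
    rw [hu, hη] at this
    rw [this]; ring
  refine ⟨η, ?_, fun w => by rw [← hδ, hδη]⟩
  by_contra hnu
  haveI : Nontrivial (R ⧸ Ideal.span {η}) := Ideal.Quotient.nontrivial_iff.2 (by rwa [Ne, Ideal.span_singleton_eq_top])
  obtain ⟨P, hP⟩ := associatedPrimes.nonempty R (R ⧸ Ideal.span {η})
  have hPp : P.IsPrime := hP.1
  obtain ⟨t, ht⟩ := ((isAssociatedPrime_iff_exists_injective_linearMap P (R ⧸ Ideal.span {η})).1 hP).2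
  obtain ⟨τ, hτ⟩ := Ideal.Quotient.mk_surjective (t 1)
  have hτ2 : ∀ c, c ∈ P ↔ η ∣ τ * c := by
    intro c
    have e : t (Ideal.Quotient.mk P c) = Ideal.Quotient.mk (Ideal.span {η}) (τ * c) := by
      have : Ideal.Quotient.mk P c = c • (1 : R ⧸ P) := by rw [Algebra.smul_def, mul_one]; rfl
      rw [this, map_smul, ← hτ, Algebra.smul_def, map_mul, mul_comm]; rfl
    rw [← Ideal.mem_span_singleton, ← Ideal.Quotient.eq_zero_iff_mem, ← Ideal.Quotient.eq_zero_iff_mem, ← e,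
      map_eq_zero_iff _ ht]
  have hηP : η ∈ P := (hτ2 η).2 (dvd_mul_left _ _)
  obtain ⟨c, ⟨i₀, hi⟩, hc⟩ := exists_dep (A := R ⧸ P) (fun i j => Ideal.Quotient.mk P ((ψ i : Fin (n + 1) → R) j)) (by
    intro w
    choose w' hw' using fun j => Ideal.Quotient.mk_surjective (w j)
    have h2 := congrArg (Ideal.Quotient.mk P) (hδη w')
    rw [map_mul, Ideal.Quotient.eq_zero_iff_mem.2 hηP, zero_mul, hδ, RingHom.map_det] at h2
    rw [← h2]
    congr 1
    ext i l
    refine Fin.cases ?_ (fun i => ?_) i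
    · simp [hw']
    · simp)
  choose c' hc' using fun i => Ideal.Quotient.mk_surjective (c i)
  have hcP : ∀ j, η ∣ τ * ∑ i, c' i * (ψ i : Fin (n + 1) → R) j := by
    intro j
    rw [← hτ2, ← Ideal.Quotient.eq_zero_iff_mem, map_sum, ← hc j]
    exact Finset.sum_congr rfl fun i _ => by rw [map_mul, hc']
  obtain ⟨w, hw⟩ : ∃ w : LinearMap.ker π, τ • ∑ i, c' i • ψ i = η • w := by
    by_cases hη0 : η = 0
    · refine ⟨0, Subtype.ext (funext fun j => ?_)⟩
      have := hcP j
      rw [hη0, zero_dvd_iff] at this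
      simpa using this
    · choose w hw using hcP
      have e : (((τ • ∑ i, c' i • ψ i) : LinearMap.ker π) : Fin (n + 1) → R) = η • w := by
        ext j
        rw [Pi.smul_apply, smul_eq_mul, ← hw j]
        simp
      refine ⟨⟨w, ?_⟩, Subtype.ext e⟩
      have h3 : π (((τ • ∑ i, c' i • ψ i) : LinearMap.ker π) : Fin (n + 1) → R) = 0 := (τ • ∑ i, c' i • ψ i).2
      rw [e, map_smul, smul_eq_mul] at h3
      exact (mul_eq_zero.1 h3).resolve_left hη0
  have hr := congrArg (fun s => ψ.repr s i₀) hw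
  simp only [map_smul, Finsupp.smul_apply, smul_eq_mul, ψ.repr_sum_self] at hr
  apply hi
  rw [← hc' i₀, Ideal.Quotient.eq_zero_iff_mem, hτ2]
  exact ⟨_, hr⟩

end P4c

section P4d
variable {R : Type u} [CommRing R]

lemma det_cons_single {k : ℕ} (z : Fin k → Fin (k + 1) → R) :
    Matrix.det (Matrix.of (Matrix.vecCons (Pi.single 0 1) z)) =
      Matrix.det (Matrix.of fun l p => z l (Fin.succ p)) := by
  rw [Matrix.det_succ_row_zero, Fin.sum_univ_succ]
  have : ∀ j : Fin k, (Matrix.of (Matrix.vecCons (Pi.single 0 1) z) : Matrix (Fin (k+1)) (Fin (k+1)) R) 0 j.succ = 0 := by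
    intro j
    simp
  simp only [this, mul_zero, zero_mul, Finset.sum_const_zero, add_zero]
  simp
  rfl

lemma minor_eq_DD {k m : ℕ} (φ : Matrix (Fin (k + 2)) (Fin m) R) (r : Fin k → Fin (k + 2)) (c : Fin k → Fin m) :
    (φ.submatrix r c).det = 0 ∨ ∃ (ε : R) (w w' : Fin (k + 2) → R),
      (φ.submatrix r c).det = ε * DD (fun l i => φ i (c l)) w w' := by
  by_cases hr : Function.Injective r
  swap
  · left
    rw [Function.not_injective_iff] at hr
    obtain ⟨p, q, hpq, hne⟩ := hr
    refine Matrix.det_zero_of_row_eq hne ?_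
    ext l
    simp [hpq]
  right
  have hcard : (Finset.univ \ Finset.univ.image r).card = 2 := by
    rw [Finset.card_sdiff_of_subset (Finset.subset_univ _), Finset.card_image_of_injective _ hr]
    simp
  obtain ⟨i, j, hij, hs⟩ := Finset.card_eq_two.mp hcard
  have hi : ∀ p, r p ≠ i := by
    intro p hp
    have : i ∈ Finset.univ \ Finset.univ.image r := by rw [hs]; simp
    simp at this
    exact this p hp
  have hj : ∀ p, r p ≠ j := by
    intro p hp
    have : j ∈ Finset.univ \ Finset.univ.image r := by rw [hs]; simp
    simp at this
    exact this p hp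
  let f : Fin (k + 2) → Fin (k + 2) := Matrix.vecCons i (Matrix.vecCons j r)
  have hf : Function.Injective f := by
    intro p q
    refine Fin.cases ?_ (fun p => ?_) p <;> refine Fin.cases ?_ (fun q => ?_) q
    · intro _; rfl
    · refine Fin.cases ?_ (fun q => ?_) q
      · intro h; exact absurd h hij
      · intro h; exact absurd h.symm (hi q)
    · refine Fin.cases ?_ (fun p => ?_) p
      · intro h; exact absurd h.symm hij
      · intro h; exact absurd h (hi p)
    · refine Fin.cases ?_ (fun p => ?_) p <;> refine Fin.cases ?_ (fun q => ?_) q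
      · intro _; rfl
      · intro h; exact absurd h.symm (hj q)
      · intro h; exact absurd h (hj p)
      · intro h; rw [hr (show r p = r q from h)]
  let σ : Equiv.Perm (Fin (k + 2)) := Equiv.ofBijective f (Finite.injective_iff_bijective.mp hf)
  have hd := Matrix.det_permute' σ (Matrix.of (Matrix.vecCons (Pi.single i (1:R)) (Matrix.vecCons (Pi.single j 1) (fun l i => φ i (c l)))))
  refine ⟨((Equiv.Perm.sign σ : ℤ) : R), Pi.single i 1, Pi.single j 1, ?_⟩
  unfold DD
  rw [← hd]
  have e1 : (Matrix.of (Matrix.vecCons (Pi.single i (1:R)) (Matrix.vecCons (Pi.single j 1) (fun l i => φ i (c l))))).submatrix id σ =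
     Matrix.of (Matrix.vecCons (Pi.single 0 1) (Matrix.vecCons (Pi.single 1 1) (fun l p => φ (f p) (c l)))) := by
    ext p q
    have hfi : ∀ q, (Pi.single i (1:R) : Fin (k+2) → R) (f q) = (Pi.single 0 1 : Fin (k+2) → R) q := by
      intro q
      have : f 0 = i := rfl
      rw [← this]
      simp only [Pi.single_apply, hf.eq_iff]
    have hfj : ∀ q, (Pi.single j (1:R) : Fin (k+2) → R) (f q) = (Pi.single 1 1 : Fin (k+2) → R) q := by
      intro q
      have : f 1 = j := rfl
      rw [← this]
      simp only [Pi.single_apply, hf.eq_iff]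
    refine Fin.cases ?_ (fun p => ?_) p
    · exact hfi q
    · refine Fin.cases ?_ (fun p => ?_) p
      · exact hfj q
      · rfl
  rw [e1, det_cons_single]
  have e2 : (Matrix.of fun (l : Fin (k+1)) p => (Matrix.vecCons (Pi.single 1 1 : Fin (k+2) → R) (fun l p => φ (f p) (c l))) l (Fin.succ p)) =
     Matrix.of (Matrix.vecCons (Pi.single 0 1 : Fin (k+1) → R) (fun l p => φ (f p.succ) (c l))) := by
    ext p q
    refine Fin.cases ?_ (fun p => ?_) p
    · have h1 : (1 : Fin (k+2)) = Fin.succ 0 := rfl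
      change (Pi.single 1 1 : Fin (k+2) → R) q.succ = (Pi.single 0 1 : Fin (k+1) → R) q
      rw [h1]
      simp only [Pi.single_apply, Fin.succ_inj]
    · rfl
  rw [e2, det_cons_single, ← Matrix.det_transpose]
  rfl

lemma det_mem_minors {k n m : ℕ} (φ : Matrix (Fin n) (Fin m) R) (z : Fin k → Fin n → R)
    (hz : ∀ l, z l ∈ LinearMap.range (Matrix.toLin' φ)) (f : Fin k → Fin n) :
    Matrix.det (Matrix.of fun l p => z l (f p)) ∈ minorsIdeal k φ := by
  choose y hy using hz
  have e : (fun l p => z l (f p)) = fun l => ∑ c, y l c • (fun p => φ (f p) c) := by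
    ext l p
    rw [← hy]
    simp [Matrix.mulVec, dotProduct, mul_comm]
  change Matrix.detRowAlternating (fun l p => z l (f p)) ∈ _
  rw [e]
  change (Matrix.detRowAlternating (n := Fin k) (R := R)).toMultilinearMap _ ∈ _
  rw [MultilinearMap.map_sum]
  refine Ideal.sum_mem _ fun c _ => ?_
  rw [MultilinearMap.map_smul_univ]
  refine Ideal.mul_mem_left _ _ (Ideal.subset_span ⟨f, c, ?_⟩)
  rw [← Matrix.det_transpose]
  rfl

lemma DD_mem_minors {k m : ℕ} (φ : Matrix (Fin (k + 2)) (Fin m) R) (z : Fin k → Fin (k + 2) → R)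
    (hz : ∀ l, z l ∈ LinearMap.range (Matrix.toLin' φ)) (u v : Fin (k + 2) → R) :
    DD z u v ∈ minorsIdeal k φ := by
  unfold DD
  rw [Matrix.det_succ_row_zero]
  refine Ideal.sum_mem _ fun i _ => Ideal.mul_mem_left _ _ ?_
  rw [Matrix.det_succ_row_zero]
  refine Ideal.sum_mem _ fun j _ => Ideal.mul_mem_left _ _ ?_
  exact det_mem_minors φ z hz _

end P4d

section P4e
variable {R : Type u} [CommRing R]

lemma det_upd_mem {k m : ℕ} (φ : Matrix (Fin (k + 2)) (Fin m) R) (ψ : Fin (k + 1) → Fin (k + 2) → R)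
    (hz : ∀ l, ψ l ∈ LinearMap.range (Matrix.toLin' φ)) (u v : Fin (k + 2) → R) (j : Fin (k + 1)) :
    Matrix.det (Matrix.of (Function.update (Matrix.vecCons u ψ) j.succ v)) ∈ minorsIdeal k φ := by
  rw [Matrix.det_succ_row_zero]
  refine Ideal.sum_mem _ fun i _ => Ideal.mul_mem_left _ _ ?_
  rw [Matrix.det_succ_row _ j]
  refine Ideal.sum_mem _ fun i' _ => Ideal.mul_mem_left _ _ ?_
  have := det_mem_minors φ (fun l => ψ (j.succAbove l)) (fun l => hz _) (fun p => i.succAbove (i'.succAbove p))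
  convert this using 2
  ext l p
  simp only [Matrix.submatrix_apply, Matrix.of_apply]
  rw [Function.update_of_ne]
  · rfl
  · intro h
    exact Fin.succAbove_ne j l (Fin.succ_injective _ h)

lemma colon_le_aux [IsDomain R] [IsNoetherianRing R] [IsLocalRing R] (hP : ∃ x y : R, Par x y) {k m : ℕ}
    (φ : Matrix (Fin (k + 2)) (Fin m) R)
    (π : (Fin (k + 2) → R) →ₗ[R] R) (hker : LinearMap.range (Matrix.toLin' φ) = LinearMap.ker π)
    {a b : R} (ha : a ∈ LinearMap.range π) (hb : b ∈ LinearMap.range π) (ha0 : a ≠ 0)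
    {q : ℕ} (hq : maximalIdeal R ^ q ≤ Ideal.span {a, b}) {c : R}
    (hc : ∀ i ∈ LinearMap.range π, c * i ∈ Ideal.span {a, b}) : c ∈ minorsIdeal k φ := by
  have hP' := hP
  obtain ⟨x, y, h⟩ := hP
  have hbot : LinearMap.range π ≠ ⊥ := by
    intro hb
    rw [hb] at ha
    exact ha0 (by simpa using ha)
  obtain ⟨ψ⟩ := ker_basis hP' π hbot
  have hq' : maximalIdeal R ^ q ≤ LinearMap.range π := hq.trans (Ideal.span_le.mpr (by
    rintro t (rfl | rfl)
    · exact ha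
    · exact hb))
  obtain ⟨η, hη, hd⟩ := hilbert_burch h π hq' ψ
  have hz : ∀ l, (ψ l : Fin (k + 2) → R) ∈ LinearMap.range (Matrix.toLin' φ) := fun l => by
    rw [hker]
    exact (ψ l).2
  have hI : ∀ i ∈ LinearMap.range π, i ∈ minorsIdeal k φ := by
    rintro i ⟨w, rfl⟩
    have h1 := hd w
    have h2 := det_upd_mem φ (fun i => (ψ i : Fin (k + 2) → R)) hz w (ψ 0) 0
    rw [show (ψ 0 : Fin (k + 2) → R) = (Matrix.vecCons w (fun i => (ψ i : Fin (k + 2) → R))) (Fin.succ 0) from rfl,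
      Function.update_eq_self, h1] at h2
    obtain ⟨η', rfl⟩ := hη
    have := Ideal.mul_mem_left _ (↑η'⁻¹ : R) h2
    rwa [Units.inv_mul_cancel_left] at this
  have haI := hI a ha
  have hbI := hI b hb
  obtain ⟨u, rfl⟩ := ha
  obtain ⟨v, rfl⟩ := hb
  have hj : ∀ j : Fin (k + 2), ∃ s t, c * π (Pi.single j 1) = s * π u + t * π v := by
    intro j
    obtain ⟨s, t, e⟩ := Ideal.mem_span_pair.mp (hc _ ⟨Pi.single j 1, rfl⟩)
    exact ⟨s, t, e.symm⟩
  choose A B hAB using hj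
  let α : (Fin (k + 2) → R) →ₗ[R] R := ∑ j, A j • LinearMap.proj j
  let β : (Fin (k + 2) → R) →ₗ[R] R := ∑ j, B j • LinearMap.proj j
  have hαβ : ∀ w, c * π w = α w * π u + β w * π v := by
    intro w
    rw [lin_eq π w]
    simp only [α, β, LinearMap.sum_apply, LinearMap.smul_apply, LinearMap.proj_apply, smul_eq_mul, Finset.mul_sum, Finset.sum_mul]
    rw [← Finset.sum_add_distrib]
    refine Finset.sum_congr rfl fun j _ => ?_
    linear_combination w j * hAB j
  have hl : ∀ j, ∃ l, β (ψ j) = -(π u * l) := by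
    intro j
    have h0 : π (ψ j) = 0 := (ψ j).2
    obtain ⟨l, _, hl⟩ := h.cm hq (s := α (ψ j)) (t := β (ψ j)) (by
      have := hαβ (ψ j)
      rw [h0] at this
      linear_combination -this)
    exact ⟨l, hl⟩
  choose l hl using hl
  obtain ⟨e, he1, he2⟩ := h.cm hq (s := c - α u) (t := - β u) (by linear_combination hαβ u)
  obtain ⟨e', he1', he2'⟩ := h.cm hq (s := α v) (t := β v - c) (by linear_combination -hαβ v)
  let κ : LinearMap.ker π := ⟨π v • u - π u • v, by simp [mul_comm]⟩
  have hκ : ∑ j, ψ.repr κ j • (ψ j : Fin (k + 2) → R) = π v • u - π u • v := by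
    have := congrArg (LinearMap.ker π).subtype (ψ.sum_repr κ)
    rw [map_sum] at this
    simpa using this
  have hΛ : c = ∑ j, ψ.repr κ j * l j + π v * e + π u * e' := by
    have h1 := congrArg β hκ
    simp only [map_sum, map_smul, map_sub, smul_eq_mul, hl] at h1
    have h2 : ∑ j, ψ.repr κ j * -(π u * l j) = - π u * ∑ j, ψ.repr κ j * l j := by
      rw [Finset.mul_sum]
      exact Finset.sum_congr rfl fun j _ => by ring
    rw [h2] at h1
    apply mul_left_cancel₀ ha0
    linear_combination h1 - π v * he2 - π u * he2'
  rw [hΛ]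
  refine add_mem (add_mem (Ideal.sum_mem _ fun j _ => Ideal.mul_mem_right _ _ ?_) (Ideal.mul_mem_right _ _ hbI)) (Ideal.mul_mem_right _ _ haI)
  let ρ : Fin (k + 2) → Fin (k + 2) → R := Matrix.vecCons u (fun i => (ψ i : Fin (k + 2) → R))
  let T : (Fin (k + 2) → R) →ₗ[R] R := (Matrix.detRowAlternating (n := Fin (k + 2)) (R := R)).toMultilinearMap.toLinearMap ρ j.succ
  have hT : ∀ w, T w = Matrix.det (Matrix.of (Function.update ρ j.succ w)) := fun w => rfl
  have hTj : T (ψ j) = η * π u := by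
    rw [hT, ← hd u, show (ψ j : Fin (k + 2) → R) = ρ j.succ from rfl, Function.update_eq_self]
  have hTi : ∀ i ≠ j.succ, T (ρ i) = 0 := by
    intro i hi
    exact AlternatingMap.map_update_self (Matrix.detRowAlternating (n := Fin (k + 2)) (R := R)) ρ hi.symm
  have h1 := congrArg T hκ
  simp only [map_sum, map_smul, map_sub, smul_eq_mul] at h1
  rw [Finset.sum_eq_single j] at h1
  rotate_left
  · intro i _ hij
    rw [show (ψ i : Fin (k + 2) → R) = ρ i.succ from rfl, hTi _ (fun hh => hij (Fin.succ_injective _ hh)), mul_zero]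
  · simp
  rw [hTj, show T u = 0 from hTi 0 (Fin.succ_ne_zero j).symm] at h1
  have h2 : η * ψ.repr κ j = - T v := by
    apply mul_left_cancel₀ ha0
    linear_combination h1
  have h3 : η * ψ.repr κ j ∈ minorsIdeal k φ := by
    rw [h2]
    exact neg_mem (det_upd_mem φ (fun i => (ψ i : Fin (k + 2) → R)) hz u v j)
  obtain ⟨η', rfl⟩ := hη
  have := Ideal.mul_mem_left _ (↑η'⁻¹ : R) h3
  rwa [Units.inv_mul_cancel_left] at this

/-- Minors are the colon ideal. -/
theorem minors_eq [IsDomain R] [IsNoetherianRing R] [IsLocalRing R] [Infinite (ResidueField R)] (hP : ∃ x y : R, Par x y) {k m : ℕ}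
    (φ : Matrix (Fin (k + 2)) (Fin m) R)
    (π : (Fin (k + 2) → R) →ₗ[R] R) (hker : LinearMap.range (Matrix.toLin' φ) = LinearMap.ker π)
    {I : Ideal R} (hI : LinearMap.range π = I)
    {a b : R} (ha : a ∈ I) (hb : b ∈ I) 
    {q : ℕ} (hq : maximalIdeal R ^ q ≤ Ideal.span {a, b})
    (h2 : ∀ i ∈ I, ∀ j ∈ I, i * j ∈ Ideal.span {a, b} * I) (c : R) :
    c ∈ minorsIdeal k φ ↔ ∀ i ∈ I, c * i ∈ Ideal.span {a, b} := by
  constructor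
  · intro hc
    refine Submodule.span_induction (p := fun c _ => ∀ i ∈ I, c * i ∈ Ideal.span {a, b}) ?_ ?_ ?_ ?_ hc
    · rintro d ⟨r, cc, rfl⟩ i hi
      rcases minor_eq_DD φ r cc with h | ⟨ε, w, w', h⟩
      · rw [h, zero_mul]; exact zero_mem _
      · rw [h, mul_assoc]
        refine Ideal.mul_mem_left _ _ (DD_mem hP π _ ?_ hI ha hb hq h2 w w' i hi)
        intro l
        have : (fun i => φ i (cc l)) ∈ LinearMap.ker π := by
          rw [← hker]
          refine ⟨Pi.single (cc l) 1, ?_⟩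
          ext i
          simp
        exact this
    · intro i _
      rw [zero_mul]; exact zero_mem _
    · intro s t _ _ hs ht i hi
      rw [add_mul]
      exact add_mem (hs i hi) (ht i hi)
    · intro r s _ hs i hi
      rw [smul_eq_mul, mul_assoc]
      exact Ideal.mul_mem_left _ _ (hs i hi)
  · intro hc
    subst hI
    by_cases ha0 : a = 0
    · have hb0 : b ≠ 0 := by
        rintro rfl
        subst ha0
        obtain ⟨x, y, h⟩ := hP
        have := hq (Ideal.pow_mem_pow h.x_mem q)
        simp at this
        exact h.prm.ne_zero this.1
      rw [Set.pair_comm] at hq hc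
      exact colon_le_aux hP φ π hker hb ha hb0 hq hc
    · exact colon_le_aux hP φ π hker ha hb ha0 hq hc

end P4e

section P5
variable {R : Type u} [CommRing R]

lemma red_trans {H G J : Ideal R} (h1 : IsReduction H G) (h2 : IsReduction G J) : IsReduction H J := by
  obtain ⟨h1, p, hp⟩ := h1
  obtain ⟨h2, s, hs⟩ := h2
  refine ⟨h1.trans h2, s + p, ?_⟩
  have key : ∀ e, J ^ (s + e) = G ^ e * J ^ s := by
    intro e
    induction e with
    | zero => simp
    | succ e ih =>
      calc J ^ (s + (e + 1)) = J ^ (s + e) * J := by rw [← pow_succ]; ring_nf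
        _ = G ^ e * J ^ (s + 1) := by rw [ih, mul_assoc, ← pow_succ]
        _ = G ^ (e + 1) * J ^ s := by rw [hs]; ring
  rw [show s + p + 1 = s + (p + 1) by ring, key, key, hp, mul_assoc]

lemma red_of_le {H G J : Ideal R} (h1 : H ≤ G) (h2 : G ≤ J) (h : IsReduction H J) : IsReduction G J := by
  obtain ⟨-, r, hr⟩ := h
  refine ⟨h2, r, le_antisymm ?_ ?_⟩
  · rw [hr]; exact Ideal.mul_mono_left h1
  · rw [pow_succ']; exact Ideal.mul_mono_left h2

lemma red_primary [IsLocalRing R] {H J : Ideal R} (h : IsReduction H J) {q : ℕ} (hq : maximalIdeal R ^ q ≤ J) :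
    ∃ q', maximalIdeal R ^ q' ≤ H := by
  obtain ⟨h1, r, hr⟩ := h
  refine ⟨q * (r + 1), ?_⟩
  rw [pow_mul]
  refine (Ideal.pow_right_mono hq _).trans ?_
  rw [hr]
  exact Ideal.mul_le_left.trans le_rfl

lemma E_aux {n : ℕ} (f w : Fin n → R) (t : R) (G J : Ideal R) (hf : ∀ i, f i ∈ J) (hw : ∀ i, t * w i ∈ J)
    (htJ : t ∈ J) (hg : ∀ i, f i - t * w i ∈ G) (d : Fin n → ℕ) (S : Finset (Fin n)) :
    (∏ i ∈ S, f i ^ d i) ∈ J ^ (∑ i ∈ S, d i) ∧ (∏ i ∈ S, (t * w i) ^ d i) ∈ J ^ (∑ i ∈ S, d i) ∧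
      t * ((∏ i ∈ S, f i ^ d i) - (∏ i ∈ S, (t * w i) ^ d i)) ∈ G * J ^ (∑ i ∈ S, d i) := by
  have hmul : ∀ A B A' B' e e', A ∈ J ^ e → B ∈ J ^ e → t * (A - B) ∈ G * J ^ e →
      A' ∈ J ^ e' → B' ∈ J ^ e' → t * (A' - B') ∈ G * J ^ e' →
      A * A' ∈ J ^ (e + e') ∧ B * B' ∈ J ^ (e + e') ∧ t * (A * A' - B * B') ∈ G * J ^ (e + e') := by
    intro A B A' B' e e' h1 h2 h3 h1' h2' h3'
    refine ⟨pow_add J e e' ▸ Ideal.mul_mem_mul h1 h1', pow_add J e e' ▸ Ideal.mul_mem_mul h2 h2', ?_⟩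
    have : t * (A * A' - B * B') = (t * (A - B)) * A' + B * (t * (A' - B')) := by ring
    rw [this]
    refine add_mem ?_ ?_
    · rw [pow_add, ← mul_assoc]; exact Ideal.mul_mem_mul h3 h1'
    · have := Ideal.mul_mem_mul h2 h3'
      rwa [mul_left_comm, ← pow_add] at this
  have hpow : ∀ i e, f i ^ e ∈ J ^ e ∧ (t * w i) ^ e ∈ J ^ e ∧ t * (f i ^ e - (t * w i) ^ e) ∈ G * J ^ e := by
    intro i e
    induction e with
    | zero => simp
    | succ e ih =>
      have := hmul _ _ (f i) (t * w i) e 1 ih.1 ih.2.1 ih.2.2 (by simpa using hf i) (by simpa using hw i)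
        (by rw [pow_one, mul_comm t]; exact Ideal.mul_mem_mul (hg i) htJ)
      simpa [pow_succ] using this
  classical
  induction S using Finset.induction_on with
  | empty => simp
  | insert i S hi ih =>
    rw [Finset.prod_insert hi, Finset.prod_insert hi, Finset.sum_insert hi]
    exact hmul _ _ _ _ _ _ (hpow i _).1 (hpow i _).2.1 (hpow i _).2.2 ih.1 ih.2.1 ih.2.2

lemma lemE {n s : ℕ} (f : Fin (n + 1) → R) (P : MvPolynomial (Fin (n + 1)) R) (hs : P.IsHomogeneous s)
    (h0 : MvPolynomial.eval f P = 0) (w : Fin (n + 1) → R) (hw : w 0 = 1) (hu : IsUnit (MvPolynomial.eval w P)) :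
    IsReduction (Ideal.span (Set.range fun i : Fin n => f i.succ - f 0 * w i.succ)) (Ideal.span (Set.range f)) := by
  set G := Ideal.span (Set.range fun i : Fin n => f i.succ - f 0 * w i.succ) with hG
  have hfJ : ∀ i, f i ∈ G ⊔ Ideal.span {f 0} := by
    intro i
    refine Fin.cases ?_ (fun i => ?_) i
    · exact Ideal.mem_sup_right (Ideal.mem_span_singleton_self _)
    · have : f i.succ = (f i.succ - f 0 * w i.succ) + f 0 * w i.succ := by ring
      rw [this]
      exact add_mem (Ideal.mem_sup_left (Ideal.subset_span ⟨i, rfl⟩))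
        (Ideal.mul_mem_right _ _ (Ideal.mem_sup_right (Ideal.mem_span_singleton_self _)))
  have hJ : Ideal.span (Set.range f) = G ⊔ Ideal.span {f 0} := by
    apply le_antisymm
    · rw [Ideal.span_le]
      rintro _ ⟨i, rfl⟩
      exact hfJ i
    · refine sup_le ?_ ?_
      · rw [hG, Ideal.span_le]
        rintro _ ⟨i, rfl⟩
        exact sub_mem (Ideal.subset_span ⟨_, rfl⟩) (Ideal.mul_mem_right _ _ (Ideal.subset_span ⟨_, rfl⟩))
      · rw [Ideal.span_singleton_le_iff_mem]
        exact Ideal.subset_span ⟨_, rfl⟩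
  rw [hJ]
  have key : f 0 * (MvPolynomial.eval f P - f 0 ^ s * MvPolynomial.eval w P) ∈ G * (G ⊔ Ideal.span {f 0}) ^ s := by
    rw [MvPolynomial.eval_eq', MvPolynomial.eval_eq', Finset.mul_sum, ← Finset.sum_sub_distrib, Finset.mul_sum]
    refine Ideal.sum_mem _ fun d hd => ?_
    have hdeg : ∑ i, d i = s := by
      have := hs (MvPolynomial.mem_support_iff.mp hd)
      rw [Finsupp.weight_apply, Finsupp.sum_fintype _ _ (by simp)] at this
      simpa using this
    have := (E_aux f w (f 0) G (G ⊔ Ideal.span {f 0}) hfJ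
      (fun i => Ideal.mul_mem_right _ _ (Ideal.mem_sup_right (Ideal.mem_span_singleton_self _)))
      (Ideal.mem_sup_right (Ideal.mem_span_singleton_self _)) (fun i => by
        refine Fin.cases ?_ (fun i => ?_) i
        · rw [hw]; simp
        · exact Ideal.subset_span ⟨i, rfl⟩) d Finset.univ).2.2
    rw [hdeg] at this
    have e : f 0 * (MvPolynomial.coeff d P * ∏ i, f i ^ d i - f 0 ^ s * (MvPolynomial.coeff d P * ∏ i, w i ^ d i)) =
      MvPolynomial.coeff d P * (f 0 * ((∏ i, f i ^ d i) - (∏ i, (f 0 * w i) ^ d i))) := by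
      simp only [mul_pow, Finset.prod_mul_distrib, Finset.prod_pow_eq_pow_sum, hdeg]
      ring
    rw [e]
    exact Ideal.mul_mem_left _ _ this
  apply red_of_pow_mem (s := s)
  obtain ⟨η, hη⟩ := hu
  rw [h0, ← hη] at key
  have := Ideal.mul_mem_left _ (-(↑η⁻¹ : R)) key
  convert this using 1
  have h3 : (↑η⁻¹ : R) * η = 1 := η.inv_mul
  linear_combination (-f 0 ^ (s + 1)) * h3

end P5

section P5b
variable {R : Type u} [CommRing R]

lemma det_mem_pow {n : ℕ} (M : Ideal R) (A : Matrix (Fin n) (Fin n) R) (h : ∀ i j, A i j ∈ M) : A.det ∈ M ^ n := by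
  rw [Matrix.det_apply]
  refine Ideal.sum_mem _ fun σ _ => ?_
  rw [Units.smul_def]
  refine zsmul_mem ?_ _
  have := Ideal.prod_mem_prod (s := (Finset.univ : Finset (Fin n))) (I := fun _ => M) (x := fun i => A (σ i) i) (fun i _ => h _ _)
  simpa using this

lemma mubound [IsDomain R] [IsNoetherianRing R] [IsLocalRing R] (hP : ∃ x y : R, Par x y) {N q : ℕ}
    (f : Fin (N + 1) → R) (hq : maximalIdeal R ^ q ≤ Ideal.span (Set.range f))
    (hN : ¬ Ideal.span (Set.range f) ≤ maximalIdeal R ^ N) :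
    ∃ c : Fin (N + 1) → R, ∑ j, c j * f j = 0 ∧ ∃ j, IsUnit (c j) := by
  by_contra hcon
  push Not at hcon
  apply hN
  let π : (Fin (N + 1) → R) →ₗ[R] R := ∑ j, f j • LinearMap.proj j
  have hπ : ∀ w, π w = ∑ j, w j * f j := by
    intro w
    simp [π, mul_comm]
  have hr : LinearMap.range π = Ideal.span (Set.range f) := by
    apply le_antisymm
    · rintro _ ⟨w, rfl⟩
      rw [hπ]
      exact Ideal.sum_mem _ fun j _ => Ideal.mul_mem_left _ _ (Ideal.subset_span ⟨j, rfl⟩)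
    · rw [Ideal.span_le]
      rintro _ ⟨j, rfl⟩
      refine ⟨Pi.single j 1, ?_⟩
      rw [hπ]
      simp [Pi.single_apply]
  have hbot : LinearMap.range π ≠ ⊥ := by
    intro hb
    obtain ⟨x, y, h⟩ := hP
    have := hq (Ideal.pow_mem_pow h.x_mem q)
    rw [← hr, hb] at this
    exact pow_ne_zero q h.prm.ne_zero (by simpa using this)
  obtain ⟨ψ⟩ := ker_basis hP π hbot
  obtain ⟨x, y, h⟩ := hP
  obtain ⟨η, ⟨η', rfl⟩, hd⟩ := hilbert_burch h π (hr ▸ hq) ψ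
  rw [← hr]
  rintro _ ⟨w, rfl⟩
  have h1 : (η' : R) * π w ∈ maximalIdeal R ^ N := by
    rw [← hd w, Matrix.det_succ_row_zero]
    refine Ideal.sum_mem _ fun j _ => Ideal.mul_mem_left _ _ (det_mem_pow _ _ fun i l => ?_)
    have := hcon (ψ i) ((hπ _).symm.trans (ψ i).2) (j.succAbove l)
    exact this
  have := Ideal.mul_mem_left _ (↑η'⁻¹ : R) h1
  rwa [Units.inv_mul_cancel_left] at this

lemma hom_deg {n s : ℕ} {S : Type*} [CommRing S] {P : MvPolynomial (Fin n) S} (hs : P.IsHomogeneous s)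
    {d : Fin n →₀ ℕ} (hd : d ∈ P.support) : ∑ i, d i = s := by
  have := hs (MvPolynomial.mem_support_iff.mp hd)
  rw [Finsupp.weight_apply, Finsupp.sum_fintype _ _ (by simp)] at this
  simpa using this

lemma eval_smul_hom {n s : ℕ} {S : Type*} [CommRing S] {P : MvPolynomial (Fin n) S} (hs : P.IsHomogeneous s)
    (t : S) (w : Fin n → S) : MvPolynomial.eval (fun i => t * w i) P = t ^ s * MvPolynomial.eval w P := by
  rw [MvPolynomial.eval_eq', MvPolynomial.eval_eq', Finset.mul_sum]
  refine Finset.sum_congr rfl fun d hd => ?_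
  simp only [mul_pow, Finset.prod_mul_distrib, Finset.prod_pow_eq_pow_sum, hom_deg hs hd]
  ring

lemma red_step [IsDomain R] [IsNoetherianRing R] [IsLocalRing R] [Infinite (ResidueField R)] (hP : ∃ x y : R, Par x y) {n q : ℕ}
    (f : Fin (n + 3) → R) (hq : maximalIdeal R ^ q ≤ Ideal.span (Set.range f)) :
    ∃ g : Fin (n + 2) → R, IsReduction (Ideal.span (Set.range g)) (Ideal.span (Set.range f)) := by
  classical
  set J := Ideal.span (Set.range f) with hJ
  let s := 2 * (q + 1)
  let T := Finset.finsuppAntidiag (Finset.univ : Finset (Fin (n + 3))) s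
  have hT : ∀ d : Fin (n + 3) →₀ ℕ, d ∈ T ↔ ∑ i, d i = s := by
    intro d
    simp [T, Finset.mem_finsuppAntidiag]
  have hcard : (q + 1) * s + 2 ≤ T.card := by
    rw [Finset.card_finsuppAntidiag_nat_eq_choose, Finset.card_univ, Fintype.card_fin]
    have h1 : (s + 2).choose s ≤ (n + 3 + s - 1).choose s := Nat.choose_le_choose _ (by omega)
    refine le_trans ?_ h1
    rw [show (s + 2).choose s = (s + 2).choose 2 from Nat.choose_symm_add, Nat.choose_two_right]
    rw [Nat.le_div_iff_mul_le (by norm_num)]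
    simp only [s, show 2 * (q + 1) + 2 - 1 = 2 * (q + 1) + 1 from rfl]
    nlinarith
  obtain ⟨N, hN⟩ : ∃ N, T.card = N + 1 := ⟨T.card - 1, by omega⟩
  have e : Fin (N + 1) ≃ T := (Fintype.equivFinOfCardEq (by simpa using hN)).symm
  let F : Fin (N + 1) → R := fun j => ∏ i, f i ^ (e j : Fin (n + 3) →₀ ℕ) i
  have hle : J ^ s ≤ Ideal.span (Set.range F) := by
    intro z hz
    rw [hJ, Ideal.mem_span_pow_iff_exists_isHomogeneous] at hz
    obtain ⟨p, hp, rfl⟩ := hz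
    rw [MvPolynomial.eval_eq']
    refine Ideal.sum_mem _ fun d hd => Ideal.mul_mem_left _ _ (Ideal.subset_span ⟨e.symm ⟨d, (hT d).2 (hom_deg hp hd)⟩, ?_⟩)
    simp [F]
  have hq1 : maximalIdeal R ^ (q + 1) ≤ J := (Ideal.pow_le_pow_right (Nat.le_succ q)).trans hq
  have hle' : maximalIdeal R ^ ((q + 1) * s) ≤ Ideal.span (Set.range F) := by
    rw [pow_mul]
    exact (Ideal.pow_right_mono hq1 s).trans hle
  obtain ⟨c, hc, j0, hj0⟩ := mubound hP F hle' (by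
    intro hcon
    obtain ⟨x, y, h⟩ := hP
    have h1 := hcon (hle' (Ideal.pow_mem_pow h.x_mem _))
    have h2 : x ^ ((q + 1) * s) * 1 ∈ maximalIdeal R ^ (1 + (q + 1) * s) := by
      rw [mul_one]
      exact Ideal.pow_le_pow_right (by omega) h1
    have := h.of_x_pow_mul _ _ _ h2
    rw [pow_one] at this
    exact (Ideal.ne_top_iff_one _).1 (Ideal.IsPrime.ne_top inferInstance) this)
  let P : MvPolynomial (Fin (n + 3)) R := ∑ j, MvPolynomial.monomial (e j : Fin (n + 3) →₀ ℕ) (c j)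
  have hPh : P.IsHomogeneous s := by
    refine MvPolynomial.IsHomogeneous.sum _ _ _ fun j _ => ?_
    refine MvPolynomial.isHomogeneous_monomial _ ?_
    have := (hT _).1 (e j).2
    rw [← this, Finsupp.degree_eq_sum]
  have hP0 : MvPolynomial.eval f P = 0 := by
    rw [map_sum, ← hc]
    refine Finset.sum_congr rfl fun j _ => ?_
    rw [MvPolynomial.eval_monomial, Finsupp.prod_fintype _ _ (by simp)]
  have hPc : MvPolynomial.coeff (e j0 : Fin (n + 3) →₀ ℕ) P = c j0 := by
    simp only [P, MvPolynomial.coeff_sum, MvPolynomial.coeff_monomial]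
    rw [Finset.sum_eq_single j0]
    · simp
    · intro j _ hj
      rw [if_neg]
      intro h
      exact hj (e.injective (Subtype.ext h))
    · simp
  let Pb := MvPolynomial.map (residue R) P
  have hPb : Pb ≠ 0 := by
    intro h0
    have := congrArg (MvPolynomial.coeff (e j0 : Fin (n + 3) →₀ ℕ)) h0
    rw [MvPolynomial.coeff_map, hPc, MvPolynomial.coeff_zero] at this
    exact (residue_ne_zero_iff_isUnit _).2 hj0 this
  have hne : Pb * MvPolynomial.X 0 ≠ 0 := mul_ne_zero hPb (MvPolynomial.X_ne_zero 0)
  obtain ⟨ub, hub⟩ : ∃ ub, MvPolynomial.eval ub (Pb * MvPolynomial.X 0) ≠ 0 := by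
    by_contra hc
    push Not at hc
    exact hne (MvPolynomial.funext (by simpa using hc))
  rw [map_mul, MvPolynomial.eval_X] at hub
  have hw : ∃ w : Fin (n + 3) → R, w 0 = 1 ∧ ∀ i, residue R (w i) = (ub 0)⁻¹ * ub i := by
    choose w hw using fun i => residue_surjective ((ub 0)⁻¹ * ub i)
    refine ⟨Function.update w 0 1, by simp, fun i => ?_⟩
    by_cases hi : i = 0
    · subst hi
      rw [Function.update_self, map_one, inv_mul_cancel₀ (right_ne_zero_of_mul hub)]
    · rw [Function.update_of_ne hi, hw]
  obtain ⟨w, hw0, hw⟩ := hw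
  refine ⟨_, lemE f P hPh hP0 w hw0 ?_⟩
  rw [← residue_ne_zero_iff_isUnit]
  have : residue R (MvPolynomial.eval w P) = MvPolynomial.eval (fun i => (ub 0)⁻¹ * ub i) Pb := by
    rw [MvPolynomial.eval_map, ← MvPolynomial.eval₂_id, MvPolynomial.hom_eval₂]
    congr 1
    ext i
    exact hw i
  rw [this, eval_smul_hom (hPh.map _)]
  exact mul_ne_zero (pow_ne_zero _ (inv_ne_zero (right_ne_zero_of_mul hub))) (left_ne_zero_of_mul hub)

lemma exists_red_aux [IsDomain R] [IsNoetherianRing R] [IsLocalRing R] [Infinite (ResidueField R)] (hP : ∃ x y : R, Par x y) (n : ℕ) :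
    ∀ {q : ℕ} (f : Fin (n + 2) → R) (_ : maximalIdeal R ^ q ≤ Ideal.span (Set.range f)),
    ∃ a b, IsReduction (Ideal.span {a, b}) (Ideal.span (Set.range f)) := by
  induction n with
  | zero =>
    intro q f hq
    refine ⟨f 0, f 1, ?_⟩
    have : Set.range f = {f 0, f 1} := by
      ext z
      simp [Fin.exists_fin_two, eq_comm]
    rw [this]
    exact ⟨le_rfl, 0, by simp⟩
  | succ n ih =>
    intro q f hq
    obtain ⟨g, hg⟩ := red_step hP f hq
    obtain ⟨q', hq'⟩ := red_primary hg hq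
    obtain ⟨a, b, hab⟩ := ih g hq'
    exact ⟨a, b, red_trans hab hg⟩

/-- Every primary ideal has a two-generated reduction. -/
theorem exists_red [IsDomain R] [IsNoetherianRing R] [IsLocalRing R] [Infinite (ResidueField R)] (hP : ∃ x y : R, Par x y)
    {I : Ideal R} {q : ℕ} (hq : maximalIdeal R ^ q ≤ I) : ∃ a b, IsReduction (Ideal.span {a, b}) I := by
  obtain ⟨s, hs⟩ := (IsNoetherian.noetherian I : I.FG)
  obtain ⟨n, f, hf⟩ : ∃ (n : ℕ) (f : Fin (n + 2) → R), Ideal.span (Set.range f) = I := by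
    refine ⟨s.card, Matrix.vecCons 0 (Matrix.vecCons 0 fun i => (s.equivFin.symm i : R)), ?_⟩
    rw [← hs]
    apply le_antisymm
    · rw [Ideal.span_le]
      rintro _ ⟨i, rfl⟩
      refine Fin.cases ?_ (fun i => Fin.cases ?_ (fun i => ?_) i) i
      · exact zero_mem (Ideal.span (s : Set R))
      · exact zero_mem (Ideal.span (s : Set R))
      · exact Submodule.subset_span (s.equivFin.symm i).2
    · rw [Submodule.span_le]
      intro z hz
      refine Ideal.subset_span ⟨(s.equivFin ⟨z, hz⟩).succ.succ, ?_⟩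
      simp
  rw [← hf] at hq ⊢
  exact exists_red_aux hP n f hq

end P5b

section P5c
variable {R : Type u} [CommRing R]

lemma red_top {H : Ideal R} (h : IsReduction H ⊤) : H = ⊤ := by
  obtain ⟨-, r, hr⟩ := h
  simpa [← Ideal.one_eq_top] using hr.symm

lemma pair_min [IsDomain R] [IsNoetherianRing R] [IsLocalRing R] (hP : ∃ x y : R, Par x y)
    {I H : Ideal R} {a b : R} {q : ℕ} (hq : maximalIdeal R ^ q ≤ I) (hab : Ideal.span {a, b} ≤ I)
    (hH : IsReduction H I) (hle : H ≤ Ideal.span {a, b}) : H = Ideal.span {a, b} := by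
  by_cases hI : I = ⊤
  · subst hI
    have := red_top hH
    rw [this] at hle ⊢
    exact (top_le_iff.mp hle).symm
  refine le_antisymm hle ?_
  by_contra hcon
  have haJ : a ∈ Ideal.span {a, b} := Ideal.subset_span (Or.inl rfl)
  have hbJ : b ∈ Ideal.span {a, b} := Ideal.subset_span (Or.inr rfl)
  have key : ∃ h ∈ I, H ≤ Ideal.span {h} ⊔ maximalIdeal R * I := by
    by_cases hU : ∃ s t, s * a + t * b ∈ H ∧ (IsUnit s ∨ IsUnit t)
    · obtain ⟨s, t, hst, hun⟩ := hU
      refine ⟨_, hH.1 hst, ?_⟩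
      intro g hg
      obtain ⟨s', t', rfl⟩ := Ideal.mem_span_pair.mp (hle hg)
      have hdet : s * t' - s' * t ∈ maximalIdeal R := by
        by_contra hd
        have hu : IsUnit (s * t' - s' * t) := by
          rcases unit_or_mem (s * t' - s' * t) with h | h
          · exact h
          · exact absurd h hd
        obtain ⟨δ, hδ⟩ := hu
        have h1 : (↑δ⁻¹ : R) * δ = 1 := δ.inv_mul
        rw [hδ] at h1
        apply hcon
        have ha : a ∈ H := by
          have : a = ↑δ⁻¹ * (t' * (s * a + t * b) - t * (s' * a + t' * b)) := by linear_combination -a * h1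
          rw [this]
          exact Ideal.mul_mem_left _ _ (sub_mem (Ideal.mul_mem_left _ _ hst) (Ideal.mul_mem_left _ _ hg))
        have hb : b ∈ H := by
          have : b = ↑δ⁻¹ * (s * (s' * a + t' * b) - s' * (s * a + t * b)) := by linear_combination -b * h1
          rw [this]
          exact Ideal.mul_mem_left _ _ (sub_mem (Ideal.mul_mem_left _ _ hg) (Ideal.mul_mem_left _ _ hst))
        rw [Ideal.span_le]
        rintro z (hz | hz)
        · rw [hz]; exact ha
        · rw [Set.mem_singleton_iff.mp hz]; exact hb
      rcases hun with ⟨σ, rfl⟩ | ⟨σ, rfl⟩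
      · have h1 : (↑σ⁻¹ : R) * σ = 1 := σ.inv_mul
        have : s' * a + t' * b = (↑σ⁻¹ * s') * (↑σ * a + t * b) + (↑σ⁻¹ * (↑σ * t' - s' * t)) * b := by
          linear_combination (-s' * a - t' * b) * h1
        rw [this]
        exact add_mem (Ideal.mem_sup_left (Ideal.mul_mem_left _ _ (Ideal.mem_span_singleton_self _)))
          (Ideal.mem_sup_right (Ideal.mul_mem_mul (Ideal.mul_mem_left _ _ hdet) (hab hbJ)))
      · have h1 : (↑σ⁻¹ : R) * σ = 1 := σ.inv_mul
        have : s' * a + t' * b = (↑σ⁻¹ * t') * (s * a + ↑σ * b) + (-↑σ⁻¹ * (s * t' - s' * ↑σ)) * a := by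
          linear_combination (-s' * a - t' * b) * h1
        rw [this]
        exact add_mem (Ideal.mem_sup_left (Ideal.mul_mem_left _ _ (Ideal.mem_span_singleton_self _)))
          (Ideal.mem_sup_right (Ideal.mul_mem_mul (Ideal.mul_mem_left _ _ hdet) (hab haJ)))
    · refine ⟨0, zero_mem _, ?_⟩
      intro g hg
      obtain ⟨s', t', rfl⟩ := Ideal.mem_span_pair.mp (hle hg)
      push Not at hU
      obtain ⟨h1, h2⟩ := hU s' t' hg
      refine Ideal.mem_sup_right (add_mem (Ideal.mul_mem_mul ?_ (hab haJ)) (Ideal.mul_mem_mul ?_ (hab hbJ)))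
      · rcases unit_or_mem s' with h | h
        · exact absurd h h1
        · exact h
      · rcases unit_or_mem t' with h | h
        · exact absurd h h2
        · exact h
  obtain ⟨h, hhI, hh⟩ := key
  obtain ⟨-, r, hr⟩ := hH
  have h1 : I ^ (r + 1) ≤ Ideal.span {h} * I ^ r ⊔ maximalIdeal R • I ^ (r + 1) := by
    conv_lhs => rw [hr]
    refine (Ideal.mul_mono_left hh).trans ?_
    rw [Ideal.sup_mul, smul_eq_mul, mul_assoc, ← pow_succ']
  have h2 := Submodule.le_of_le_smul_of_le_jacobson_bot (IsNoetherian.noetherian (I ^ (r + 1)))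
    (IsLocalRing.maximalIdeal_le_jacobson ⊥) h1
  have h3 : maximalIdeal R ^ (q * (r + 1)) ≤ Ideal.span {h} := by
    rw [pow_mul]
    exact (Ideal.pow_right_mono hq _).trans (h2.trans (Ideal.mul_le_left.trans le_rfl))
  obtain ⟨x, y, hp⟩ := hP
  have hu := hp.unit_of_dvd (Ideal.mem_span_singleton.mp (h3 (Ideal.pow_mem_pow hp.x_mem _)))
    (Ideal.mem_span_singleton.mp (h3 (Ideal.pow_mem_pow hp.y_mem _)))
  exact hI (Ideal.eq_top_of_isUnit_mem _ hhI hu)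

lemma pair_isMin [IsDomain R] [IsNoetherianRing R] [IsLocalRing R] (hP : ∃ x y : R, Par x y)
    {I : Ideal R} {a b : R} {q : ℕ} (hq : maximalIdeal R ^ q ≤ I) (hab : IsReduction (Ideal.span {a, b}) I) :
    IsMinimalReduction (Ideal.span {a, b}) I :=
  ⟨hab, fun _ h1 h2 => pair_min hP hq hab.1 h1 h2⟩

lemma min_isPair [IsDomain R] [IsNoetherianRing R] [IsLocalRing R] [Infinite (ResidueField R)] (hP : ∃ x y : R, Par x y)
    {I J : Ideal R} {q : ℕ} (hq : maximalIdeal R ^ q ≤ I) (hJ : IsMinimalReduction J I) :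
    ∃ a b, J = Ideal.span {a, b} := by
  obtain ⟨q', hq'⟩ := red_primary hJ.1 hq
  obtain ⟨a, b, hab⟩ := exists_red hP hq'
  exact ⟨a, b, (hJ.2 _ (red_trans hab hJ.1) hab.1).symm⟩

lemma mem_core_iff [IsDomain R] [IsNoetherianRing R] [IsLocalRing R] [Infinite (ResidueField R)] (hP : ∃ x y : R, Par x y)
    {I : Ideal R} {q : ℕ} (hq : maximalIdeal R ^ q ≤ I) (z : R) :
    z ∈ core I ↔ ∀ a b, IsReduction (Ideal.span {a, b}) I → z ∈ Ideal.span {a, b} := by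
  rw [core, Ideal.mem_sInf]
  constructor
  · intro h a b hab
    exact h (pair_isMin hP hq hab)
  · intro h J hJ
    obtain ⟨a, b, rfl⟩ := min_isPair hP hq hJ
    exact h a b hJ.1

end P5c

section P5d
variable {R : Type u} [CommRing R]

lemma good_seq [IsLocalRing R] [Infinite (ResidueField R)] (Q : Polynomial R) (hQ : Q.eval 0 = 1) :
    ∃ u : ℕ → R, u 0 = 0 ∧ (∀ i j, i ≠ j → IsUnit (u i - u j)) ∧ ∀ j, IsUnit (Q.eval (u j)) := by
  classical
  let Qb := Q.map (residue R)
  have hQb : Qb * Polynomial.X ≠ 0 := by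
    refine mul_ne_zero ?_ Polynomial.X_ne_zero
    intro h0
    have : Qb.eval (residue R 0) = 1 := by
      rw [Polynomial.eval_map, Polynomial.eval₂_hom, hQ, map_one]
    rw [h0] at this
    simp at this
  have hfin : {z : ResidueField R | (Qb * Polynomial.X).eval z = 0}.Finite := by
    refine ((Qb * Polynomial.X).roots.toFinset.finite_toSet).subset ?_
    intro z hz
    simp only [Finset.mem_coe, Multiset.mem_toFinset]
    exact (Polynomial.mem_roots hQb).mpr hz
  have hinf := hfin.infinite_compl
  let e := hinf.natEmbedding
  choose w hw using fun j => residue_surjective (e j : ResidueField R)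
  have he : ∀ j, (Qb * Polynomial.X).eval (e j : ResidueField R) ≠ 0 := fun j => (e j).2
  have hw1 : ∀ j, IsUnit (Q.eval (w j)) ∧ IsUnit (w j) := by
    intro j
    have := he j
    rw [← hw, Polynomial.eval_mul, Polynomial.eval_X, Polynomial.eval_map, Polynomial.eval₂_hom] at this
    exact ⟨(residue_ne_zero_iff_isUnit _).1 (left_ne_zero_of_mul this), (residue_ne_zero_iff_isUnit _).1 (right_ne_zero_of_mul this)⟩
  refine ⟨fun j => Nat.casesOn j 0 w, rfl, ?_, ?_⟩
  · intro i j hij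
    rcases i with _ | i <;> rcases j with _ | j
    · exact absurd rfl hij
    · simpa using (hw1 j).2
    · simpa using (hw1 i).2
    · change IsUnit (w i - w j)
      rw [← residue_ne_zero_iff_isUnit, map_sub, hw, hw, sub_ne_zero]
      intro h
      exact hij (by rw [e.injective (Subtype.ext h)])
  · intro j
    rcases j with _ | j
    · change IsUnit (Q.eval 0)
      rw [hQ]; exact isUnit_one
    · exact (hw1 j).1

lemma generic_red [IsDomain R] [IsNoetherianRing R] {I : Ideal R} {a b c : R}
    (hab : IsReduction (Ideal.span {a, b}) I) (hc : c ∈ I) :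
    (∃ s, c ^ (s + 1) ∈ Ideal.span {a, b} * (Ideal.span {a, b} ⊔ Ideal.span {c}) ^ s) ∧
    ∃ Q : Polynomial R, Q.eval 0 = 1 ∧ ∀ u, IsUnit (Q.eval u) → IsReduction (Ideal.span {a + u * c, b}) I := by
  obtain ⟨s, hs⟩ := exists_pow_mem (F := FractionRing R) (Ideal.span {a, b}) (z := c) (fun V hV => v_red hV hab hc)
  refine ⟨⟨s, hs⟩, ?_⟩
  let f : Fin 3 → R := ![c, a, b]
  have hf : Ideal.span {a, b} ⊔ Ideal.span {c} = Ideal.span (Set.range f) := by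
    rw [← Ideal.span_union]
    congr 1
    ext z
    simp [f, Fin.exists_fin_succ, eq_comm]
    tauto
  obtain ⟨s1, h1, s2, h2, he⟩ := (mem_span_mul (C := (Ideal.span {a, b} ⊔ Ideal.span {c}) ^ s)).mp hs
  rw [hf, Ideal.mem_span_pow_iff_exists_isHomogeneous] at h1 h2
  obtain ⟨q1, hq1, rfl⟩ := h1
  obtain ⟨q2, hq2, rfl⟩ := h2
  let P : MvPolynomial (Fin 3) R := MvPolynomial.X 0 ^ (s + 1) - (MvPolynomial.X 1 * q1 + MvPolynomial.X 2 * q2)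
  have hP : P.IsHomogeneous (s + 1) := by
    refine MvPolynomial.IsHomogeneous.sub ?_ (MvPolynomial.IsHomogeneous.add ?_ ?_)
    · exact MvPolynomial.isHomogeneous_X_pow _ _
    · rw [add_comm]; exact (MvPolynomial.isHomogeneous_X _ _).mul hq1
    · rw [add_comm]; exact (MvPolynomial.isHomogeneous_X _ _).mul hq2
  have hP0 : MvPolynomial.eval f P = 0 := by
    simp only [P, map_sub, map_add, map_mul, map_pow, MvPolynomial.eval_X]
    simp only [f] at he ⊢
    simp
    linear_combination he
  let g : Polynomial R := MvPolynomial.eval₂ Polynomial.C ![1, -Polynomial.X, 0] q1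
  have hg : ∀ u, g.eval u = MvPolynomial.eval ![1, -u, 0] q1 := by
    intro u
    rw [← Polynomial.coe_evalRingHom, MvPolynomial.hom_eval₂, ← MvPolynomial.eval₂_id]
    congr 1
    · ext; simp
    · ext i
      fin_cases i <;> simp
  refine ⟨1 + Polynomial.X * g, by simp, fun u hu => ?_⟩
  have hw : MvPolynomial.eval ![1, -u, 0] P = (1 + Polynomial.X * g).eval u := by
    simp only [P, map_sub, map_add, map_mul, map_pow, MvPolynomial.eval_X, Polynomial.eval_add, Polynomial.eval_mul, hg]
    simp
  have hr := lemE f P hP hP0 ![1, -u, 0] rfl (hw ▸ hu)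
  have hset : (Set.range fun i : Fin 2 => f i.succ - f 0 * ![1, -u, 0] i.succ) = {a + u * c, b} := by
    ext z
    simp [f, Fin.exists_fin_two, eq_comm, mul_comm]
  rw [hset, ← hf] at hr
  refine red_trans hr (red_of_le le_sup_left (sup_le hab.1 ?_) hab)
  rwa [Ideal.span_singleton_le_iff_mem]

lemma sup_pow_le (X B : Ideal R) (s : ℕ) : (X ⊔ B) ^ s ≤ X ^ s ⊔ B := by
  induction s with
  | zero => simp
  | succ s ih =>
    rw [pow_succ, pow_succ]
    refine (Ideal.mul_mono_left ih).trans ?_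
    rw [Ideal.sup_mul, Ideal.mul_sup]
    refine sup_le (sup_le le_sup_left ?_) ?_
    · exact (Ideal.mul_le_right.trans le_rfl).trans le_sup_right
    · exact (Ideal.mul_le_left.trans le_rfl).trans le_sup_right

lemma forms_le {M : Ideal R} {l : R} {L : ℕ → R} (hl : ∀ j, M ≤ Ideal.span {l} ⊔ Ideal.span {L j})
    (hL : ∀ j, L j ∈ M) (k : ℕ) :
    M ^ (k + 1) ≤ Ideal.span {l} * M ^ k ⊔ Ideal.span {∏ j ∈ Finset.range (k + 1), L j} := by
  have hprod : ∀ k, ∏ j ∈ Finset.range k, L j ∈ M ^ k := by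
    intro k
    have := Ideal.prod_mem_prod (s := Finset.range k) (I := fun _ => M) (x := L) (fun i _ => hL i)
    simpa using this
  induction k with
  | zero => simpa using hl 0
  | succ k ih =>
    rw [pow_succ' _ (k + 1)]
    refine (Ideal.mul_mono_right ih).trans ?_
    rw [Ideal.mul_sup]
    refine sup_le ?_ ?_
    · rw [mul_left_comm, ← pow_succ']
      exact le_sup_left
    · refine (Ideal.mul_mono_left (hl (k + 1))).trans ?_
      rw [Ideal.sup_mul]
      refine sup_le ?_ ?_
      · refine (Ideal.mul_mono_right ?_).trans le_sup_left
        rw [Ideal.span_singleton_le_iff_mem]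
        exact hprod _
      · rw [Ideal.span_singleton_mul_span_singleton, Finset.prod_range_succ _ (k + 1), mul_comm]
        exact le_sup_right

lemma forms_mem {a c b z : R} {u : ℕ → R} (hu : ∀ i j, i ≠ j → IsUnit (u i - u j))
    (hz : ∀ j, z ∈ Ideal.span {a + u j * c, b}) (k : ℕ) :
    Ideal.span {z} * Ideal.span {a, c} ^ k ≤ Ideal.span {∏ j ∈ Finset.range (k + 1), (a + u j * c)} ⊔ Ideal.span {b} := by
  have hz' : ∀ j, z ∈ Ideal.span {a + u j * c} ⊔ Ideal.span {b} := by
    intro j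
    rw [← Ideal.span_insert]
    exact hz j
  induction k with
  | zero =>
    simpa [Ideal.span_singleton_le_iff_mem] using hz' 0
  | succ k ih =>
    let L : ℕ → R := fun j => if j = k + 1 then a + u 0 * c else a + u j * c
    have hlk : ∀ j, L j = a + u j * c ∨ L j = a + u 0 * c := by
      intro j
      by_cases h : j = k + 1
      · right; simp [L, h]
      · left; simp [L, h]
    have hpair : ∀ j, j ≠ k + 1 → Ideal.span {a, c} ≤ Ideal.span {a + u (k + 1) * c} ⊔ Ideal.span {a + u j * c} := by
      intro j hj
      obtain ⟨δ, hδ⟩ := hu (k + 1) j hj.symm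
      have h1 : (↑δ⁻¹ : R) * (u (k + 1) - u j) = 1 := by rw [← hδ]; exact δ.inv_mul
      have m1 : a + u (k + 1) * c ∈ Ideal.span {a + u (k + 1) * c} ⊔ Ideal.span {a + u j * c} :=
        Ideal.mem_sup_left (Ideal.mem_span_singleton_self _)
      have m2 : a + u j * c ∈ Ideal.span {a + u (k + 1) * c} ⊔ Ideal.span {a + u j * c} :=
        Ideal.mem_sup_right (Ideal.mem_span_singleton_self _)
      have m3 : c ∈ Ideal.span {a + u (k + 1) * c} ⊔ Ideal.span {a + u j * c} := by
        have : c = ↑δ⁻¹ * ((a + u (k + 1) * c) - (a + u j * c)) := by linear_combination -c * h1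
        have m5 := Ideal.mul_mem_left _ (↑δ⁻¹ : R) (sub_mem m1 m2)
        rwa [← this] at m5
      have m4 : a ∈ Ideal.span {a + u (k + 1) * c} ⊔ Ideal.span {a + u j * c} := by
        have : a = (a + u j * c) - u j * c := by ring
        have m5 := sub_mem m2 (Ideal.mul_mem_left _ (u j) m3)
        rwa [← this] at m5
      rw [Ideal.span_le]
      rintro t (ht | ht)
      · rw [ht]; exact m4
      · rw [Set.mem_singleton_iff.mp ht]; exact m3
    have hf := forms_le (M := Ideal.span {a, c}) (l := a + u (k + 1) * c) (L := L) (by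
        intro j
        by_cases h : j = k + 1
        · have : L j = a + u 0 * c := by simp [L, h]
          rw [this]
          exact hpair 0 (by omega)
        · have : L j = a + u j * c := by simp [L, h]
          rw [this]
          exact hpair j h) (by
        intro j
        have hm : ∀ t, a + t * c ∈ Ideal.span {a, c} := fun t =>
          add_mem (Ideal.subset_span (Or.inl rfl)) (Ideal.mul_mem_left _ _ (Ideal.subset_span (Or.inr rfl)))
        rcases hlk j with h | h <;> rw [h] <;> exact hm _) k
    have hprod : ∏ j ∈ Finset.range (k + 1), L j = ∏ j ∈ Finset.range (k + 1), (a + u j * c) := by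
      refine Finset.prod_congr rfl fun j hj => ?_
      have : j ≠ k + 1 := by
        have := Finset.mem_range.mp hj
        omega
      simp [L, this]
    rw [hprod] at hf
    refine (Ideal.mul_mono_right hf).trans ?_
    rw [Ideal.mul_sup, Finset.prod_range_succ _ (k + 1)]
    refine sup_le ?_ ?_
    · rw [mul_left_comm]
      refine (Ideal.mul_mono_right ih).trans ?_
      rw [Ideal.mul_sup, Ideal.span_singleton_mul_span_singleton, mul_comm (a + u (k + 1) * c)]
      exact sup_le_sup le_rfl (Ideal.mul_le_right.trans le_rfl)
    · rw [mul_comm]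
      refine (Ideal.mul_mono_right ((Ideal.span_singleton_le_iff_mem _).2 (hz' (k + 1)))).trans ?_
      rw [Ideal.mul_sup, Ideal.span_singleton_mul_span_singleton]
      exact sup_le_sup le_rfl (Ideal.mul_le_right.trans le_rfl)

lemma core_coeff [IsDomain R] [IsNoetherianRing R] [IsLocalRing R] [Infinite (ResidueField R)] (hP : ∃ x y : R, Par x y)
    {I : Ideal R} {q : ℕ} (hq : maximalIdeal R ^ q ≤ I) {a b α β : R}
    (hab : IsReduction (Ideal.span {a, b}) I)
    (hx : ∀ a' b', IsReduction (Ideal.span {a', b'}) I → α * a + β * b ∈ Ideal.span {a', b'}) {c : R} (hc : c ∈ I) :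
    α * c ∈ Ideal.span {a, b} := by
  obtain ⟨⟨s, hs⟩, Q, hQ0, hQ⟩ := generic_red hab hc
  obtain ⟨u, hu0, hu, huQ⟩ := good_seq Q hQ0
  have hred := fun j => hQ (u j) (huQ j)
  have hz : ∀ j, α * a ∈ Ideal.span {a + u j * c, b} := by
    intro j
    have h1 := hx _ _ (hred j)
    have : α * a = (α * a + β * b) - β * b := by ring
    rw [this]
    exact sub_mem h1 (Ideal.mul_mem_left _ _ (Ideal.subset_span (Or.inr rfl)))
  have hforms := forms_mem hu hz s
  have hs' : c ^ (s + 1) ∈ Ideal.span {a} * Ideal.span {a, c} ^ s ⊔ Ideal.span {b} := by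
    have e1 : Ideal.span {a, b} ⊔ Ideal.span {c} = Ideal.span {a, c} ⊔ Ideal.span {b} := by
      rw [Ideal.span_insert, Ideal.span_insert, sup_right_comm]
    rw [e1] at hs
    have e2 := Ideal.mul_mono_right (I := Ideal.span {a, b}) (sup_pow_le (Ideal.span {a, c}) (Ideal.span {b}) s) hs
    rw [Ideal.span_insert a {b}, Ideal.mul_sup, Ideal.sup_mul] at e2
    refine (sup_le (sup_le le_sup_left ?_) ?_ : _ ≤ Ideal.span {a} * Ideal.span {a, c} ^ s ⊔ Ideal.span {b}) e2
    · exact (Ideal.mul_le_left.trans le_rfl).trans le_sup_right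
    · exact (Ideal.mul_le_right.trans le_rfl).trans le_sup_right
  set e0 := ∏ j ∈ Finset.range s, (a + u (j + 1) * c) with he0
  have hprod : ∏ j ∈ Finset.range (s + 1), (a + u j * c) = e0 * a := by
    rw [Finset.prod_range_succ', hu0, zero_mul, add_zero]
  have he0M : e0 ∈ Ideal.span {a, c} ^ s := by
    have := Ideal.prod_mem_prod (s := Finset.range s) (I := fun _ => Ideal.span {a, c}) (x := fun j => a + u (j + 1) * c) (fun i _ =>
       add_mem (Ideal.subset_span (Or.inl rfl)) (Ideal.mul_mem_left _ _ (Ideal.subset_span (Or.inr rfl))))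
    simpa using this
  have h1 : c * e0 ∈ Ideal.span {a} * Ideal.span {a, c} ^ s ⊔ Ideal.span {b} := by
    have h2 : c * e0 ∈ Ideal.span {a, c} ^ (s + 1) := by
      rw [pow_succ']
      exact Ideal.mul_mem_mul (Ideal.subset_span (Or.inr rfl)) he0M
    have h3 := pow_sup_span_le (Ideal.span {a}) c s
    rw [← Ideal.span_insert] at h3
    refine (sup_le le_sup_left ?_ : _ ≤ Ideal.span {a} * Ideal.span {a, c} ^ s ⊔ Ideal.span {b}) (h3 h2)
    rwa [Ideal.span_singleton_le_iff_mem]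
  have h2 : α * (c * e0) ∈ Ideal.span {e0 * a} ⊔ Ideal.span {b} := by
    have h3 := Ideal.mul_mem_mul (Ideal.mem_span_singleton_self α) h1
    rw [Ideal.mul_sup, ← mul_assoc, Ideal.span_singleton_mul_span_singleton] at h3
    rw [← hprod]
    have h4 : Ideal.span {α} * Ideal.span {b} ≤ Ideal.span {∏ j ∈ Finset.range (s + 1), (a + u j * c)} ⊔ Ideal.span {b} :=
      (Ideal.mul_le_right : Ideal.span {α} * Ideal.span {b} ≤ Ideal.span {b}).trans le_sup_right
    exact sup_le hforms h4 h3
  rw [← Ideal.span_insert, Ideal.mem_span_pair] at h2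
  obtain ⟨w, w', hw⟩ := h2
  obtain ⟨x, y, h⟩ := hP
  have hcancel : ∀ k t, b ∣ (∏ j ∈ Finset.range k, (a + u (j + 1) * c)) * t → b ∣ t := by
    intro k
    induction k with
    | zero => intro t; simp
    | succ k ih =>
      intro t ht
      rw [Finset.prod_range_succ, mul_assoc] at ht
      obtain ⟨N, hN⟩ := red_primary (hred (k + 1)) hq
      rw [Set.pair_comm] at hN
      exact h.dvd_of_cm hN (ih _ ht)
  obtain ⟨w'', hw''⟩ := hcancel s (α * c - w * a) ⟨w', by rw [← he0]; linear_combination -hw⟩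
  rw [Ideal.mem_span_pair]
  exact ⟨w, w'', by linear_combination -hw''⟩

end P5d

section P6
variable {R : Type u} [CommRing R] [IsDomain R] [IsNoetherianRing R] [IsLocalRing R]

lemma Iv_eq_of_red {F : Type u} [Field F] [Algebra R F] [FaithfulSMul R F] {I : Ideal R} (hI : IsIntClosedIdeal I) {a b : R}
    (hab : IsReduction (Ideal.span {a, b}) I) : Iv F a b = I := by
  apply le_antisymm
  · intro z hz
    refine mem_of_v (F := F) hI ?_
    intro V hV
    obtain ⟨t, ht, h⟩ := hz V hV
    rcases ht with rfl | ht
    · exact ⟨a, hab.1 (Ideal.subset_span (by simp)), h⟩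
    · rw [Set.mem_singleton_iff] at ht
      subst ht
      exact ⟨b, hab.1 (Ideal.subset_span (by simp)), h⟩
  · intro z hz V hV
    obtain ⟨i, hi, h⟩ := v_red hV hab hz
    have h1 : i ∈ Iv F a b := span_le_Iv _ _ hi
    obtain ⟨t, ht, h'⟩ := h1 V hV
    exact ⟨t, ht, h.trans h'⟩

lemma minors_mem [Infinite (ResidueField R)] (hP : ∃ x y : R, Par x y) {k m q : ℕ}
    (φ : Matrix (Fin (k + 2)) (Fin m) R)
    (π : (Fin (k + 2) → R) →ₗ[R] R) (hker : LinearMap.range (Matrix.toLin' φ) = LinearMap.ker π)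
    {I : Ideal R} (hI : LinearMap.range π = I) (hc : IsIntClosedIdeal I) (hq : maximalIdeal R ^ q ≤ I)
    {a b : R} (hab : IsReduction (Ideal.span {a, b}) I) :
    minorsIdeal k φ = Kc (FractionRing R) a b := by
  obtain ⟨q', hq'⟩ := red_primary hab hq
  have hIv := Iv_eq_of_red (F := FractionRing R) hc hab
  ext c
  rw [minors_eq hP φ π hker hI (hab.1 (Ideal.subset_span (by simp))) (hab.1 (Ideal.subset_span (by simp))) hq'
    (fun i hi j hj => ?_) c, mem_Kc, hIv]
  rw [← hIv] at hi hj ⊢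
  exact Iv_mul_Iv hP hq' hi hj

lemma vcl_TB {F : Type u} [Field F] [Algebra R F] {a b z : R}
    (h : ∀ V : ValuationSubring F, Over R V → ∃ k ∈ Kc F a b, ∃ i ∈ Iv F a b,
      V.valuation (algebraMap R F z) ≤ V.valuation (algebraMap R F k) * V.valuation (algebraMap R F i)) :
    algebraMap R F z ∈ vcl R (TB F a b) := by
  intro V hV
  obtain ⟨k, hk, i, hi, h1⟩ := h V hV
  obtain ⟨t, ht, h2⟩ := hi V hV
  refine ⟨algebraMap R F k * t, ⟨k, hk, ?_⟩, ?_⟩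
  · rcases ht with rfl | ht
    · exact Or.inl rfl
    · rw [Set.mem_singleton_iff] at ht
      subst ht
      exact Or.inr rfl
  · rw [map_mul]
    exact h1.trans (mul_le_mul' le_rfl h2)

theorem primary_case [Infinite (ResidueField R)] (hP : ∃ x y : R, Par x y) {k m q : ℕ}
    (φ : Matrix (Fin (k + 2)) (Fin m) R)
    (π : (Fin (k + 2) → R) →ₗ[R] R) (hker : LinearMap.range (Matrix.toLin' φ) = LinearMap.ker π)
    {I : Ideal R} (hI : LinearMap.range π = I) (hc : IsIntClosedIdeal I) (hq : maximalIdeal R ^ q ≤ I) :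
    core I = minorsIdeal k φ * I ∧ IsIntClosedIdeal (minorsIdeal k φ) ∧ IsIntClosedIdeal (core I) := by
  have hK : ∀ {a b : R}, IsReduction (Ideal.span {a, b}) I → minorsIdeal k φ = Kc (FractionRing R) a b :=
    fun hab => minors_mem hP φ π hker hI hc hq hab
  have hIv : ∀ {a b : R}, IsReduction (Ideal.span {a, b}) I → Iv (FractionRing R) a b = I :=
    fun hab => Iv_eq_of_red hc hab
  obtain ⟨a, b, hab⟩ := exists_red hP hq
  have hcore : core I = minorsIdeal k φ * I := by
    apply le_antisymm
    · intro z hz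
      rw [mem_core_iff hP hq] at hz
      obtain ⟨α, β, rfl⟩ := Ideal.mem_span_pair.1 (hz a b hab)
      have h1 : α ∈ minorsIdeal k φ := by
        rw [hK hab, mem_Kc, hIv hab]
        intro i hi
        exact core_coeff hP hq hab hz hi
      have h2 : β ∈ minorsIdeal k φ := by
        rw [hK hab, mem_Kc, hIv hab]
        intro i hi
        rw [Set.pair_comm] at hab ⊢
        rw [add_comm] at hz
        exact core_coeff hP hq hab hz hi
      exact add_mem (Ideal.mul_mem_mul h1 (hab.1 (Ideal.subset_span (by simp))))
        (Ideal.mul_mem_mul h2 (hab.1 (Ideal.subset_span (by simp))))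
    · rw [Ideal.mul_le]
      intro c hc' i hi
      rw [mem_core_iff hP hq]
      intro a' b' h'
      rw [hK h', mem_Kc, hIv h'] at hc'
      exact hc' i hi
  refine ⟨hcore, ?_, ?_⟩
  · intro J hJ
    refine le_antisymm ?_ hJ.1
    intro z hz
    rw [hK hab, mem_Kc]
    intro i hi
    obtain ⟨q', hq'⟩ := red_primary hab hq
    refine partB (F := FractionRing R) hP hq' (vcl_TB fun V hV => ?_)
    obtain ⟨c, hc', h1⟩ := v_red hV hJ hz
    rw [hK hab] at hc'
    refine ⟨c, hc', i, hi, ?_⟩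
    rw [map_mul, map_mul]
    exact mul_le_mul' h1 le_rfl
  · intro J hJ
    refine le_antisymm ?_ hJ.1
    intro z hz
    rw [mem_core_iff hP hq]
    intro a' b' h'
    obtain ⟨q', hq'⟩ := red_primary h' hq
    refine partB (F := FractionRing R) hP hq' (vcl_TB fun V hV => ?_)
    obtain ⟨w, hw, h1⟩ := v_red hV hJ hz
    rw [hcore] at hw
    obtain ⟨c, hc', h2⟩ := exists_max hV (IsNoetherian.noetherian (minorsIdeal k φ))
    obtain ⟨i, hi, h3⟩ := exists_max hV (IsNoetherian.noetherian I)
    rw [hK h'] at hc'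
    rw [← hIv h'] at hi
    exact ⟨c, hc', i, hi, h1.trans (v_mul_le h2 h3 hw)⟩

end P6

section P6b
variable {R : Type u} [CommRing R] [IsDomain R] [IsNoetherianRing R] [IsLocalRing R]

/-- If every element of `I` is divisible by `g` then `I = g I'`. -/
lemma exists_div {I : Ideal R} {g : R} (h : ∀ z ∈ I, g ∣ z) :
    ∃ I' : Ideal R, I = Ideal.span {g} * I' ∧ (∀ z, g * z ∈ I → z ∈ I') := by
  refine ⟨(Submodule.comap (LinearMap.mulLeft R g) I : Ideal R), ?_, fun z hz => hz⟩
  ext z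
  rw [Ideal.mem_span_singleton_mul]
  constructor
  · intro hz
    obtain ⟨w, rfl⟩ := h z hz
    exact ⟨w, hz, rfl⟩
  · rintro ⟨w, hw, rfl⟩
    exact hw

lemma Par.pow_y {x y : R} (h : Par x y) {H : Ideal R} {z : R} (hz : z ∈ H) (hx : ¬ x ∣ z) :
    ∃ n, y ^ n ∈ H ⊔ Ideal.span {x} := by
  have hz0 : (Ideal.Quotient.mk (Ideal.span {x})) z ≠ 0 := by
    rw [Ne, Ideal.Quotient.eq_zero_iff_mem, Ideal.mem_span_singleton]
    exact hx
  -- write z = u y^n + x t by Krull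
  by_contra hcon
  push Not at hcon
  have hall : ∀ n, ∃ w t, z = y ^ n * w + x * t := by
    intro n
    induction n with
    | zero => exact ⟨z, 0, by simp⟩
    | succ n ih =>
      obtain ⟨w, t, hw⟩ := ih
      rcases unit_or_mem w with hu | hm
      · exfalso
        apply hcon n
        obtain ⟨v, hv⟩ := hu.exists_right_inv
        have : y ^ n = z * v + x * (-(t * v)) := by
          rw [hw]; linear_combination (-(y ^ n)) * hv
        rw [this]
        exact add_mem (Ideal.mem_sup_left (Ideal.mul_mem_right _ _ hz))
          (Ideal.mem_sup_right (Ideal.mul_mem_right _ _ (Ideal.mem_span_singleton_self _)))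
      · rw [h.spn, Ideal.mem_span_pair] at hm
        obtain ⟨p, q, rfl⟩ := hm
        exact ⟨q, t + y ^ n * p, by rw [hw]; ring⟩
  haveI : Nontrivial (R ⧸ Ideal.span {x}) := ⟨⟨_, _, hz0⟩⟩
  haveI : IsLocalRing (R ⧸ Ideal.span {x}) := IsLocalRing.of_surjective' (Ideal.Quotient.mk _) Ideal.Quotient.mk_surjective
  have hK := Ideal.iInf_pow_eq_bot_of_isLocalRing (Ideal.span {Ideal.Quotient.mk (Ideal.span {x}) y}) (by
    rw [Ideal.ne_top_iff_exists_maximal]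
    refine ⟨maximalIdeal _, inferInstance, ?_⟩
    rw [Ideal.span_singleton_le_iff_mem, mem_maximalIdeal, mem_nonunits_iff]
    intro hu
    obtain ⟨v, hv⟩ := hu.exists_right_inv
    obtain ⟨v, rfl⟩ := Ideal.Quotient.mk_surjective v
    rw [← map_mul, ← map_one (Ideal.Quotient.mk _), Ideal.Quotient.eq, Ideal.mem_span_singleton] at hv
    obtain ⟨c, hc⟩ := hv
    have h1 : (1 : R) ∈ maximalIdeal R := by
      have : (1 : R) = y * v - x * c := by rw [← hc]; ring
      rw [this]
      exact sub_mem (Ideal.mul_mem_right _ _ h.y_mem) (Ideal.mul_mem_right _ _ h.x_mem)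
    exact (Ideal.ne_top_iff_one _).1 (maximalIdeal.isMaximal R).ne_top h1)
  apply hz0
  have : Ideal.Quotient.mk (Ideal.span {x}) z ∈ (⨅ i, Ideal.span {Ideal.Quotient.mk (Ideal.span {x}) y} ^ i) := by
    rw [Ideal.mem_iInf]
    intro n
    obtain ⟨w, t, hw⟩ := hall n
    rw [Ideal.span_singleton_pow, Ideal.mem_span_singleton]
    refine ⟨Ideal.Quotient.mk _ w, ?_⟩
    rw [← map_pow, ← map_mul, Ideal.Quotient.eq, Ideal.mem_span_singleton]
    exact ⟨t, by rw [hw]; ring⟩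
  rw [hK] at this
  exact this

lemma Par.factor {x y : R} (h : Par x y) {I : Ideal R} (hI : I ≠ ⊥) :
    ∃ (g : R) (I' : Ideal R) (q : ℕ), g ≠ 0 ∧ I = Ideal.span {g} * I' ∧ maximalIdeal R ^ q ≤ I' := by
  -- pull out powers of x
  have h1 : ∃ k, ∃ I1 : Ideal R, I = Ideal.span {x ^ k} * I1 ∧ ∃ z ∈ I1, ¬ x ∣ z := by
    by_contra hcon
    push Not at hcon
    have hall : ∀ k, ∃ I1 : Ideal R, I = Ideal.span {x ^ k} * I1 := by
      intro k
      induction k with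
      | zero => exact ⟨I, by simp⟩
      | succ k ih =>
        obtain ⟨I1, h1⟩ := ih
        obtain ⟨I2, h2, -⟩ := exists_div (hcon k I1 h1)
        refine ⟨I2, ?_⟩
        rw [h1, h2, ← mul_assoc, Ideal.span_singleton_mul_span_singleton, pow_succ]
    apply hI
    rw [eq_bot_iff]
    have hK := Ideal.iInf_pow_eq_bot_of_isLocalRing (Ideal.span {x}) (by
      intro ht
      rw [Ideal.span_singleton_eq_top] at ht
      exact h.prm.not_unit ht)
    rw [← hK]
    refine le_iInf fun k => ?_
    obtain ⟨I1, h1⟩ := hall k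
    rw [h1, Ideal.span_singleton_pow, Ideal.mul_le]
    intro r hr s _
    exact Ideal.mul_mem_right _ _ hr
  obtain ⟨k, I1, hI1, z, hz, hxz⟩ := h1
  -- saturate with respect to x
  let S : ℕ →o Ideal R :=
    { toFun := fun N => (Submodule.comap (LinearMap.mulLeft R (x ^ N)) I1 : Ideal R)
      monotone' := by
        refine monotone_nat_of_le_succ fun N w hw => ?_
        change x ^ N * w ∈ I1 at hw
        change x ^ (N + 1) * w ∈ I1
        rw [pow_succ', mul_assoc]
        exact Ideal.mul_mem_left _ _ hw }
  obtain ⟨N, hN⟩ := monotone_stabilizes_iff_noetherian.2 (inferInstance : IsNoetherian R R) S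
  have hSmem : ∀ N w, w ∈ S N ↔ x ^ N * w ∈ I1 := fun _ _ => Iff.rfl
  have hsat : ∀ w, x * w ∈ S N → w ∈ S N := by
    intro w hw
    rw [hN (N + 1) (Nat.le_succ N), hSmem, pow_succ, mul_assoc]
    exact hw
  have hzS : z ∈ S N := Ideal.mul_mem_left _ _ hz
  -- choose minimal n
  classical
  have hex := h.pow_y hzS hxz
  have hprin : ∃ g, S N = Ideal.span {g} := by
    have hmin := Nat.find_spec hex
    set n := Nat.find hex with hn
    obtain ⟨g, hg, t, ht, hgt⟩ := Submodule.mem_sup.1 hmin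
    refine ⟨g, le_antisymm ?_ ((Ideal.span_singleton_le_iff_mem _).2 hg)⟩
    have key : S N ≤ Ideal.span {g} ⊔ Ideal.span {x} * S N := by
      intro w hw
      have hdiv : ∀ j, j ≤ n → ∃ p q, w = y ^ j * p + x * q := by
        intro j
        induction j with
        | zero => intro _; exact ⟨w, 0, by simp⟩
        | succ j ih =>
          intro hj
          obtain ⟨p, q, hpq⟩ := ih (by omega)
          rcases unit_or_mem p with hu | hm
          · exfalso
            refine Nat.find_min hex (show j < Nat.find hex by omega) ?_
            obtain ⟨v, hv⟩ := hu.exists_right_inv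
            have : y ^ j = w * v + x * (-(q * v)) := by
              rw [hpq]; linear_combination (-(y ^ j)) * hv
            rw [this]
            exact add_mem (Ideal.mem_sup_left (Ideal.mul_mem_right _ _ hw))
              (Ideal.mem_sup_right (Ideal.mul_mem_right _ _ (Ideal.mem_span_singleton_self _)))
          · rw [h.spn, Ideal.mem_span_pair] at hm
            obtain ⟨p1, p2, rfl⟩ := hm
            exact ⟨p2, q + y ^ j * p1, by rw [hpq]; ring⟩
      obtain ⟨p, q, hpq⟩ := hdiv n le_rfl
      obtain ⟨c, rfl⟩ := Ideal.mem_span_singleton.1 ht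
      have e : w = g * p + x * (c * p + q) := by rw [hpq, ← hgt]; ring
      have h2 : c * p + q ∈ S N := by
        apply hsat
        have : x * (c * p + q) = w - g * p := by rw [e]; ring
        rw [this]
        exact sub_mem hw (Ideal.mul_mem_right _ _ hg)
      rw [e]
      exact add_mem (Ideal.mem_sup_left (Ideal.mul_mem_right _ _ (Ideal.mem_span_singleton_self _)))
        (Ideal.mem_sup_right (Ideal.mul_mem_mul (Ideal.mem_span_singleton_self _) h2))
    refine Submodule.le_of_le_smul_of_le_jacobson_bot (I := Ideal.span {x}) (IsNoetherian.noetherian _) ?_ key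
    rw [IsLocalRing.jacobson_eq_maximalIdeal _ bot_ne_top, Ideal.span_singleton_le_iff_mem]
    exact h.x_mem
  obtain ⟨g, hg⟩ := hprin
  have hdvd : ∀ w ∈ I1, g ∣ w := by
    intro w hw
    rw [← Ideal.mem_span_singleton, ← hg]
    exact Ideal.mul_mem_left _ _ hw
  obtain ⟨I2, hI2, hI2'⟩ := exists_div hdvd
  have hxN : x ^ N ∈ I2 := by
    apply hI2'
    rw [mul_comm, ← hSmem, hg]
    exact Ideal.mem_span_singleton_self _
  obtain ⟨z', rfl⟩ := hdvd z hz
  have hz' : z' ∈ I2 := hI2' _ hz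
  have hxz' : ¬ x ∣ z' := fun hd => hxz (hd.mul_left _)
  obtain ⟨n, hn⟩ := h.pow_y hz' hxz'
  have hyN : y ^ (n * N) ∈ I2 := by
    have h3 := Ideal.pow_mem_pow hn N
    rw [← pow_mul] at h3
    have h4 : (I2 ⊔ Ideal.span {x}) ^ N ≤ I2 := by
      rw [sup_comm]
      refine (sup_pow_le _ _ _).trans ?_
      rw [Ideal.span_singleton_pow]
      exact sup_le ((Ideal.span_singleton_le_iff_mem _).2 hxN) le_rfl
    exact h4 h3
  refine ⟨x ^ k * g, I2, N + n * N, ?_, ?_, ?_⟩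
  · refine mul_ne_zero (pow_ne_zero _ h.prm.ne_zero) ?_
    rintro rfl
    exact hxz (by simp)
  · rw [hI1, hI2, ← mul_assoc, Ideal.span_singleton_mul_span_singleton]
  · rw [h.spn, Ideal.span_insert]
    refine Ideal.sup_pow_add_le_pow_sup_pow.trans ?_
    rw [Ideal.span_singleton_pow, Ideal.span_singleton_pow]
    exact sup_le ((Ideal.span_singleton_le_iff_mem _).2 hxN) ((Ideal.span_singleton_le_iff_mem _).2 hyN)

end P6b

section P6c
variable {R : Type u} [CommRing R] [IsDomain R] [IsNoetherianRing R] [IsLocalRing R]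

lemma span_mul_inj {g : R} (hg : g ≠ 0) {A B : Ideal R} (h : Ideal.span {g} * A = Ideal.span {g} * B) : A = B :=
  (Ideal.span_singleton_mul_right_inj hg).1 h

lemma red_mul_iff {g : R} (hg : g ≠ 0) {A B : Ideal R} :
    IsReduction (Ideal.span {g} * A) (Ideal.span {g} * B) ↔ IsReduction A B := by
  unfold IsReduction
  rw [Ideal.span_singleton_mul_right_mono hg]
  refine and_congr Iff.rfl (exists_congr fun r => ?_)
  have e1 : (Ideal.span {g} * B) ^ (r + 1) = Ideal.span {g ^ (r + 1)} * B ^ (r + 1) := by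
    rw [mul_pow, Ideal.span_singleton_pow]
  have e2 : (Ideal.span {g} * A) * (Ideal.span {g} * B) ^ r = Ideal.span {g ^ (r + 1)} * (A * B ^ r) := by
    rw [mul_pow, ← Ideal.span_singleton_pow]; ring
  rw [e1, e2, Ideal.span_singleton_mul_right_inj (pow_ne_zero _ hg)]

lemma le_span_mul {g : R} {J B : Ideal R} (h : J ≤ Ideal.span {g} * B) : ∃ A : Ideal R, J = Ideal.span {g} * A := by
  obtain ⟨A, hA, -⟩ := exists_div (I := J) (g := g) (fun z hz => by
    obtain ⟨w, -, rfl⟩ := Ideal.mem_span_singleton_mul.1 (h hz)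
    exact dvd_mul_right _ _)
  exact ⟨A, hA⟩

lemma minred_mul_iff {g : R} (hg : g ≠ 0) {A B : Ideal R} :
    IsMinimalReduction (Ideal.span {g} * A) (Ideal.span {g} * B) ↔ IsMinimalReduction A B := by
  unfold IsMinimalReduction
  rw [red_mul_iff hg]
  refine and_congr Iff.rfl ⟨fun h J hJ hJA => ?_, fun h J hJ hJA => ?_⟩
  · exact span_mul_inj hg (h _ ((red_mul_iff hg).2 hJ) (Ideal.mul_mono_right hJA))
  · obtain ⟨J', rfl⟩ := le_span_mul hJA
    rw [h J' ((red_mul_iff hg).1 hJ) ((Ideal.span_singleton_mul_right_mono hg).1 hJA)]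

lemma core_mul {g : R} (hg : g ≠ 0) {B : Ideal R} (hB : ∃ A, IsMinimalReduction A B) :
    core (Ideal.span {g} * B) = Ideal.span {g} * core B := by
  obtain ⟨A, hA⟩ := hB
  ext z
  rw [core, Ideal.mem_sInf, Ideal.mem_span_singleton_mul]
  constructor
  · intro h
    obtain ⟨w, -, rfl⟩ := Ideal.mem_span_singleton_mul.1 (h ((minred_mul_iff hg).2 hA))
    refine ⟨w, ?_, rfl⟩
    rw [core, Ideal.mem_sInf]
    intro J hJ
    obtain ⟨w', hw', e⟩ := Ideal.mem_span_singleton_mul.1 (h ((minred_mul_iff hg).2 hJ))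
    rwa [← mul_left_cancel₀ hg e]
  · rintro ⟨w, hw, rfl⟩ J hJ
    obtain ⟨J', rfl⟩ := le_span_mul hJ.1.1
    rw [core, Ideal.mem_sInf] at hw
    exact Ideal.mul_mem_mul (Ideal.mem_span_singleton_self _) (hw ((minred_mul_iff hg).1 hJ))

lemma closed_of_mul {g : R} (hg : g ≠ 0) {B : Ideal R} (h : IsIntClosedIdeal (Ideal.span {g} * B)) :
    IsIntClosedIdeal B := by
  intro J hJ
  exact span_mul_inj hg (h _ ((red_mul_iff hg).2 hJ))

lemma Par.unit_of_pow_le {x y : R} (h : Par x y) {q : ℕ} {b : R} (hq : maximalIdeal R ^ q ≤ Ideal.span {b}) :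
    IsUnit b :=
  h.unit_of_dvd (Ideal.mem_span_singleton.1 (hq (Ideal.pow_mem_pow h.x_mem q)))
    (Ideal.mem_span_singleton.1 (hq (Ideal.pow_mem_pow h.y_mem q)))

lemma principal_closed (hP : ∃ x y : R, Par x y) {g : R} (hg : g ≠ 0) : IsIntClosedIdeal (Ideal.span {g}) := by
  obtain ⟨x, y, h⟩ := hP
  intro J hJ
  have hgJ : g ∈ J := hJ.1 (Ideal.mem_span_singleton_self _)
  have hJ0 : J ≠ ⊥ := by
    rintro rfl
    exact hg hgJ
  obtain ⟨g', J', q, hg', rfl, hq⟩ := h.factor hJ0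
  obtain ⟨w, hw, rfl⟩ := Ideal.mem_span_singleton_mul.1 hgJ
  rw [← Ideal.span_singleton_mul_span_singleton, red_mul_iff hg'] at hJ
  obtain ⟨q', hq'⟩ := red_primary hJ hq
  have hu := h.unit_of_pow_le hq'
  have e : Ideal.span {w} = ⊤ := Ideal.span_singleton_eq_top.2 hu
  rw [← Ideal.span_singleton_mul_span_singleton, e]
  congr 1
  rw [eq_top_iff, ← e, Ideal.span_singleton_le_iff_mem]
  exact hw

lemma mul_closed (hP : ∃ x y : R, Par x y) {g : R} (hg : g ≠ 0) {B : Ideal R} (h : IsIntClosedIdeal B) :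
    IsIntClosedIdeal (Ideal.span {g} * B) := by
  intro J hJ
  have hdiv : ∀ z ∈ J, g ∣ z := by
    intro z hz
    rw [← Ideal.mem_span_singleton]
    refine mem_of_v (F := FractionRing R) (principal_closed hP hg) fun V hV => ?_
    obtain ⟨i, hi, hv⟩ := v_red hV hJ hz
    obtain ⟨w, hw, rfl⟩ := Ideal.mem_span_singleton_mul.1 hi
    exact ⟨g * w, Ideal.mul_mem_right _ _ (Ideal.mem_span_singleton_self _), hv⟩
  obtain ⟨J', rfl, -⟩ := exists_div hdiv
  rw [h J' ((red_mul_iff hg).1 hJ)]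

lemma core_eq_self {I : Ideal R} (h : ∀ J, IsReduction J I → J = I) : core I = I := by
  have hI : IsReduction I I := ⟨le_rfl, 0, by simp⟩
  rw [core]
  apply le_antisymm
  · exact sInf_le ⟨hI, fun J hJ _ => h J hJ⟩
  · refine le_sInf fun J hJ => ?_
    rw [h J hJ.1]

lemma principal_red {g : R} {J : Ideal R} (hJ : IsReduction J (Ideal.span {g})) : J = Ideal.span {g} := by
  by_cases hg : g = 0
  · subst hg
    have : Ideal.span {(0 : R)} = ⊥ := by simp
    rw [this] at hJ ⊢
    exact le_bot_iff.1 hJ.1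
  · have e : Ideal.span {g} = Ideal.span {g} * ⊤ := by simp
    rw [e] at hJ
    obtain ⟨A, rfl⟩ := le_span_mul hJ.1
    rw [red_top ((red_mul_iff hg).1 hJ)]
    simp

lemma minors_zero {n m : ℕ} (φ : Matrix (Fin n) (Fin m) R) : minorsIdeal 0 φ = ⊤ := by
  rw [Ideal.eq_top_iff_one]
  refine Ideal.subset_span ⟨Fin.elim0, Fin.elim0, ?_⟩
  simp

lemma div_pres {n : ℕ} {g : R} (hg : g ≠ 0) {I' : Ideal R} (π : (Fin n → R) →ₗ[R] R)
    (h : LinearMap.range π = Ideal.span {g} * I') :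
    ∃ π' : (Fin n → R) →ₗ[R] R, LinearMap.range π' = I' ∧ LinearMap.ker π' = LinearMap.ker π := by
  have h1 : ∀ i, ∃ w, g * w = π (Pi.single i 1) := by
    intro i
    have : π (Pi.single i 1) ∈ Ideal.span {g} * I' := by
      rw [← h]; exact LinearMap.mem_range_self _ _
    obtain ⟨w, -, e⟩ := Ideal.mem_span_singleton_mul.1 this
    exact ⟨w, e⟩
  choose w hw using h1
  have hπ : ∀ f, π f = g * (Fintype.linearCombination R w) f := by
    intro f
    have : π = g • (Fintype.linearCombination R w) := by
      apply LinearMap.pi_ext'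
      intro i
      ext
      simp [← hw, Fintype.linearCombination_apply_single]
    rw [this]; rfl
  refine ⟨Fintype.linearCombination R w, ?_, ?_⟩
  · ext z
    constructor
    · rintro ⟨f, rfl⟩
      have : π f ∈ Ideal.span {g} * I' := by
        rw [← h]; exact LinearMap.mem_range_self _ _
      obtain ⟨w', hw', e⟩ := Ideal.mem_span_singleton_mul.1 this
      rw [hπ] at e
      rwa [← mul_left_cancel₀ hg e]
    · intro hz
      have : g * z ∈ Ideal.span {g} * I' := Ideal.mul_mem_mul (Ideal.mem_span_singleton_self _) hz
      rw [← h] at this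
      obtain ⟨f, hf⟩ := this
      rw [hπ] at hf
      exact ⟨f, mul_left_cancel₀ hg hf⟩
  · ext f
    rw [LinearMap.mem_ker, LinearMap.mem_ker, hπ]
    simp [hg]

theorem final_aux [Infinite (ResidueField R)] (hP : ∃ x y : R, Par x y) (I : Ideal R) (hI : IsIntClosedIdeal I)
    {n m : ℕ} (φ : Matrix (Fin n) (Fin m) R) (hφ : Presents φ I) :
    core I = minorsIdeal (n - 2) φ * I ∧
    IsIntClosedIdeal (minorsIdeal (n - 2) φ) ∧ IsIntClosedIdeal (core I) := by
  obtain ⟨hmu, π, hr, hker⟩ := hφ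
  by_cases hn : n ≤ 1
  · have hpr : ∃ g, I = Ideal.span {g} := by
      obtain ⟨s, hs, hspan⟩ := exists_gens_of_muE hmu
      have : s.card ≤ 1 := hs ▸ hn
      obtain ⟨g, hg⟩ := Finset.card_le_one_iff_subset_singleton.1 this
      rcases Finset.subset_singleton_iff.1 hg with rfl | rfl
      · exact ⟨0, by rw [← hspan]; simp⟩
      · exact ⟨g, by rw [← hspan]; simp [Ideal.span]⟩
    have h2 : n - 2 = 0 := by omega
    rw [h2, minors_zero]
    have hc : core I = I := by
      obtain ⟨g, rfl⟩ := hpr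
      exact core_eq_self fun J hJ => principal_red hJ
    rw [hc]
    exact ⟨by simp, fun J hJ => top_le_iff.1 hJ.1, hI⟩
  · obtain ⟨k, rfl⟩ : ∃ k, n = k + 2 := ⟨n - 2, by omega⟩
    rw [Nat.add_sub_cancel]
    have hI0 : I ≠ ⊥ := by
      rintro rfl
      have : muE (⊥ : Ideal R) ≤ 0 := sInf_le ⟨∅, by simp, by simp⟩
      rw [hmu] at this
      simp at this
    obtain ⟨x, y, h⟩ := id hP
    obtain ⟨g, I', q, hg, rfl, hq⟩ := h.factor hI0
    obtain ⟨π', hr', hk'⟩ := div_pres hg π hr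
    obtain ⟨h1, h2, h3⟩ := primary_case hP φ π' (hker.trans hk'.symm) hr' (closed_of_mul hg hI) hq
    obtain ⟨a, b, hab⟩ := exists_red hP hq
    rw [core_mul hg ⟨_, pair_isMin hP hq hab⟩]
    refine ⟨?_, h2, mul_closed hP hg h3⟩
    rw [h1]; ring

end P6c



/-- Corollary 3.5 (Huneke–Swanson): for an integrally closed ideal in a
two-dimensional regular local ring with infinite residue field,
`core I = I_{n-2}(φ)·I`, and `I_{n-2}(φ)` and `core I` are integrally closed. -/
theorem statement11 {R : Type u} [CommRing R] [IsNoetherianRing R] [IsLocalRing R]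
    (hreg : IsRegularLocal R) (hdim : rDim R = 2)
    (hres : Infinite (ResidueField R))
    (I : Ideal R) (hI : IsIntClosedIdeal I)
    {n m : ℕ} (φ : Matrix (Fin n) (Fin m) R) (hφ : Presents φ I) :
    core I = minorsIdeal (n - 2) φ * I ∧
    IsIntClosedIdeal (minorsIdeal (n - 2) φ) ∧ IsIntClosedIdeal (core I) := by
  haveI := hres
  obtain ⟨hd, hP⟩ := init_reg hreg hdim
  exact final_aux hP I hI φ hφ

end CPU
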